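/- arXiv:math/0612494 — 2 statements merged into one kernel-verified Lean document; each statement's English description precedes it below -/
import Mathlib

section
/- Assume L > 4/√3 and let σ₀ = max{ μ(μ−1)(2−μ)/2 : μ ∈ (1,2) and (√3 L/4) μ(2−μ) ∈ ℤ }. Let s ≥ 1 be an integer, K > 0 and γ₀ > σ₀. Then there exists C > 0 such that for every τ ∈ ℝ, every k ∈ ℤ with |k/L| ≤ K, and all complex-valued Schwartz functions w, W, H on ℝ with W' = w, satisfying the resolvent equation (γ₀ + iτ) w − w' + (Q w)' + w''' + (k²/L²) W = H', one has ‖w‖_{H^s(ℝ)}² ≤ C ‖H‖_{H^{s+1}(ℝ)}². -/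
open MeasureTheory

/-- The KdV soliton profile `Q(x) = 3 sech²(x/2)`. -/
noncomputable def Q (x : ℝ) : ℝ := 3 * (1 / Real.cosh (x / 2)) ^ 2

/-- The maximal unstable growth rate `σ₀ = max{ μ(μ−1)(2−μ)/2 : μ ∈ (1,2),
(√3 L/4) μ(2−μ) ∈ ℤ }`. -/
noncomputable def sigma0 (L : ℝ) : ℝ :=
  sSup {x : ℝ | ∃ μ : ℝ, 1 < μ ∧ μ < 2 ∧ x = μ * (μ - 1) * (2 - μ) / 2 ∧
    ∃ k : ℤ, (k : ℝ) = Real.sqrt 3 * L / 4 * (μ * (2 - μ))}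

/-- The squared `H^s(ℝ)` norm `Σ_{m ≤ s} ‖∂ₓ^m f‖²_{L²}`. -/
noncomputable def HsSq (s : ℕ) (f : ℝ → ℂ) : ℝ :=
  ∑ m ∈ Finset.range (s + 1), ∫ x : ℝ, ‖iteratedDeriv m f x‖ ^ 2

/-- The resolvent equation `(γ₀ + iτ) w − w' + (Qw)' + w''' + (k²/L²) W = H'`
on the transverse mode `k/L`, where `W` is the antiderivative of `w`. -/
def ResolventEq (L γ₀ τ : ℝ) (k : ℤ) (w W H : ℝ → ℂ) : Prop :=
  (∀ x : ℝ, deriv W x = w x) ∧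
  ∀ x : ℝ, ((γ₀ : ℂ) + τ * Complex.I) * w x - deriv w x
      + deriv (fun y : ℝ => (Q y : ℂ) * w y) x + iteratedDeriv 3 w x
      + (((k : ℝ) ^ 2 / L ^ 2 : ℝ) : ℂ) * W x = deriv H x


/-! ## Module 1: basics -/

open scoped SchwartzMap ContDiff

noncomputable def th (x : ℝ) : ℝ := Real.tanh (x / 2)

theorem th_hasDerivAt (x : ℝ) : HasDerivAt th ((1 - th x ^ 2) / 2) x := by
  have hc : Real.cosh (x / 2) ≠ 0 := (Real.cosh_pos _).ne'
  have h2 : HasDerivAt (fun x : ℝ => x / 2) (1 / 2) x := (hasDerivAt_id x).div_const 2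
  have h := (h2.sinh).div (h2.cosh) hc
  have e : th = fun x => Real.sinh (x / 2) / Real.cosh (x / 2) := by
    funext y; simp [th, Real.tanh_eq_sinh_div_cosh]
  refine (h.congr_deriv (g' := (1 - th x ^ 2) / 2) ?_).congr_of_eventuallyEq
    (Filter.Eventually.of_forall fun y => congrFun e y)
  simp only [th, Real.tanh_eq_sinh_div_cosh]
  field_simp

theorem th_sq_lt (x : ℝ) : th x ^ 2 < 1 := by
  have := Real.abs_tanh_lt_one (x / 2)
  rw [abs_lt] at this
  unfold th
  nlinarith [this.1, this.2]

theorem th_lt_one (x : ℝ) : th x < 1 := by nlinarith [th_sq_lt x]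
theorem neg_one_lt_th (x : ℝ) : -1 < th x := by nlinarith [th_sq_lt x]

theorem th_zero : th 0 = 0 := by simp [th]

theorem th_neg (x : ℝ) : th (-x) = - th x := by
  simp [th, neg_div, Real.tanh_neg]

theorem th_differentiable : Differentiable ℝ th := fun x => (th_hasDerivAt x).differentiableAt

theorem th_continuous : Continuous th := th_differentiable.continuous

theorem Q_eq (x : ℝ) : Q x = 3 * (1 - th x ^ 2) := by
  have hc : Real.cosh (x / 2) ≠ 0 := (Real.cosh_pos _).ne'
  have := Real.cosh_sq (x / 2)
  unfold Q th
  rw [Real.tanh_eq_sinh_div_cosh]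
  field_simp
  linarith

theorem th_iter (n : ℕ) : ∃ p : Polynomial ℝ, iteratedDeriv n th = fun x => p.eval (th x) := by
  induction n with
  | zero => exact ⟨Polynomial.X, by simp [iteratedDeriv_zero]⟩
  | succ n ih =>
    obtain ⟨p, hp⟩ := ih
    refine ⟨p.derivative * (Polynomial.C (1/2) * (1 - Polynomial.X ^ 2)), ?_⟩
    funext x
    rw [iteratedDeriv_succ, hp]
    have := ((p.hasDerivAt (th x)).comp x (th_hasDerivAt x)).deriv
    simp only [Function.comp_def] at this
    rw [this]
    simp only [Polynomial.eval_mul, Polynomial.eval_C, Polynomial.eval_sub, Polynomial.eval_one,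
      Polynomial.eval_pow, Polynomial.eval_X]
    ring

theorem th_contDiff : ContDiff ℝ ∞ th := by
  have e : th = fun x => Real.sinh (x / 2) / Real.cosh (x / 2) := by
    funext y; simp [th, Real.tanh_eq_sinh_div_cosh]
  rw [e]
  apply ContDiff.div
  · exact Real.contDiff_sinh.comp (by fun_prop)
  · exact Real.contDiff_cosh.comp (by fun_prop)
  · intro x; exact (Real.cosh_pos _).ne'

theorem th_temperate : th.HasTemperateGrowth := by
  refine ⟨th_contDiff, fun n => ?_⟩
  obtain ⟨p, hp⟩ := th_iter n
  obtain ⟨C, hC⟩ := (isCompact_Icc (a := (-1:ℝ)) (b := 1)).exists_bound_of_continuousOn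
    (f := fun y => p.eval y) p.continuous.continuousOn
  refine ⟨0, C, fun x => ?_⟩
  rw [norm_iteratedFDeriv_eq_norm_iteratedDeriv, hp]
  simpa using hC (th x) ⟨(neg_one_lt_th x).le, (th_lt_one x).le⟩

/-- complex valued version -/
noncomputable def T (x : ℝ) : ℂ := (th x : ℂ)

theorem T_temperate : T.HasTemperateGrowth :=
  Function.HasTemperateGrowth.comp Function.Complex.hasTemperateGrowth_ofReal th_temperate

theorem T_hasDerivAt (x : ℝ) : HasDerivAt T ((1 - T x ^ 2) / 2) x := by
  have := (th_hasDerivAt x).ofReal_comp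
  unfold T
  convert this using 1
  push_cast; ring

theorem T_norm_le (x : ℝ) : ‖T x‖ ≤ 1 := by
  unfold T
  rw [Complex.norm_real, Real.norm_eq_abs, abs_le]
  exact ⟨(neg_one_lt_th x).le, (th_lt_one x).le⟩

noncomputable def dS (f : 𝓢(ℝ, ℂ)) : 𝓢(ℝ, ℂ) := SchwartzMap.derivCLM ℂ ℂ f
noncomputable def tS (f : 𝓢(ℝ, ℂ)) : 𝓢(ℝ, ℂ) := SchwartzMap.smulLeftCLM ℂ T f

theorem dS_apply (f : 𝓢(ℝ, ℂ)) (x : ℝ) : dS f x = deriv f x := by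
  simp [dS]

theorem tS_apply (f : 𝓢(ℝ, ℂ)) (x : ℝ) : tS f x = T x * f x := by
  simp [tS, SchwartzMap.smulLeftCLM_apply_apply T_temperate]

theorem dS_hasDerivAt (f : 𝓢(ℝ, ℂ)) (x : ℝ) : HasDerivAt f (dS f x) x := by
  rw [dS_apply]; exact f.differentiableAt.hasDerivAt

theorem dS_coe (f : 𝓢(ℝ, ℂ)) : ⇑(dS f) = deriv f := funext (dS_apply f)

theorem dS_add (f g : 𝓢(ℝ, ℂ)) : dS (f + g) = dS f + dS g := by simp [dS]
theorem dS_sub (f g : 𝓢(ℝ, ℂ)) : dS (f - g) = dS f - dS g := by simp [dS]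
theorem dS_neg (f : 𝓢(ℝ, ℂ)) : dS (-f) = - dS f := by simp [dS]
theorem dS_smul (c : ℂ) (f : 𝓢(ℝ, ℂ)) : dS (c • f) = c • dS f := by simp [dS]
theorem tS_add (f g : 𝓢(ℝ, ℂ)) : tS (f + g) = tS f + tS g := by simp [tS]
theorem tS_sub (f g : 𝓢(ℝ, ℂ)) : tS (f - g) = tS f - tS g := by simp [tS]
theorem tS_neg (f : 𝓢(ℝ, ℂ)) : tS (-f) = - tS f := by simp [tS]
theorem tS_smul (c : ℂ) (f : 𝓢(ℝ, ℂ)) : tS (c • f) = c • tS f := by simp [tS]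

theorem dS_tS (f : 𝓢(ℝ, ℂ)) : dS (tS f) = tS (dS f) + (1/2 : ℂ) • (f - tS (tS f)) := by
  ext x
  have h := (T_hasDerivAt x).mul (dS_hasDerivAt f x)
  have e : ⇑(tS f) = T * ⇑f := by funext y; simp [tS_apply]
  rw [dS_apply, e, h.deriv]
  simp [tS_apply]
  ring

/-- pointwise L2 norm squared -/
noncomputable def N (f : ℝ → ℂ) : ℝ := ∫ x : ℝ, ‖f x‖ ^ 2

def L2 (f : ℝ → ℂ) : Prop := Continuous f ∧ Integrable (fun x => ‖f x‖ ^ 2)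

theorem N_nonneg (f : ℝ → ℂ) : 0 ≤ N f := integral_nonneg fun x => by positivity

theorem L2_S (f : 𝓢(ℝ, ℂ)) : L2 f := by
  refine ⟨f.continuous, ?_⟩
  have := (f.memLp 2).integrable_norm_pow (by norm_num)
  simpa using this

theorem HsSq_zero (f : ℝ → ℂ) : HsSq 0 f = N f := by simp [HsSq, N]

theorem HsSq_nonneg (m : ℕ) (f : ℝ → ℂ) : 0 ≤ HsSq m f :=
  Finset.sum_nonneg fun _ _ => integral_nonneg fun x => by positivity

theorem HsSq_succ' (m : ℕ) (f : ℝ → ℂ) : HsSq (m+1) f = N f + HsSq m (deriv f) := by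
  unfold HsSq
  rw [Finset.sum_range_succ']
  simp only [iteratedDeriv_succ', N, iteratedDeriv_zero]
  ring

theorem HsSq_succ (m : ℕ) (f : 𝓢(ℝ, ℂ)) : HsSq (m+1) f = N f + HsSq m (dS f) := by
  rw [HsSq_succ', dS_coe]

theorem HsSq_mono {m n : ℕ} (h : m ≤ n) (f : ℝ → ℂ) : HsSq m f ≤ HsSq n f := by
  unfold HsSq
  apply Finset.sum_le_sum_of_subset_of_nonneg
  · intro i; simp; omega
  · intros; exact integral_nonneg fun x => by positivity

theorem N_le_HsSq (m : ℕ) (f : ℝ → ℂ) : N f ≤ HsSq m f := by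
  rw [← HsSq_zero]; exact HsSq_mono (Nat.zero_le _) f

theorem HsSq_dS_le (m : ℕ) (f : 𝓢(ℝ, ℂ)) : HsSq m (dS f) ≤ HsSq (m+1) f := by
  rw [HsSq_succ]; linarith [N_nonneg f]

theorem L2_add {f g : ℝ → ℂ} (hf : L2 f) (hg : L2 g) : L2 (fun x => f x + g x) := by
  have hc := hf.1.add hg.1
  refine ⟨hc, ((hf.2.add hg.2).const_mul 2).mono' (by
    exact (hc.norm.pow 2).aestronglyMeasurable) (Filter.Eventually.of_forall fun x => ?_)⟩
  have := norm_add_le (f x) (g x)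
  simp only [Pi.add_apply, norm_pow, norm_norm]
  nlinarith [sq_nonneg (‖f x‖ - ‖g x‖), norm_nonneg (f x + g x), norm_nonneg (f x), norm_nonneg (g x)]

theorem L2_mul_bdd {f g : ℝ → ℂ} {M : ℝ} (hf : Continuous f) (hM : ∀ x, ‖f x‖ ≤ M) (hg : L2 g) :
    L2 (fun x => f x * g x) := by
  have hc := hf.mul hg.1
  refine ⟨hc, (hg.2.const_mul (M^2)).mono' (by
    exact (hc.norm.pow 2).aestronglyMeasurable) (Filter.Eventually.of_forall fun x => ?_)⟩
  have := hM x
  simp only [norm_pow, norm_norm, norm_mul, mul_pow]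
  have h0 := norm_nonneg (f x)
  gcongr

theorem L2_const_mul {g : ℝ → ℂ} (c : ℂ) (hg : L2 g) : L2 (fun x => c * g x) :=
  L2_mul_bdd (f := fun _ => c) continuous_const (fun _ => le_rfl) hg

theorem L2_neg {g : ℝ → ℂ} (hg : L2 g) : L2 (fun x => - g x) := by
  simpa using L2_const_mul (-1) hg

theorem L2_sub {f g : ℝ → ℂ} (hf : L2 f) (hg : L2 g) : L2 (fun x => f x - g x) := by
  simpa [sub_eq_add_neg] using L2_add hf (L2_neg hg)

theorem L2_T {g : ℝ → ℂ} (hg : L2 g) : L2 (fun x => T x * g x) :=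
  L2_mul_bdd T_temperate.1.continuous T_norm_le hg

theorem N_add_le {f g : ℝ → ℂ} (hf : L2 f) (hg : L2 g) :
    N (fun x => f x + g x) ≤ 2 * (N f + N g) := by
  unfold N
  rw [← integral_add hf.2 hg.2, ← integral_const_mul]
  apply integral_mono (L2_add hf hg).2 ((hf.2.add hg.2).const_mul 2)
  intro x
  have := norm_add_le (f x) (g x)
  simp only [Pi.add_apply]
  nlinarith [sq_nonneg (‖f x‖ - ‖g x‖), norm_nonneg (f x + g x), norm_nonneg (f x), norm_nonneg (g x)]

theorem N_mul_bdd {f g : ℝ → ℂ} {M : ℝ} (hf : Continuous f) (hM : ∀ x, ‖f x‖ ≤ M) (hg : L2 g) :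
    N (fun x => f x * g x) ≤ M^2 * N g := by
  unfold N
  rw [← integral_const_mul]
  apply integral_mono (L2_mul_bdd hf hM hg).2 (hg.2.const_mul _)
  intro x
  have := hM x
  simp only [norm_mul, mul_pow]
  have h0 := norm_nonneg (f x)
  gcongr

theorem N_const_mul (c : ℂ) (g : ℝ → ℂ) : N (fun x => c * g x) = ‖c‖^2 * N g := by
  unfold N
  rw [← integral_const_mul]
  congr 1; funext x; simp [mul_pow]

theorem N_neg (g : ℝ → ℂ) : N (fun x => - g x) = N g := by
  unfold N; simp

theorem N_sub_le {f g : ℝ → ℂ} (hf : L2 f) (hg : L2 g) :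
    N (fun x => f x - g x) ≤ 2 * (N f + N g) := by
  have := N_add_le hf (L2_neg hg)
  rw [N_neg] at this
  simpa [sub_eq_add_neg] using this

theorem N_T {g : ℝ → ℂ} (hg : L2 g) : N (fun x => T x * g x) ≤ N g := by
  simpa using N_mul_bdd T_temperate.1.continuous T_norm_le hg

theorem L2_mul_integrable {f g : ℝ → ℂ} (hf : L2 f) (hg : L2 g) :
    Integrable (fun x => f x * g x) := by
  have hc := hf.1.mul hg.1
  refine (hf.2.add hg.2).mono' hc.aestronglyMeasurable (Filter.Eventually.of_forall fun x => ?_)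
  simp only [norm_mul, Pi.add_apply]
  nlinarith [sq_nonneg (‖f x‖ - ‖g x‖), norm_nonneg (f x), norm_nonneg (g x)]

/-- Cauchy-Schwarz -/
theorem norm_integral_mul_sq_le {f g : ℝ → ℂ} (hf : L2 f) (hg : L2 g) :
    ‖∫ x, f x * g x‖ ^ 2 ≤ N f * N g := by
  have hI := L2_mul_integrable hf hg
  have h1 : ‖∫ x, f x * g x‖ ≤ ∫ x, ‖f x‖ * ‖g x‖ := by
    refine (norm_integral_le_integral_norm _).trans (le_of_eq ?_)
    simp
  have hI' : Integrable (fun x => ‖f x‖ * ‖g x‖) := by simpa using hI.norm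
  have key : ∀ s : ℝ, 0 ≤ N g * (s * s) + (2 * ∫ x, ‖f x‖ * ‖g x‖) * s + N f := by
    intro s
    have : 0 ≤ ∫ x, (‖f x‖ + s * ‖g x‖)^2 := integral_nonneg fun x => by positivity
    have e : (fun x => (‖f x‖ + s * ‖g x‖)^2) = fun x => (‖f x‖^2 + (2*s) * (‖f x‖ * ‖g x‖)) + s^2 * ‖g x‖^2 := by
      funext x; ring
    have hA : Integrable (fun x => ‖f x‖^2 + (2*s) * (‖f x‖ * ‖g x‖)) := hf.2.add (hI'.const_mul _)
    rw [e, integral_add hA (hg.2.const_mul _),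
      integral_add hf.2 (hI'.const_mul _), integral_const_mul, integral_const_mul] at this
    unfold N
    linarith
  have hd := discrim_le_zero key
  unfold discrim at hd
  have h0 : 0 ≤ ‖∫ x, f x * g x‖ := norm_nonneg _
  nlinarith

theorem HsSq_add_le (m : ℕ) (f g : 𝓢(ℝ, ℂ)) : HsSq m (f + g : 𝓢(ℝ, ℂ)) ≤ 2 * (HsSq m f + HsSq m g) := by
  induction m generalizing f g with
  | zero => simp only [HsSq_zero]; exact N_add_le (L2_S f) (L2_S g)
  | succ m ih =>
    simp only [HsSq_succ, dS_add]
    have h1 := ih (dS f) (dS g)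
    have h2 : N (f + g : 𝓢(ℝ, ℂ)) ≤ _ := N_add_le (L2_S f) (L2_S g)
    linarith

theorem HsSq_smul (m : ℕ) (c : ℂ) (f : 𝓢(ℝ, ℂ)) : HsSq m (c • f : 𝓢(ℝ, ℂ)) = ‖c‖^2 * HsSq m f := by
  induction m generalizing f with
  | zero => simp only [HsSq_zero]; exact N_const_mul c f
  | succ m ih =>
    simp only [HsSq_succ, dS_smul, ih]
    have h2 : N (c • f : 𝓢(ℝ, ℂ)) = _ := N_const_mul c f
    rw [h2]; ring

theorem HsSq_neg (m : ℕ) (f : 𝓢(ℝ, ℂ)) : HsSq m (-f : 𝓢(ℝ, ℂ)) = HsSq m f := by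
  have := HsSq_smul m (-1) f
  simpa using this

theorem HsSq_sub_le (m : ℕ) (f g : 𝓢(ℝ, ℂ)) : HsSq m (f - g : 𝓢(ℝ, ℂ)) ≤ 2 * (HsSq m f + HsSq m g) := by
  have := HsSq_add_le m f (-g)
  rw [HsSq_neg] at this
  rwa [sub_eq_add_neg]

theorem HsSq_tS (m : ℕ) : ∃ C : ℝ, 0 ≤ C ∧ ∀ f : 𝓢(ℝ, ℂ), HsSq m (tS f) ≤ C * HsSq m f := by
  have hN : ∀ f : 𝓢(ℝ, ℂ), N (tS f) ≤ N f := by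
    intro f
    have e : ⇑(tS f) = fun x => T x * f x := by funext y; simp [tS_apply]
    rw [e]; exact N_T (L2_S f)
  induction m with
  | zero => exact ⟨1, by norm_num, fun f => by simpa [HsSq_zero] using hN f⟩
  | succ m ih =>
    obtain ⟨C, hC0, hC⟩ := ih
    refine ⟨2 * C + 1 + 1 + C * C, by positivity, fun f => ?_⟩
    have h1 := hC (dS f)
    have h2 := hC f
    have h3 := hC (tS f)
    have h4 := HsSq_add_le m (tS (dS f)) ((1/2 : ℂ) • (f - tS (tS f)))
    have h5 := HsSq_sub_le m f (tS (tS f))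
    rw [HsSq_smul] at h4
    have e : ‖(1/2 : ℂ)‖^2 = 1/4 := by norm_num
    rw [e] at h4
    have h6 := mul_le_mul_of_nonneg_left h2 hC0
    have h7 := HsSq_mono (Nat.le_succ m) f
    have h8 := mul_le_mul_of_nonneg_left h7 (mul_nonneg hC0 hC0)
    have h10 := HsSq_succ m f
    have h11 := hN f
    have h12 := HsSq_nonneg m (dS f)
    have h14 := N_nonneg f
    have h15 : C * HsSq m (dS f) ≤ C * HsSq (m+1) f := by
      apply mul_le_mul_of_nonneg_left _ hC0; linarith
    rw [HsSq_succ, dS_tS]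
    simp only [Nat.succ_eq_add_one] at *
    nlinarith

/-! ### Domination calculus -/

section dom
variable {ι : Type}

/-- family of Schwartz functions bounded in `H^m` by `R` -/
def B (R : ι → ℝ) (m : ℕ) (F : ι → 𝓢(ℝ, ℂ)) : Prop := ∃ C : ℝ, 0 ≤ C ∧ ∀ i, HsSq m (F i) ≤ C * R i

/-- family of functions bounded in `L²` by `R` -/
def BN (R : ι → ℝ) (F : ι → ℝ → ℂ) : Prop :=
  (∀ i, L2 (F i)) ∧ ∃ C : ℝ, 0 ≤ C ∧ ∀ i, N (F i) ≤ C * R i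

/-- family of numbers bounded by `R` -/
def Bc (R : ι → ℝ) (c : ι → ℂ) : Prop := ∃ C : ℝ, 0 ≤ C ∧ ∀ i, ‖c i‖ ^ 2 ≤ C * R i

variable {R : ι → ℝ}

theorem B.add {m : ℕ} {F G : ι → 𝓢(ℝ, ℂ)} (hF : B R m F) (hG : B R m G) : B R m (fun i => F i + G i) := by
  obtain ⟨C, hC, h⟩ := hF
  obtain ⟨D, hD, h'⟩ := hG
  exact ⟨2 * (C + D), by positivity, fun i => by
    linarith [HsSq_add_le m (F i) (G i), h i, h' i]⟩

theorem B.sub {m : ℕ} {F G : ι → 𝓢(ℝ, ℂ)} (hF : B R m F) (hG : B R m G) : B R m (fun i => F i - G i) := by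
  obtain ⟨C, hC, h⟩ := hF
  obtain ⟨D, hD, h'⟩ := hG
  exact ⟨2 * (C + D), by positivity, fun i => by
    linarith [HsSq_sub_le m (F i) (G i), h i, h' i]⟩

theorem B.neg {m : ℕ} {F : ι → 𝓢(ℝ, ℂ)} (hF : B R m F) : B R m (fun i => - F i) := by
  obtain ⟨C, hC, h⟩ := hF
  exact ⟨C, hC, fun i => by rw [HsSq_neg]; exact h i⟩

theorem B.smul {m : ℕ} {F : ι → 𝓢(ℝ, ℂ)} (c : ℂ) (hF : B R m F) : B R m (fun i => c • F i) := by
  obtain ⟨C, hC, h⟩ := hF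
  exact ⟨‖c‖^2 * C, by positivity, fun i => by
    rw [HsSq_smul, mul_assoc]; exact mul_le_mul_of_nonneg_left (h i) (by positivity)⟩

theorem B.tS {m : ℕ} {F : ι → 𝓢(ℝ, ℂ)} (hF : B R m F) : B R m (fun i => tS (F i)) := by
  obtain ⟨C, hC, h⟩ := hF
  obtain ⟨D, hD, h'⟩ := HsSq_tS m
  exact ⟨D * C, by positivity, fun i => by
    rw [mul_assoc]; exact (h' (F i)).trans (mul_le_mul_of_nonneg_left (h i) hD)⟩

theorem B.dS {m : ℕ} {F : ι → 𝓢(ℝ, ℂ)} (hF : B R (m+1) F) : B R m (fun i => dS (F i)) := by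
  obtain ⟨C, hC, h⟩ := hF
  exact ⟨C, hC, fun i => (HsSq_dS_le m (F i)).trans (h i)⟩

theorem B.mono {m n : ℕ} (hmn : m ≤ n) {F : ι → 𝓢(ℝ, ℂ)} (hF : B R n F) : B R m F := by
  obtain ⟨C, hC, h⟩ := hF
  exact ⟨C, hC, fun i => (HsSq_mono hmn (F i)).trans (h i)⟩

theorem B.succ {m : ℕ} {F : ι → 𝓢(ℝ, ℂ)} (h0 : B R 0 F) (hF : B R m (fun i => _root_.dS (F i))) :
    B R (m+1) F := by
  obtain ⟨C, hC, h⟩ := h0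
  obtain ⟨D, hD, h'⟩ := hF
  refine ⟨C + D, by positivity, fun i => ?_⟩
  have := h i
  have := h' i
  rw [HsSq_succ, ← HsSq_zero]; linarith

theorem B.toBN {m : ℕ} {F : ι → 𝓢(ℝ, ℂ)} (hF : B R m F) : BN R (fun i => ⇑(F i)) := by
  obtain ⟨C, hC, h⟩ := hF
  exact ⟨fun i => L2_S _, C, hC, fun i => (N_le_HsSq m _).trans (h i)⟩

theorem BN.toB {F : ι → 𝓢(ℝ, ℂ)} (hF : BN R (fun i => ⇑(F i))) : B R 0 F := by
  obtain ⟨_, C, hC, h⟩ := hF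
  exact ⟨C, hC, fun i => by rw [HsSq_zero]; exact h i⟩

theorem B.trans {R' : ι → ℝ} {m : ℕ} {F : ι → 𝓢(ℝ, ℂ)} (hF : B R' m F)
    (hR : ∃ C : ℝ, 0 ≤ C ∧ ∀ i, R' i ≤ C * R i) : B R m F := by
  obtain ⟨C, hC, h⟩ := hF
  obtain ⟨D, hD, h'⟩ := hR
  exact ⟨C * D, by positivity, fun i => (h i).trans (by
    rw [mul_assoc]; exact mul_le_mul_of_nonneg_left (h' i) hC)⟩

theorem BN.add {F G : ι → ℝ → ℂ} (hF : BN R F) (hG : BN R G) : BN R (fun i x => F i x + G i x) := by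
  obtain ⟨l, C, hC, h⟩ := hF
  obtain ⟨l', D, hD, h'⟩ := hG
  exact ⟨fun i => L2_add (l i) (l' i), 2 * (C + D), by positivity, fun i => by
    linarith [N_add_le (l i) (l' i), h i, h' i]⟩

theorem BN.sub {F G : ι → ℝ → ℂ} (hF : BN R F) (hG : BN R G) : BN R (fun i x => F i x - G i x) := by
  obtain ⟨l, C, hC, h⟩ := hF
  obtain ⟨l', D, hD, h'⟩ := hG
  exact ⟨fun i => L2_sub (l i) (l' i), 2 * (C + D), by positivity, fun i => by
    linarith [N_sub_le (l i) (l' i), h i, h' i]⟩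

theorem BN.mul_bdd {f : ℝ → ℂ} {M : ℝ} {F : ι → ℝ → ℂ} (hf : Continuous f) (hM : ∀ x, ‖f x‖ ≤ M)
    (hF : BN R F) : BN R (fun i x => f x * F i x) := by
  obtain ⟨l, C, hC, h⟩ := hF
  exact ⟨fun i => L2_mul_bdd hf hM (l i), M^2 * C, by positivity, fun i => by
    refine (N_mul_bdd hf hM (l i)).trans ?_
    rw [mul_assoc]; exact mul_le_mul_of_nonneg_left (h i) (by positivity)⟩

theorem BN.const_mul {F : ι → ℝ → ℂ} (c : ℂ) (hF : BN R F) : BN R (fun i x => c * F i x) :=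
  BN.mul_bdd (f := fun _ => c) continuous_const (fun _ => le_rfl) hF

theorem BN.T {F : ι → ℝ → ℂ} (hF : BN R F) : BN R (fun i x => T x * F i x) :=
  BN.mul_bdd T_temperate.1.continuous T_norm_le hF

theorem BN.of_Bc {c : ι → ℂ} {f : ℝ → ℂ} (hc : Bc R c) (hf : L2 f) : BN R (fun i x => c i * f x) := by
  obtain ⟨C, hC, h⟩ := hc
  have := N_nonneg f
  exact ⟨fun i => L2_const_mul _ hf, C * N f, by positivity, fun i => by
    rw [N_const_mul]
    nlinarith [h i]⟩

theorem Bc.of_BN {F : ι → ℝ → ℂ} {f : ℝ → ℂ} (hF : BN R F) (hf : L2 f) :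
    Bc R (fun i => ∫ x, F i x * f x) := by
  obtain ⟨l, C, hC, h⟩ := hF
  have := N_nonneg f
  exact ⟨C * N f, by positivity, fun i => (norm_integral_mul_sq_le (l i) hf).trans (by nlinarith [h i])⟩

theorem Bc.add {c d : ι → ℂ} (hc : Bc R c) (hd : Bc R d) : Bc R (fun i => c i + d i) := by
  obtain ⟨C, hC, h⟩ := hc
  obtain ⟨D, hD, h'⟩ := hd
  refine ⟨2 * (C + D), by positivity, fun i => ?_⟩
  have := norm_add_le (c i) (d i)
  nlinarith [sq_nonneg (‖c i‖ - ‖d i‖), h i, h' i, norm_nonneg (c i + d i), norm_nonneg (c i), norm_nonneg (d i)]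

theorem Bc.of_le {c d : ι → ℂ} (M : ℝ) (hc : Bc R c) (h' : ∀ i, ‖d i‖ ≤ M * ‖c i‖) : Bc R d := by
  obtain ⟨C, hC, h⟩ := hc
  refine ⟨M^2 * C, by positivity, fun i => ?_⟩
  have h1 : ‖d i‖^2 ≤ (M * ‖c i‖)^2 := by gcongr; exact h' i
  have h2 := mul_le_mul_of_nonneg_left (h i) (sq_nonneg M)
  nlinarith

theorem Bc.const_mul {c : ι → ℂ} (a : ℂ) (hc : Bc R c) : Bc R (fun i => a * c i) :=
  Bc.of_le ‖a‖ hc fun i => by simp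

theorem Bc.sub {c d : ι → ℂ} (hc : Bc R c) (hd : Bc R d) : Bc R (fun i => c i - d i) := by
  have := hc.add (hd.const_mul (-1))
  simpa [sub_eq_add_neg] using this

end dom

/-! ## Module 2: solving `u - u'' = z`, energy estimates -/

theorem dS_dS_eq_laplacian (f : 𝓢(ℝ, ℂ)) : Laplacian.laplacian f = dS (dS f) := by
  ext x
  rw [SchwartzMap.laplacian_apply, InnerProductSpace.laplacian_eq_iteratedDeriv_real (e := x),
    dS_apply, dS_coe, iteratedDeriv_succ, iteratedDeriv_one]

theorem exists_solve (z : 𝓢(ℝ, ℂ)) : ∃ u : 𝓢(ℝ, ℂ), u - dS (dS u) = z := by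
  set g : ℝ → ℝ := fun x => (1 + ‖(2 * Real.pi) * x‖ ^ 2) ^ (-1 : ℝ) with hg
  have hgt : g.HasTemperateGrowth := by
    have h1 := Function.hasTemperateGrowth_one_add_norm_sq_rpow ℝ (-1)
    have h2 : (fun x : ℝ => (2 * Real.pi) * x).HasTemperateGrowth :=
      (ContinuousLinearMap.hasTemperateGrowth ((2 * Real.pi) • ContinuousLinearMap.id ℝ ℝ))
    exact Function.HasTemperateGrowth.comp h1 h2
  have hn : (fun x : ℝ => ‖x‖ ^ 2).HasTemperateGrowth := Function.hasTemperateGrowth_norm_sq ℝ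
  set u := SchwartzMap.fourierMultiplierCLM ℂ g z with hu
  refine ⟨u, ?_⟩
  rw [← dS_dS_eq_laplacian, SchwartzMap.laplacian_eq_fourierMultiplierCLM]
  rw [hu, SchwartzMap.fourierMultiplierCLM_fourierMultiplierCLM_apply (by exact hn) hgt]
  have e1 : SchwartzMap.fourierMultiplierCLM ℂ (fun _ : ℝ => (1:ℝ)) z = z := by
    rw [SchwartzMap.fourierMultiplierCLM_const]; simp
  have hm : (fun x : ℝ => ‖x‖ ^ 2 * g x).HasTemperateGrowth := hn.mul hgt
  have e2 : (fun _ : ℝ => (1:ℝ)) = fun x => g x + (2 * Real.pi)^2 * (‖x‖^2 * g x) := by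
    funext x
    have : (1 + ‖(2 * Real.pi) * x‖ ^ 2) ≠ 0 := by positivity
    simp only [hg, Real.rpow_neg_one]
    field_simp
    simp [mul_pow]
  rw [e2] at e1
  simp only [SchwartzMap.fourierMultiplierCLM_apply] at e1 ⊢
  have e3 : SchwartzMap.smulLeftCLM ℂ (fun x => g x + (2 * Real.pi)^2 * (‖x‖^2 * g x))
      (FourierTransform.fourier z) = SchwartzMap.smulLeftCLM ℂ g (FourierTransform.fourier z) +
      (2 * Real.pi)^2 • SchwartzMap.smulLeftCLM ℂ ((fun x => ‖x‖^2) * g) (FourierTransform.fourier z) := by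
    ext x
    have hm2 : (fun x => g x + (2 * Real.pi)^2 * (‖x‖^2 * g x)).HasTemperateGrowth :=
      hgt.add ((Function.HasTemperateGrowth.const _).mul hm)
    simp only [SchwartzMap.smulLeftCLM_apply_apply hm2, add_apply, smul_apply,
      SchwartzMap.smulLeftCLM_apply_apply hgt, SchwartzMap.smulLeftCLM_apply_apply (hn.mul hgt)]
    simp only [Pi.mul_apply, Complex.real_smul]
    push_cast
    ring
  rw [e3] at e1
  rw [FourierTransform.fourierInv_add, FourierTransform.fourierInv_smul] at e1
  rw [neg_smul, sub_neg_eq_add]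
  exact e1

/-- complex inner product -/
noncomputable def IP (f g : 𝓢(ℝ, ℂ)) : ℂ := ∫ x, (starRingEnd ℂ) (f x) * g x

theorem L2_star {f : ℝ → ℂ} (hf : L2 f) : L2 (fun x => (starRingEnd ℂ) (f x)) :=
  ⟨Complex.continuous_conj.comp hf.1, by simpa using hf.2⟩

theorem IP_int (f g : 𝓢(ℝ, ℂ)) : Integrable (fun x => (starRingEnd ℂ) (f x) * g x) :=
  L2_mul_integrable (L2_star (L2_S f)) (L2_S g)

theorem IP_add (f g h : 𝓢(ℝ, ℂ)) : IP f (g + h) = IP f g + IP f h := by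
  unfold IP
  rw [← integral_add (IP_int f g) (IP_int f h)]
  congr 1; funext x; simp [mul_add]

theorem IP_smul (c : ℂ) (f g : 𝓢(ℝ, ℂ)) : IP f (c • g) = c * IP f g := by
  unfold IP
  rw [← integral_const_mul]
  congr 1; funext x; simp; ring

theorem IP_neg (f g : 𝓢(ℝ, ℂ)) : IP f (-g) = - IP f g := by
  have := IP_smul (-1) f g
  simpa using this

theorem IP_sub (f g h : 𝓢(ℝ, ℂ)) : IP f (g - h) = IP f g - IP f h := by
  rw [sub_eq_add_neg, IP_add, IP_neg, sub_eq_add_neg]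

theorem IP_conj (f g : 𝓢(ℝ, ℂ)) : (starRingEnd ℂ) (IP f g) = IP g f := by
  unfold IP
  rw [← integral_conj]
  congr 1; funext x; simp; ring

theorem IP_re_symm (f g : 𝓢(ℝ, ℂ)) : (IP f g).re = (IP g f).re := by
  rw [← IP_conj]; simp

theorem IP_self (f : 𝓢(ℝ, ℂ)) : IP f f = (N f : ℂ) := by
  unfold IP N
  rw [← integral_complex_ofReal]
  congr 1; funext x
  rw [← Complex.normSq_eq_conj_mul_self, Complex.normSq_eq_norm_sq]

theorem IP_sub_left (f g h : 𝓢(ℝ, ℂ)) : IP (f - g) h = IP f h - IP g h := by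
  rw [← IP_conj, IP_sub, map_sub, IP_conj, IP_conj]

theorem IP_tS (f g : 𝓢(ℝ, ℂ)) : IP f (tS g) = IP (tS f) g := by
  unfold IP
  congr 1; funext x
  simp only [tS_apply, map_mul, T, Complex.conj_ofReal]; ring

theorem IP_dS (f g : 𝓢(ℝ, ℂ)) : IP f (dS g) = - IP (dS f) g := by
  have hd : ∀ x, HasDerivAt (fun x => (starRingEnd ℂ) (f x) * g x)
      ((starRingEnd ℂ) (dS f x) * g x + (starRingEnd ℂ) (f x) * dS g x) x := fun x =>
    (HasDerivAt.star (dS_hasDerivAt f x)).mul (dS_hasDerivAt g x)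
  have h0 := integral_eq_zero_of_hasDerivAt_of_integrable hd
    ((IP_int (dS f) g).add (IP_int f (dS g))) (IP_int f g)
  rw [integral_add (IP_int (dS f) g) (IP_int f (dS g))] at h0
  unfold IP
  linear_combination h0

theorem IP_dS_re (f : 𝓢(ℝ, ℂ)) : (IP f (dS f)).re = 0 := by
  have h := IP_dS f f
  have h2 := IP_re_symm f (dS f)
  have := congrArg Complex.re h
  simp only [Complex.neg_re] at this
  linarith

theorem IP_re_sq (f g : 𝓢(ℝ, ℂ)) : (IP f g).re ^ 2 ≤ N f * N g := by
  have h1 : ‖IP f g‖^2 ≤ N f * N g := by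
    have := norm_integral_mul_sq_le (L2_star (L2_S f)) (L2_S g)
    have e : N (fun x => (starRingEnd ℂ) (f x)) = N f := by unfold N; simp
    rw [e] at this
    exact this
  have h2 := Complex.abs_re_le_norm (IP f g)
  have h3 : (IP f g).re ^ 2 ≤ ‖IP f g‖^2 := by
    rw [← sq_abs]; gcongr
  linarith

theorem IP_re_le (f g : 𝓢(ℝ, ℂ)) : (IP f g).re ≤ (N f + N g) / 2 := by
  have h := IP_re_sq f g
  have h1 := N_nonneg f
  have h2 := N_nonneg g
  nlinarith [sq_nonneg (N f - N g)]

theorem energy_conclude {γ : ℝ} {z G : 𝓢(ℝ, ℂ)} (hγ : 0 < γ) (h : γ * N z = (IP z G).re) :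
    γ ^ 2 * N z ≤ N G := by
  have h1 := IP_re_sq z G
  rw [← h] at h1
  by_cases h0 : N z = 0
  · rw [h0]; simpa using N_nonneg G
  · have h3 := lt_of_le_of_ne (N_nonneg z) (Ne.symm h0)
    nlinarith

theorem lam_re (γ τ a : ℝ) : ((((γ : ℂ) + τ * Complex.I)) * (a : ℂ)).re = γ * a := by
  simp

theorem energy_free {γ τ : ℝ} {z G : 𝓢(ℝ, ℂ)} (hγ : 0 < γ)
    (h : ((γ : ℂ) + τ * Complex.I) • z - dS z + dS (dS (dS z)) = G) :
    γ ^ 2 * N z ≤ N G := by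
  apply energy_conclude hγ
  rw [← h, IP_add, IP_sub, IP_smul, IP_self, Complex.add_re, Complex.sub_re, lam_re, IP_dS_re,
    IP_dS z, Complex.neg_re, IP_dS_re]
  ring

theorem energy_free_Hs {γ τ : ℝ} (m : ℕ) {z G : 𝓢(ℝ, ℂ)} (hγ : 0 < γ)
    (h : ((γ : ℂ) + τ * Complex.I) • z - dS z + dS (dS (dS z)) = G) :
    γ ^ 2 * HsSq m z ≤ HsSq m G := by
  induction m generalizing z G with
  | zero => simp only [HsSq_zero]; exact energy_free hγ h
  | succ m ih =>
    rw [HsSq_succ, HsSq_succ]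
    have h1 := energy_free hγ h
    have h2 : ((γ : ℂ) + τ * Complex.I) • dS z - dS (dS z) + dS (dS (dS (dS z))) = dS G := by
      rw [← h]; simp [dS_add, dS_sub, dS_smul]
    have := ih h2
    linarith

theorem energy_r {γ τ : ℝ} {r G : 𝓢(ℝ, ℂ)} (hγ : 0 < γ)
    (h : ((γ : ℂ) + τ * Complex.I) • r + dS (dS (dS r - tS r)) + tS (dS (dS r - tS r)) = G) :
    γ ^ 2 * N r ≤ N G := by
  apply energy_conclude hγ
  rw [← h, IP_add, IP_add, IP_smul, IP_self, IP_tS, IP_dS r, Complex.add_re, Complex.add_re, lam_re]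
  have e := IP_dS_re (dS r - tS r)
  rw [IP_sub_left, Complex.sub_re] at e
  rw [Complex.neg_re]
  linarith

theorem energy_res {u p q : 𝓢(ℝ, ℂ)} (h : u - dS (dS u) = dS p + q) : N u ≤ N p + N q := by
  have h1 : N u + N (dS u) = - (IP (dS u) p).re + (IP u q).re := by
    have h2 : (IP u (u - dS (dS u))).re = (IP u (dS p + q)).re := by rw [h]
    rw [IP_sub, IP_add, IP_self, IP_dS, IP_dS u p, IP_self] at h2
    simpa using h2
  have h3 := IP_re_le u q
  have h4 := IP_re_le (dS u) (-p)
  have e : N (-p : 𝓢(ℝ, ℂ)) = N p := N_neg p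
  rw [IP_neg, Complex.neg_re, e] at h4
  have := N_nonneg (dS u)
  linarith

theorem energy_res_Hs (m : ℕ) {u p q : 𝓢(ℝ, ℂ)} (h : u - dS (dS u) = dS p + q) :
    HsSq m u ≤ HsSq m p + HsSq m q := by
  induction m generalizing u p q with
  | zero => simp only [HsSq_zero]; exact energy_res h
  | succ m ih =>
    simp only [HsSq_succ]
    have h1 := energy_res h
    have h2 : dS u - dS (dS (dS u)) = dS (dS p) + dS q := by
      rw [← dS_add, ← h, dS_sub]
    have := ih h2
    linarith

theorem solve_unique {u v : 𝓢(ℝ, ℂ)} (h : u - dS (dS u) = v - dS (dS v)) : u = v := by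
  have h1 : (u - v) - dS (dS (u - v)) = dS 0 + 0 := by
    have e : dS (0 : 𝓢(ℝ, ℂ)) = 0 := by simp [dS]
    rw [dS_sub, dS_sub, e, sub_sub_sub_comm, h]; simp
  have h2 := energy_res h1
  have e0 : N (0 : 𝓢(ℝ, ℂ)) = 0 := by unfold N; simp
  rw [e0] at h2
  have h3 : N (u - v : 𝓢(ℝ, ℂ)) = 0 := le_antisymm (by linarith) (N_nonneg _)
  unfold N at h3
  have hc : Continuous (fun x => ‖(u - v : 𝓢(ℝ, ℂ)) x‖^2) := by fun_prop
  rw [integral_eq_zero_iff_of_nonneg (fun x => by positivity) (L2_S (u - v)).2] at h3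
  have h4 := (hc.ae_eq_iff_eq volume continuous_const).1 h3
  ext x
  have : ‖(u - v : 𝓢(ℝ, ℂ)) x‖^2 = 0 := congrFun h4 x
  have h5 := norm_eq_zero.1 (pow_eq_zero_iff (by norm_num) |>.1 this)
  simpa [sub_eq_zero] using h5

theorem energy_F0 {γ τ : ℝ} (β : ℝ) {z G : 𝓢(ℝ, ℂ)} (hγ : 0 < γ)
    (h : dS (dS (dS (dS z))) - dS (dS z) + ((γ : ℂ) + τ * Complex.I) • dS z + (β : ℂ) • z = G) :
    γ ^ 2 * N (dS z) ≤ N G := by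
  apply energy_conclude hγ
  have e3 : (IP (dS z) z).re = 0 := by rw [IP_re_symm]; exact IP_dS_re z
  rw [← h, IP_add, IP_add, IP_sub, IP_smul, IP_smul, IP_self, IP_dS (dS z) (dS (dS (dS z)))]
  simp only [Complex.add_re, Complex.sub_re, Complex.neg_re, lam_re, IP_dS_re, Complex.re_ofReal_mul, e3]
  ring

theorem energy_F0_Hs {γ τ : ℝ} (β : ℝ) (m : ℕ) {z G : 𝓢(ℝ, ℂ)} (hγ : 0 < γ)
    (h : dS (dS (dS (dS z))) - dS (dS z) + ((γ : ℂ) + τ * Complex.I) • dS z + (β : ℂ) • z = G) :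
    γ ^ 2 * HsSq m (dS z) ≤ HsSq m G := by
  induction m generalizing z G with
  | zero => simp only [HsSq_zero]; exact energy_F0 β hγ h
  | succ m ih =>
    rw [HsSq_succ, HsSq_succ]
    have h1 := energy_F0 β hγ h
    have h2 := ih (z := dS z) (G := dS G) (by rw [← h]; simp only [dS_add, dS_sub, dS_smul])
    linarith

/-! ## Module 3: first order estimates and Lyapunov estimates -/

theorem th_ge (x : ℝ) : 1 - 2 * Real.exp (-x) ≤ th x := by
  unfold th
  rw [Real.tanh_eq_sinh_div_cosh, Real.sinh_eq, Real.cosh_eq]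
  have e : Real.exp (-x) = Real.exp (-(x/2)) * Real.exp (-(x/2)) := by
    rw [← Real.exp_add]; ring_nf
  have h1 : Real.exp (x/2) * Real.exp (-(x/2)) = 1 := by rw [← Real.exp_add]; simp
  have p1 := Real.exp_pos (x/2)
  have p2 := Real.exp_pos (-(x/2))
  rw [e, div_div_div_cancel_right₀ (by norm_num), le_div_iff₀ (by positivity)]
  set a := Real.exp (x/2)
  set b := Real.exp (-(x/2))
  have : b * b * a = b := by rw [mul_assoc, mul_comm b a, h1, mul_one]
  nlinarith [mul_pos (mul_pos p2 p2) p2]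

theorem lyap_half {E E' n F : ℝ → ℝ} {δ Λ C : ℝ} (hδ : 0 ≤ δ) (hΛ : 0 ≤ Λ) (hC : 0 ≤ C)
    (hE : ∀ x, HasDerivAt E (E' x) x) (hE0 : ∀ x, 0 ≤ E x) (hn : Continuous n) (hF : Continuous F)
    (hn0 : ∀ x, 0 ≤ n x) (hF0 : ∀ x, 0 ≤ F x)
    (hineq : ∀ x, 0 ≤ x → E' x ≤ - δ * n x + Λ * Real.exp (-x) * E x + C * F x)
    {S : ℝ} (hS : 0 ≤ S) :
    δ * ∫ x in (0:ℝ)..S, n x ≤ Real.exp Λ * (E 0 + C * ∫ x in (0:ℝ)..S, F x) := by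
  set m : ℝ → ℝ := fun x => Real.exp (Λ * Real.exp (-x)) with hm
  have hmd : ∀ x, HasDerivAt m (m x * (Λ * (Real.exp (-x) * (-1)))) x := fun x =>
    (((hasDerivAt_neg x).exp).const_mul Λ).exp
  set g : ℝ → ℝ := fun y => m y * E y + (δ * ∫ x in (0:ℝ)..y, n x) -
    (Real.exp Λ * C) * ∫ x in (0:ℝ)..y, F x with hg
  have hgd : ∀ y, HasDerivAt g ((m y * (Λ * (Real.exp (-y) * (-1)))) * E y + m y * E' y + δ * n y
      - (Real.exp Λ * C) * F y) y := fun y =>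
    (((hmd y).mul (hE y)).add
      ((intervalIntegral.integral_hasDerivAt_right (hn.intervalIntegrable _ _)
        (hn.stronglyMeasurableAtFilter _ _) hn.continuousAt).const_mul δ)).sub
      ((intervalIntegral.integral_hasDerivAt_right (hF.intervalIntegrable _ _)
        (hF.stronglyMeasurableAtFilter _ _) hF.continuousAt).const_mul _)
  have hanti : AntitoneOn g (Set.Ici 0) := by
    apply antitoneOn_of_deriv_nonpos (convex_Ici 0)
    · exact fun x _ => (hgd x).continuousAt.continuousWithinAt
    · exact fun x _ => (hgd x).differentiableAt.differentiableWithinAt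
    · intro x hx
      have hx0 : 0 ≤ x := by
        simp only [interior_Ici, Set.mem_Ioi] at hx; exact hx.le
      rw [(hgd x).deriv]
      have hm1 : 1 ≤ m x := by
        simp only [hm]; apply Real.one_le_exp; positivity
      have hm2 : m x ≤ Real.exp Λ := by
        simp only [hm]; apply Real.exp_le_exp.2
        have : Real.exp (-x) ≤ 1 := Real.exp_le_one_iff.2 (by linarith)
        nlinarith
      have h1 := mul_le_mul_of_nonneg_left (hineq x hx0) (by linarith : 0 ≤ m x)
      have h2 : 0 ≤ δ * n x := mul_nonneg hδ (hn0 x)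
      have h3 : 0 ≤ C * F x := mul_nonneg hC (hF0 x)
      nlinarith
  have := hanti (Set.self_mem_Ici) hS hS
  simp only [hg, intervalIntegral.integral_same] at this
  have h0 : m 0 = Real.exp Λ := by simp [hm]
  have h4 : 0 ≤ m S * E S := mul_nonneg (Real.exp_pos _).le (hE0 S)
  rw [h0] at this
  linarith

theorem full_line {n : ℝ → ℝ} {K : ℝ} (hn : Continuous n) (hn0 : ∀ x, 0 ≤ n x)
    (h1 : ∀ S, 0 ≤ S → ∫ x in (0:ℝ)..S, n x ≤ K) (h2 : ∀ S, 0 ≤ S → ∫ x in (0:ℝ)..S, n (-x) ≤ K) :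
    Integrable n ∧ ∫ x, n x ≤ 2 * K := by
  have hb : ∀ S : ℝ, 0 ≤ S → ∫ x in (-S)..S, n x ≤ 2 * K := by
    intro S hS
    rw [← intervalIntegral.integral_add_adjacent_intervals (b := 0) (hn.intervalIntegrable _ _)
      (hn.intervalIntegrable _ _)]
    have := h1 S hS
    have h3 := h2 S hS
    rw [intervalIntegral.integral_comp_neg] at h3
    simp only [neg_zero] at h3
    linarith
  have ha : Filter.Tendsto (fun k : ℕ => -(k:ℝ)) Filter.atTop Filter.atBot :=
    Filter.tendsto_neg_atTop_atBot.comp tendsto_natCast_atTop_atTop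
  have hI : Integrable n := by
    apply integrable_of_intervalIntegral_norm_bounded (l := Filter.atTop) (2 * K) (a := fun k : ℕ => -(k:ℝ))
      (b := fun k : ℕ => (k:ℝ)) _ ha tendsto_natCast_atTop_atTop
    · refine Filter.Eventually.of_forall fun k => ?_
      simp only [Real.norm_eq_abs, abs_of_nonneg (hn0 _)]
      exact hb k (Nat.cast_nonneg k)
    · intro k
      exact (hn.integrableOn_Icc).mono_set Set.Ioc_subset_Icc_self
  refine ⟨hI, ?_⟩
  exact le_of_tendsto (intervalIntegral_tendsto_integral hI ha tendsto_natCast_atTop_atTop)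
    (Filter.Eventually.of_forall fun k => hb k (Nat.cast_nonneg k))

theorem norm_sq_re_im (z : ℂ) : ‖z‖^2 = z.re^2 + z.im^2 := by
  rw [← Complex.normSq_eq_norm_sq, Complex.normSq_apply]; ring

theorem HasDerivAt.re' {f : ℝ → ℂ} {f' : ℂ} {x : ℝ} (h : HasDerivAt f f' x) :
    HasDerivAt (fun x => (f x).re) f'.re x :=
  (Complex.reCLM.hasFDerivAt.comp_hasDerivAt x h)

theorem HasDerivAt.im' {f : ℝ → ℂ} {f' : ℂ} {x : ℝ} (h : HasDerivAt f f' x) :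
    HasDerivAt (fun x => (f x).im) f'.im x :=
  (Complex.imCLM.hasFDerivAt.comp_hasDerivAt x h)

theorem half_int_le {F : ℝ → ℝ} (hF : Integrable F) (h0 : ∀ x, 0 ≤ F x) {S : ℝ} (hS : 0 ≤ S) :
    ∫ x in (0:ℝ)..S, F x ≤ ∫ x, F x := by
  rw [intervalIntegral.integral_of_le hS]
  exact setIntegral_le_integral hF (Filter.Eventually.of_forall h0)

theorem half_int_le' {F : ℝ → ℝ} (hF : Integrable F) (h0 : ∀ x, 0 ≤ F x) {S : ℝ} (hS : 0 ≤ S) :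
    ∫ x in (0:ℝ)..S, F (-x) ≤ ∫ x, F x := by
  rw [← integral_neg_eq_self F]
  exact half_int_le (hF.comp_neg) (fun x => h0 _) hS

theorem lyapA_half {f r : ℝ → ℂ} (hf : ∀ x, HasDerivAt f (r x - T x * f x) x) (hr : Continuous r)
    {S : ℝ} (hS : 0 ≤ S) :
    ∫ x in (0:ℝ)..S, ‖f x‖^2 ≤ Real.exp 4 * (‖f 0‖^2 + ∫ x in (0:ℝ)..S, ‖r x‖^2) := by
  have hc : Continuous f := continuous_iff_continuousAt.2 fun x => (hf x).continuousAt
  have hE : ∀ x, HasDerivAt (fun x => ‖f x‖^2)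
      (2 * (f x).re * (r x - T x * f x).re + 2 * (f x).im * (r x - T x * f x).im) x := by
    intro x
    simp only [norm_sq_re_im]
    have := ((hf x).re'.pow 2).add ((hf x).im'.pow 2)
    refine this.congr_deriv ?_
    push_cast; ring
  have := lyap_half (E := fun x => ‖f x‖^2) (n := fun x => ‖f x‖^2) (F := fun x => ‖r x‖^2)
    (δ := 1) (Λ := 4) (C := 1) (by norm_num) (by norm_num) (by norm_num) hE (fun x => by positivity)
    (by fun_prop) (by fun_prop) (fun x => by positivity) (fun x => by positivity) ?_ hS
  · simpa using this
  · intro x hx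
    simp only [norm_sq_re_im, T, Complex.sub_re, Complex.sub_im, Complex.re_ofReal_mul, Complex.im_ofReal_mul]
    have h1 := th_ge x
    have h2 : 0 ≤ (f x).re^2 + (f x).im^2 := by positivity
    nlinarith [sq_nonneg ((f x).re - (r x).re), sq_nonneg ((f x).im - (r x).im),
      mul_le_mul_of_nonneg_right h1 h2]

theorem lyapA {f r : ℝ → ℂ} (hf : ∀ x, HasDerivAt f (r x - T x * f x) x) (hr : L2 r) :
    L2 f ∧ N f ≤ (2 * Real.exp 4) * (‖f 0‖^2 + N r) := by
  have hc : Continuous f := continuous_iff_continuousAt.2 fun x => (hf x).continuousAt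
  have := full_line (n := fun x => ‖f x‖^2) (K := Real.exp 4 * (‖f 0‖^2 + N r)) (by fun_prop)
    (fun x => by positivity) ?_ ?_
  · refine ⟨⟨hc, this.1⟩, ?_⟩
    unfold N at *
    linarith [this.2]
  · intro S hS
    refine (lyapA_half hf hr.1 hS).trans ?_
    have := half_int_le hr.2 (fun x => by positivity) hS
    unfold N
    gcongr
  · intro S hS
    have hf2 : ∀ x, HasDerivAt (fun x => f (-x)) (-r (-x) - T x * f (-x)) x := by
      intro x
      have h1 := (hf (-x)).scomp x (hasDerivAt_neg x)
      refine HasDerivAt.congr_deriv (f := fun x => f (-x)) h1 ?_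
      have : T (-x) = - T x := by simp [T, th_neg]
      rw [this]; simp; ring
    have h3 := lyapA_half hf2 (by have := hr.1; fun_prop) hS
    refine h3.trans ?_
    have := half_int_le' hr.2 (fun x => by positivity) hS
    unfold N
    simp only [norm_neg, neg_zero]
    gcongr

theorem lyapD_half {b : ℝ} (hb : 0 < b) {W X f : ℝ → ℂ} (hW : ∀ x, HasDerivAt W (X x - T x * W x) x)
    (hX : ∀ x, HasDerivAt X (f x - b * W x) x) (hf : Continuous f) {S : ℝ} (hS : 0 ≤ S) :
    (b / (2 * b + 4)) * ∫ x in (0:ℝ)..S, (‖X x‖^2 + ‖W x‖^2) ≤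
      Real.exp 8 * (2 * (‖X 0‖^2 + b * ‖W 0‖^2) +
        (2 / (b / (2 * b + 4)) + b / (2 * b + 4)) * ∫ x in (0:ℝ)..S, ‖f x‖^2) := by
  set ε := b / (2 * b + 4) with hε
  have hε0 : 0 < ε := by positivity
  have hε1 : 2 * ε * b + 4 * ε = b := by rw [hε]; field_simp
  have hε2 : 4 * ε^2 ≤ b := by nlinarith
  have hcW : Continuous W := continuous_iff_continuousAt.2 fun x => (hW x).continuousAt
  have hcX : Continuous X := continuous_iff_continuousAt.2 fun x => (hX x).continuousAt
  set E : ℝ → ℝ := fun x => ((X x).re^2 + (X x).im^2) + b * ((W x).re^2 + (W x).im^2)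
    - 2 * ε * ((X x).re * (W x).re + (X x).im * (W x).im) with hEd
  have hE := fun x => ((((hX x).re'.pow 2).add ((hX x).im'.pow 2)).add
    ((((hW x).re'.pow 2).add ((hW x).im'.pow 2)).const_mul b)).sub
    ((((hX x).re'.mul (hW x).re').add ((hX x).im'.mul (hW x).im')).const_mul (2 * ε))
  have hq : ∀ p q : ℝ, (p^2 + b * q^2) / 2 ≤ p^2 + b * q^2 - 2 * ε * (p * q) := by
    intro p q
    nlinarith [sq_nonneg (p - 2 * ε * q), sq_nonneg q]
  have hq' : ∀ p q : ℝ, p^2 + b * q^2 - 2 * ε * (p * q) ≤ 2 * (p^2 + b * q^2) := by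
    intro p q
    nlinarith [sq_nonneg (p + 2 * ε * q), sq_nonneg q]
  have hElow : ∀ x, b * ((W x).re^2 + (W x).im^2) / 2 ≤ E x := by
    intro x
    simp only [hEd]
    nlinarith [hq (X x).re (W x).re, hq (X x).im (W x).im, sq_nonneg (X x).re, sq_nonneg (X x).im]
  have := lyap_half (E := E) (n := fun x => ‖X x‖^2 + ‖W x‖^2) (F := fun x => ‖f x‖^2)
    (δ := ε) (Λ := 8) (C := 2 / ε + ε) hε0.le (by norm_num) (by positivity) hE
    (fun x => le_trans (by positivity) (hElow x))
    (by fun_prop) (by fun_prop) (fun x => by positivity) (fun x => by positivity) ?_ hS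
  · refine this.trans ?_
    have h0 : E 0 ≤ 2 * (‖X 0‖^2 + b * ‖W 0‖^2) := by
      simp only [hEd, norm_sq_re_im]
      nlinarith [hq' (X 0).re (W 0).re, hq' (X 0).im (W 0).im]
    gcongr
  · intro x hx
    have h1 := th_ge x
    have h4 := th_lt_one x
    have h5 := neg_one_lt_th x
    have hex := Real.exp_pos (-x)
    have hL := mul_le_mul_of_nonneg_left (hElow x) (by positivity : 0 ≤ 8 * Real.exp (-x))
    have key : ∀ p q g : ℝ, 2 * p * (g - b * q) + b * (2 * q * (p - th x * q))
        - 2 * ε * ((g - b * q) * q + p * (p - th x * q)) ≤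
        - ε * (p^2 + q^2) + 4 * b * Real.exp (-x) * q^2 + (2 / ε + ε) * g^2 := by
      intro p q g
      have a1 : 2 * p * g ≤ ε / 2 * p^2 + 2 / ε * g^2 := by
        have : 0 ≤ (ε * p - 2 * g)^2 / (2 * ε) := by positivity
        have e : (ε * p - 2 * g)^2 / (2 * ε) = ε / 2 * p^2 + 2 / ε * g^2 - 2 * p * g := by
          field_simp; ring
        linarith
      have a2 : 2 * ε * (th x * (p * q)) ≤ ε / 2 * p^2 + 2 * ε * q^2 := by
        have : 0 ≤ ε / 2 * (p - 2 * th x * q)^2 := by positivity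
        have h6 : th x^2 * q^2 ≤ q^2 := by nlinarith [th_sq_lt x, sq_nonneg q]
        nlinarith
      have a3 : - (2 * ε * (g * q)) ≤ ε * g^2 + ε * q^2 := by
        nlinarith [sq_nonneg (g + q)]
      have a4 : - (2 * b * (th x * q^2)) ≤ - (2 * b * q^2) + 4 * b * Real.exp (-x) * q^2 := by
        have : 0 ≤ b * q^2 := by positivity
        nlinarith
      have a5 : (2 * ε * b + 4 * ε) * q^2 = b * q^2 := by rw [hε1]
      have a6 : 0 ≤ b * q^2 := by positivity
      nlinarith
    have k1 := key (X x).re (W x).re (f x).re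
    have k2 := key (X x).im (W x).im (f x).im
    simp only [norm_sq_re_im, T, Complex.sub_re, Complex.sub_im, Complex.re_ofReal_mul, Complex.im_ofReal_mul]
    push_cast
    nlinarith

theorem lyapD {b : ℝ} (hb : 0 < b) : ∃ C : ℝ, 0 ≤ C ∧ ∀ {W X f : ℝ → ℂ},
    (∀ x, HasDerivAt W (X x - T x * W x) x) → (∀ x, HasDerivAt X (f x - b * W x) x) → L2 f →
    L2 W ∧ L2 X ∧ N W ≤ C * (‖X 0‖^2 + ‖W 0‖^2 + N f) ∧ N X ≤ C * (‖X 0‖^2 + ‖W 0‖^2 + N f) := by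
  set ε := b / (2 * b + 4) with hε
  have hε0 : 0 < ε := by positivity
  set c := 2 / ε + ε with hc
  have hc0 : 0 < c := by positivity
  set M := (2 + 2 * b + c) with hM
  refine ⟨2 * (Real.exp 8 / ε * M), by positivity, ?_⟩
  intro W X f hW hX hf
  have hcW : Continuous W := continuous_iff_continuousAt.2 fun x => (hW x).continuousAt
  have hcX : Continuous X := continuous_iff_continuousAt.2 fun x => (hX x).continuousAt
  have hNf := N_nonneg f
  have hbnd : 2 * (‖X 0‖^2 + b * ‖W 0‖^2) + c * N f ≤ M * (‖X 0‖^2 + ‖W 0‖^2 + N f) := by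
    have e1 : 0 ≤ ‖X 0‖^2 := by positivity
    have e2 : 0 ≤ ‖W 0‖^2 := by positivity
    rw [hM]
    have : 0 ≤ b * ‖X 0‖^2 := by positivity
    have : 0 ≤ c * ‖X 0‖^2 := by positivity
    have : 0 ≤ c * ‖W 0‖^2 := by positivity
    have : 0 ≤ b * N f := by positivity
    nlinarith
  have := full_line (n := fun x => ‖X x‖^2 + ‖W x‖^2)
    (K := Real.exp 8 / ε * (M * (‖X 0‖^2 + ‖W 0‖^2 + N f))) (by fun_prop)
    (fun x => by positivity) ?_ ?_
  · have hXL : L2 X := ⟨hcX, this.1.mono' (by fun_prop) (Filter.Eventually.of_forall fun x => by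
      simp only [norm_pow, norm_norm]; nlinarith [sq_nonneg ‖W x‖])⟩
    have hWL : L2 W := ⟨hcW, this.1.mono' (by fun_prop) (Filter.Eventually.of_forall fun x => by
      simp only [norm_pow, norm_norm]; nlinarith [sq_nonneg ‖X x‖])⟩
    have h2 := this.2
    rw [integral_add hXL.2 hWL.2] at h2
    have n1 := N_nonneg X
    have n2 := N_nonneg W
    unfold N at *
    exact ⟨hWL, hXL, by linarith, by linarith⟩
  · intro S hS
    have h1 := lyapD_half hb hW hX hf.1 hS
    have h2 := half_int_le hf.2 (fun x => by positivity) hS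
    rw [← hε, ← hc] at h1
    rw [div_mul_eq_mul_div, le_div_iff₀ hε0, mul_comm]
    refine h1.trans ?_
    gcongr
    refine le_trans ?_ hbnd
    unfold N
    gcongr
  · intro S hS
    have hT : ∀ x, T (-x) = - T x := fun x => by simp [T, th_neg]
    have hW2 : ∀ x, HasDerivAt (fun x => W (-x)) (- X (-x) - T x * W (-x)) x := by
      intro x
      have h1 := (hW (-x)).scomp x (hasDerivAt_neg x)
      refine HasDerivAt.congr_deriv (f := fun x => W (-x)) h1 ?_
      rw [hT]; simp; ring
    have hX2 : ∀ x, HasDerivAt (fun x => -X (-x)) (f (-x) - b * W (-x)) x := by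
      intro x
      have h1 := ((hX (-x)).scomp x (hasDerivAt_neg x)).neg
      refine HasDerivAt.congr_deriv (f := fun x => -X (-x)) h1 ?_
      simp
    have h1 := lyapD_half hb hW2 hX2 (by have := hf.1; fun_prop) hS
    have h2 := half_int_le' hf.2 (fun x => by positivity) hS
    rw [← hε, ← hc] at h1
    simp only [norm_neg, neg_zero] at h1
    rw [div_mul_eq_mul_div, le_div_iff₀ hε0, mul_comm]
    refine h1.trans ?_
    gcongr
    refine le_trans ?_ hbnd
    unfold N
    gcongr

theorem first_order {f r : ℝ → ℂ} {α : ℝ → ℝ} {M α₀ σ : ℝ} (hα : Continuous α) (hM : ∀ x, |α x| ≤ M)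
    (hα₀ : 0 < α₀) (hσ : σ ^ 2 = 1) (hs : ∀ x, α₀ ≤ σ * α x) (hfL : L2 f) (hrL : L2 r)
    (hf : ∀ x, HasDerivAt f (r x - α x * f x) x) : N f ≤ (1 / α₀^2) * N r := by
  have hE : ∀ x, HasDerivAt (fun x => ‖f x‖^2)
      (2 * (f x).re * (r x - α x * f x).re + 2 * (f x).im * (r x - α x * f x).im) x := by
    intro x
    simp only [norm_sq_re_im]
    have := ((hf x).re'.pow 2).add ((hf x).im'.pow 2)
    refine this.congr_deriv ?_
    push_cast; ring
  set u' : ℝ → ℝ := fun x => 2 * (f x).re * (r x - α x * f x).re + 2 * (f x).im * (r x - α x * f x).im with hu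
  have hcu : Continuous u' := by
    have := hfL.1
    have := hrL.1
    simp only [hu]
    fun_prop
  have hbd : ∀ x, |2 * (f x).re * (r x - α x * f x).re + 2 * (f x).im * (r x - α x * f x).im
      + 2 * α x * ‖f x‖^2| ≤ ‖f x‖^2 + ‖r x‖^2 := by
    intro x
    simp only [norm_sq_re_im, Complex.sub_re, Complex.sub_im, Complex.re_ofReal_mul, Complex.im_ofReal_mul]
    rw [abs_le]
    constructor
    · nlinarith [sq_nonneg ((f x).re + (r x).re), sq_nonneg ((f x).im + (r x).im)]
    · nlinarith [sq_nonneg ((f x).re - (r x).re), sq_nonneg ((f x).im - (r x).im)]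
  have hI : Integrable u' := by
    refine ((hfL.2.const_mul (1 + 2 * M)).add hrL.2).mono' hcu.aestronglyMeasurable
      (Filter.Eventually.of_forall fun x => ?_)
    have h1 := hbd x
    have h2 := hM x
    rw [abs_le] at h1 h2
    rw [Real.norm_eq_abs, abs_le]
    simp only [hu, Pi.add_apply]
    have h3 : 0 ≤ ‖f x‖^2 := by positivity
    constructor <;> nlinarith
  have h0 := integral_eq_zero_of_hasDerivAt_of_integrable hE hI hfL.2
  have hle : ∫ x, σ * u' x ≤ ∫ x, (-α₀ * ‖f x‖^2 + (1/α₀) * ‖r x‖^2) := by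
    apply integral_mono (hI.const_mul _) ((hfL.2.const_mul _).add (hrL.2.const_mul _))
    intro x
    simp only [hu]
    have key : ∀ p q : ℝ, σ * (2 * p * (q - α x * p)) ≤ - α₀ * p^2 + (1 / α₀) * q^2 := by
      intro p q
      have a1 : 2 * (σ * (p * q)) ≤ α₀ * p^2 + (1/α₀) * q^2 := by
        have : 0 ≤ (α₀ * p - σ * q)^2 / α₀ := by positivity
        have e : (α₀ * p - σ * q)^2 / α₀ = α₀ * p^2 + (1/α₀) * (σ^2 * q^2) - 2 * (σ * (p * q)) := by
          field_simp; ring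
        rw [hσ, one_mul] at e
        linarith
      nlinarith [mul_le_mul_of_nonneg_right (hs x) (sq_nonneg p)]
    have k1 := key (f x).re (r x).re
    have k2 := key (f x).im (r x).im
    simp only [Pi.add_apply, norm_sq_re_im, Complex.sub_re, Complex.sub_im, Complex.re_ofReal_mul,
      Complex.im_ofReal_mul]
    linarith
  rw [integral_const_mul, h0, integral_add (hfL.2.const_mul _) (hrL.2.const_mul _), integral_const_mul,
    integral_const_mul] at hle
  have h1 : α₀ * N f ≤ (1 / α₀) * N r := by unfold N; linarith
  have h2 := mul_le_mul_of_nonneg_left h1 (by positivity : 0 ≤ 1 / α₀)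
  have e1 : 1 / α₀ * (α₀ * N f) = N f := by field_simp
  have e2 : 1 / α₀ * (1 / α₀ * N r) = 1 / α₀^2 * N r := by field_simp
  linarith

/-! ## Module 4: the mode `k = 0` -/

theorem N_eq_zero {f : ℝ → ℂ} (hf : L2 f) (h : N f = 0) (x : ℝ) : f x = 0 := by
  unfold N at h
  have hc : Continuous (fun x => ‖f x‖^2) := by have := hf.1; fun_prop
  rw [integral_eq_zero_iff_of_nonneg (fun x => by positivity) hf.2] at h
  have h4 := (hc.ae_eq_iff_eq volume continuous_const).1 h
  have : ‖f x‖^2 = 0 := congrFun h4 x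
  exact norm_eq_zero.1 (pow_eq_zero_iff (by norm_num) |>.1 this)

noncomputable def S2 (x : ℝ) : ℂ := 1 - T x ^ 2

theorem S2_hasDerivAt (x : ℝ) : HasDerivAt S2 (- T x * S2 x) x := by
  have := ((T_hasDerivAt x).pow 2).const_sub 1
  refine HasDerivAt.congr_deriv (f := S2) this ?_
  unfold S2; push_cast; ring

theorem T_hasDerivAt' (x : ℝ) : HasDerivAt T (S2 x / 2) x := T_hasDerivAt x

theorem T_continuous : Continuous T := T_temperate.1.continuous

theorem L2_zero : L2 (fun _ => 0) := ⟨continuous_const, by simp⟩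

theorem L2_S2 : L2 S2 := (lyapA (f := S2) (r := fun _ => 0)
  (fun x => (S2_hasDerivAt x).congr_deriv (by ring)) L2_zero).1


theorem T_eq (x : ℝ) : T x = ((th x : ℝ) : ℂ) := rfl

theorem L2_Tpow {g : ℝ → ℂ} (n : ℕ) (hg : L2 g) : L2 (fun x => T x ^ n * g x) := by
  induction n with
  | zero => simpa using hg
  | succ n ih =>
    have := L2_T ih
    convert this using 2 with x
    ring

theorem L2_mul_S2 {g : ℝ → ℂ} (hg : L2 g) : L2 (fun x => S2 x * g x) := by
  have := L2_sub hg (L2_Tpow 2 hg)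
  convert this using 2 with x
  unfold S2; ring

theorem int_dS_S {c : ℝ → ℂ} (W : 𝓢(ℝ, ℂ)) (hc : L2 c) : Integrable (fun x => W x * c x) :=
  L2_mul_integrable (L2_S W) hc

/-- integration by parts against a decaying weight -/
theorem int_dS_mul (f : 𝓢(ℝ, ℂ)) {χ χ1 : ℝ → ℂ} (h : ∀ x, HasDerivAt χ (χ1 x) x)
    (l0 : L2 χ) (l1 : L2 χ1) : ∫ x, dS f x * χ x = - ∫ x, f x * χ1 x := by
  have hd : ∀ x, HasDerivAt (fun x => f x * χ x) (dS f x * χ x + f x * χ1 x) x := fun x =>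
    (dS_hasDerivAt f x).mul (h x)
  have := integral_eq_zero_of_hasDerivAt_of_integrable hd
    ((int_dS_S (dS f) l0).add (int_dS_S f l1)) (int_dS_S f l0)
  rw [integral_add (int_dS_S (dS f) l0) (int_dS_S f l1)] at this
  linear_combination this

theorem int_S2_sq_ne : (∫ x, S2 x * S2 x) ≠ 0 := by
  have e : ∀ x, S2 x * S2 x = ((‖S2 x‖ ^ 2 : ℝ) : ℂ) := by
    intro x
    have : S2 x = ((1 - th x ^ 2 : ℝ) : ℂ) := by unfold S2; rw [T_eq]; push_cast; ring
    rw [this, Complex.norm_real, Real.norm_eq_abs, sq_abs]; push_cast; ring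
  simp only [e]
  rw [integral_complex_ofReal]
  intro h
  have h1 : N S2 = 0 := by exact_mod_cast h
  have h2 := N_eq_zero L2_S2 h1 0
  simp [S2, T_eq, th_zero] at h2

theorem Bc.inv_mul {ι : Type} {R : ι → ℝ} {c lam : ι → ℂ} {γ : ℝ} (hγ : 0 < γ) (hl : ∀ i, γ ≤ ‖lam i‖)
    (hc : Bc R c) : Bc R (fun i => (lam i)⁻¹ * c i) :=
  Bc.of_le γ⁻¹ hc fun i => by
    rw [norm_mul, norm_inv]
    gcongr
    exact hl i

theorem norm_lam (γ τ : ℝ) : γ ≤ ‖(γ : ℂ) + τ * Complex.I‖ := by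
  have := Complex.re_le_norm ((γ : ℂ) + τ * Complex.I)
  simpa using this

/-- `L²` control for `f' = r - T f`, the kernel coefficient being fixed by a functional -/
theorem A_bound {ι : Type} {R : ι → ℝ} {F r : ι → 𝓢(ℝ, ℂ)} {lam c d : ι → ℂ} {p : ℝ → ℂ} {γ : ℝ}
    (hγ : 0 < γ) (hl : ∀ i, γ ≤ ‖lam i‖)
    (h : ∀ i, dS (F i) = r i - tS (F i)) (hr : B R 0 r) (hp : L2 p) (hp0 : ∫ x, S2 x * p x = 0)
    (hc : Bc R c) (hd : Bc R d)
    (hf : ∀ i, lam i * ∫ x, F i x * S2 x = lam i * d i + (∫ x, F i x * p x) + c i) : B R 0 F := by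
  set J := ∫ x, S2 x * S2 x with hJ
  have hJ0 : J ≠ 0 := int_S2_sq_ne
  set G : ι → ℝ → ℂ := fun i x => F i x - F i 0 * S2 x with hG
  have hGd : ∀ i x, HasDerivAt (G i) (r i x - T x * G i x) x := by
    intro i x
    have h1 := (dS_hasDerivAt (F i) x).sub ((S2_hasDerivAt x).const_mul (F i 0))
    refine h1.congr_deriv ?_
    rw [h i]
    simp only [hG, sub_apply, tS_apply]
    ring
  have hG0 : ∀ i, G i 0 = 0 := by
    intro i; simp [hG, S2, T_eq, th_zero]
  have hGB : BN R G := by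
    obtain ⟨C, hC, hr'⟩ := hr
    refine ⟨fun i => (lyapA (hGd i) (L2_S (r i))).1, 2 * Real.exp 4 * C, by positivity, fun i => ?_⟩
    have h1 := (lyapA (hGd i) (L2_S (r i))).2
    have h2 := hr' i
    rw [HsSq_zero] at h2
    rw [hG0] at h1
    simp only [norm_zero, ne_eq, OfNat.ofNat_ne_zero, not_false_eq_true, zero_pow, zero_add] at h1
    rw [mul_assoc]
    exact h1.trans (by gcongr)
  have hF : ∀ i x, F i x = G i x + F i 0 * S2 x := by intro i x; simp [hG]
  have split : ∀ i {q : ℝ → ℂ}, L2 q → ∫ x, F i x * q x = (∫ x, G i x * q x) + F i 0 * ∫ x, S2 x * q x := by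
    intro i q hq
    rw [← integral_const_mul, ← integral_add (L2_mul_integrable (hGB.1 i) hq)
      ((L2_mul_integrable L2_S2 hq).const_mul _)]
    congr 1; funext x; rw [hF i x]; ring
  have key : ∀ i, F i 0 = J⁻¹ * (d i - ∫ x, G i x * S2 x) +
      J⁻¹ * ((lam i)⁻¹ * ((∫ x, G i x * p x) + c i)) := by
    intro i
    have hl0 : lam i ≠ 0 := by
      intro h0; have := hl i; rw [h0, norm_zero] at this; linarith
    have h1 := hf i
    rw [split i L2_S2, split i hp, hp0, ← hJ] at h1
    field_simp
    linear_combination h1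
  have hF0 : Bc R (fun i => F i 0) := by
    have h1 := (hd.sub (Bc.of_BN hGB L2_S2)).const_mul J⁻¹
    have h2 := (Bc.inv_mul hγ hl ((Bc.of_BN hGB hp).add hc)).const_mul J⁻¹
    have h3 := h1.add h2
    simp only [← key] at h3
    exact h3
  apply BN.toB
  have := hGB.add (BN.of_Bc hF0 L2_S2)
  simpa only [← hF] using this

theorem A_regularity {ι : Type} {R : ι → ℝ} {f r : ι → 𝓢(ℝ, ℂ)} {m : ℕ} (h0 : B R 0 f) (hr : B R m r)
    (h : ∀ i, dS (f i) = r i - tS (f i)) : B R (m+1) f := by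
  induction m with
  | zero =>
    apply B.succ h0
    simp only [h]
    exact hr.sub h0.tS
  | succ m ih =>
    apply B.succ h0
    simp only [h]
    exact hr.sub (ih (hr.mono (Nat.le_succ m))).tS

structure Sol0 (γ : ℝ) : Type where
  τ : ℝ
  W : 𝓢(ℝ, ℂ)
  H : 𝓢(ℝ, ℂ)
  eq : ((γ : ℂ) + τ * Complex.I) • W - dS W + (3 : ℂ) • (dS W - tS (tS (dS W))) + dS (dS (dS W)) = H

namespace Sol0
variable {γ : ℝ}

noncomputable def y (i : Sol0 γ) : 𝓢(ℝ, ℂ) := dS i.W + tS i.W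
noncomputable def z (i : Sol0 γ) : 𝓢(ℝ, ℂ) := dS (dS i.y) + tS (dS i.y)
noncomputable def AH (i : Sol0 γ) : 𝓢(ℝ, ℂ) := dS i.H + tS i.H
/-- smoothed variable -/
noncomputable def ζ (i : Sol0 γ) : 𝓢(ℝ, ℂ) := (exists_solve i.z).choose
theorem ζ_eq (i : Sol0 γ) : i.ζ - dS (dS i.ζ) = i.z := (exists_solve i.z).choose_spec
noncomputable def lam (i : Sol0 γ) : ℂ := (γ : ℂ) + i.τ * Complex.I

theorem z_eq (i : Sol0 γ) : ((γ : ℂ) + i.τ * Complex.I) • i.z - dS i.z + dS (dS (dS i.z)) =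
    dS (dS i.AH) + tS (dS i.AH) := by
  simp only [AH, ← i.eq, z, y, dS_add, dS_sub, dS_smul, dS_tS]
  ext x
  simp only [add_apply, sub_apply, smul_apply, smul_eq_mul, tS_apply]
  ring

theorem y_eq (i : Sol0 γ) : ((γ : ℂ) + i.τ * Complex.I) • i.y + (1/2 : ℂ) • (dS i.y - (3 : ℂ) • tS (tS (dS i.y))) +
    dS (dS (dS i.y)) = i.AH := by
  simp only [AH, ← i.eq, y, dS_add, dS_sub, dS_smul, dS_tS]
  ext x
  simp only [add_apply, sub_apply, smul_apply, smul_eq_mul, tS_apply]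
  ring

noncomputable def η (i : Sol0 γ) : 𝓢(ℝ, ℂ) := ((γ : ℂ) + i.τ * Complex.I) • i.ζ - dS i.ζ + dS (dS (dS i.ζ))

theorem η_eq (i : Sol0 γ) : (i.η + i.AH) - dS (dS (i.η + i.AH)) =
    dS (tS i.AH) + (i.AH - (1/2 : ℂ) • (i.AH - tS (tS i.AH))) := by
  have h := i.z_eq
  rw [← i.ζ_eq] at h
  simp only [η, dS_add, dS_sub, dS_smul, dS_tS] at h ⊢
  ext x
  have h2 := DFunLike.congr_fun h x
  simp only [add_apply, sub_apply, smul_apply, smul_eq_mul, tS_apply] at h2 ⊢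
  linear_combination h2

/-- the quantity controlling everything -/
noncomputable def R (s : ℕ) (i : Sol0 γ) : ℝ := HsSq (s+1) i.H

theorem H_B (s : ℕ) : B (R s) (s+1) (fun i : Sol0 γ => i.H) := ⟨1, zero_le_one, fun i => by simp [R]⟩

theorem AH_B (s : ℕ) : B (R s) s (fun i : Sol0 γ => i.AH) :=
  (H_B s).dS.add ((H_B s).mono (Nat.le_succ s)).tS

theorem ζ_B (hγ : 0 < γ) (s : ℕ) : B (R s) s (fun i : Sol0 γ => i.ζ) := by
  have h1 : B (R s) s (fun i : Sol0 γ => i.η + i.AH) := by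
    obtain ⟨C, hC, h⟩ := (AH_B (γ := γ) s).tS
    obtain ⟨D, hD, h'⟩ := (AH_B (γ := γ) s).sub (((AH_B (γ := γ) s).sub (AH_B s).tS.tS).smul (1/2))
    refine ⟨C + D, by positivity, fun i => ?_⟩
    have := energy_res_Hs s i.η_eq
    linarith [h i, h' i]
  have h2 : B (R s) s (fun i : Sol0 γ => i.η) := by
    have := h1.sub (AH_B s)
    simpa only [add_sub_cancel_right] using this
  obtain ⟨C, hC, h⟩ := h2
  refine ⟨C / γ^2, by positivity, fun i => ?_⟩
  have := energy_free_Hs s hγ (z := i.ζ) (G := i.η) rfl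
  rw [div_mul_eq_mul_div, le_div_iff₀ (by positivity)]
  linarith [h i]

noncomputable def u (i : Sol0 γ) : 𝓢(ℝ, ℂ) := dS i.y + dS i.ζ

theorem u_eq (i : Sol0 γ) : dS i.u = (i.ζ + tS (dS i.ζ)) - tS i.u := by
  have h := i.ζ_eq
  simp only [z] at h
  simp only [u, dS_add, tS_add]
  ext x
  have h2 := DFunLike.congr_fun h x
  simp only [add_apply, sub_apply, tS_apply] at h2 ⊢
  linear_combination -h2

theorem TS2_hasDerivAt (x : ℝ) : HasDerivAt (fun x => T x * S2 x) (S2 x * (1/2 - 3/2 * T x ^ 2)) x := by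
  refine ((T_hasDerivAt' x).mul (S2_hasDerivAt x)).congr_deriv ?_
  unfold S2; ring

theorem TS2_hasDerivAt2 (x : ℝ) : HasDerivAt (fun x => S2 x * (1/2 - 3/2 * T x ^ 2))
    (T x * S2 x * (3 * T x ^ 2 - 2)) x := by
  have h1 : HasDerivAt (fun x => 1/2 - 3/2 * T x ^ 2) (- (3/2 * (2 * T x * (S2 x / 2)))) x := by
    have := (((T_hasDerivAt' x).pow 2).const_mul (3/2)).const_sub (1/2)
    refine this.congr_deriv ?_
    push_cast; ring
  refine ((S2_hasDerivAt x).mul h1).congr_deriv ?_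
  unfold S2; ring

theorem v_functional (i : Sol0 γ) : i.lam * ∫ x, dS i.y x * S2 x =
    (∫ x, dS i.y x * (3/2 * (T x * (S2 x * S2 x)))) + ∫ x, i.AH x * (T x * S2 x) := by
  set v := dS i.y with hv
  set E : 𝓢(ℝ, ℂ) := dS (dS v) + (1/2 : ℂ) • (v - (3 : ℂ) • tS (tS v)) - i.AH with hE
  have hE' : ∀ x, i.lam * v x = - dS E x := by
    have h := congrArg dS i.y_eq
    simp only [dS_add, dS_smul] at h
    intro x
    simp only [hE, dS_sub, dS_add, dS_smul]
    have h2 := DFunLike.congr_fun h x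
    simp only [add_apply, smul_apply, smul_eq_mul, dS_sub, dS_smul, ← hv, sub_apply] at h2 ⊢
    unfold lam
    linear_combination h2
  have lTS : L2 (fun x => T x * S2 x) := L2_T L2_S2
  have l1 : L2 (fun x => S2 x * (1/2 - 3/2 * T x ^ 2)) := by
    have := L2_sub (L2_const_mul (1/2) L2_S2) (L2_const_mul (3/2) (L2_Tpow 2 L2_S2))
    convert this using 2 with x
    ring
  have l2 : L2 (fun x => T x * S2 x * (3 * T x ^ 2 - 2)) := by
    have := L2_sub (L2_const_mul 3 (L2_Tpow 3 L2_S2)) (L2_const_mul 2 lTS)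
    convert this using 2 with x
    ring
  have e1 : i.lam * ∫ x, v x * S2 x = - ∫ x, E x * (T x * S2 x) := by
    rw [← integral_const_mul]
    have : ∀ x, i.lam * (v x * S2 x) = - (dS E x * S2 x) := fun x => by
      rw [← mul_assoc, hE']; ring
    simp only [this]
    rw [integral_neg, int_dS_mul E S2_hasDerivAt L2_S2 (by convert L2_neg lTS using 2; ring), neg_neg,
      ← integral_neg]
    congr 1; funext x; ring
  have e2 : ∫ x, dS (dS v) x * (T x * S2 x) = ∫ x, v x * (T x * S2 x * (3 * T x ^ 2 - 2)) := by
    rw [int_dS_mul (dS v) TS2_hasDerivAt lTS l1, int_dS_mul v TS2_hasDerivAt2 l1 l2, neg_neg]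
  have i1 := int_dS_S (dS (dS v)) lTS
  have i2 := int_dS_S ((1/2 : ℂ) • (v - (3 : ℂ) • tS (tS v))) lTS
  have i3 := int_dS_S i.AH lTS
  have i4 := int_dS_S v l2
  have e3 : ∫ x, E x * (T x * S2 x) = (∫ x, dS (dS v) x * (T x * S2 x)) +
      (∫ x, ((1/2 : ℂ) • (v - (3 : ℂ) • tS (tS v))) x * (T x * S2 x)) - ∫ x, i.AH x * (T x * S2 x) := by
    have i12 : Integrable (fun x => dS (dS v) x * (T x * S2 x) +
      ((1/2 : ℂ) • (v - (3 : ℂ) • tS (tS v))) x * (T x * S2 x)) := i1.add i2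
    rw [← integral_add i1 i2, ← integral_sub i12 i3]
    congr 1; funext x
    simp only [hE, add_apply, sub_apply]
    ring
  rw [e1, e3, e2, ← integral_add i4 i2]
  have e4 : ∫ x, v x * (3/2 * (T x * (S2 x * S2 x))) = - ∫ x, (v x * (T x * S2 x * (3 * T x ^ 2 - 2)) +
      ((1/2 : ℂ) • (v - (3 : ℂ) • tS (tS v))) x * (T x * S2 x)) := by
    rw [← integral_neg]
    congr 1; funext x
    simp only [smul_apply, sub_apply, smul_eq_mul, tS_apply]
    unfold S2; ring
  rw [e4]; ring

theorem int_TS2_cube : ∫ x, S2 x * (3/2 * (T x * (S2 x * S2 x))) = 0 := by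
  have l1 : L2 (fun x => S2 x * S2 x) := L2_mul_S2 L2_S2
  have hd : ∀ x, HasDerivAt (fun x => (-1/2) * (S2 x * (S2 x * S2 x))) (S2 x * (3/2 * (T x * (S2 x * S2 x)))) x := by
    intro x
    refine (((S2_hasDerivAt x).mul ((S2_hasDerivAt x).mul (S2_hasDerivAt x))).const_mul (-1/2)).congr_deriv ?_
    simp only [Pi.mul_apply]
    ring
  exact integral_eq_zero_of_hasDerivAt_of_integrable hd
    (L2_mul_integrable L2_S2 (L2_const_mul _ (L2_T l1))) ((L2_mul_integrable L2_S2 l1).const_mul _)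

theorem u_B0 (hγ : 0 < γ) {s : ℕ} (hs : 1 ≤ s) : B (R s) 0 (fun i : Sol0 γ => i.u) := by
  obtain ⟨s, rfl⟩ : ∃ m, s = m + 1 := ⟨s - 1, by omega⟩
  have hζ := ζ_B hγ (s+1)
  have hζ' := hζ.dS
  have lp : L2 (fun x => 3/2 * (T x * (S2 x * S2 x))) := L2_const_mul _ (L2_T (L2_mul_S2 L2_S2))
  refine A_bound (lam := lam) (p := fun x => 3/2 * (T x * (S2 x * S2 x)))
    (r := fun i => i.ζ + tS (dS i.ζ)) (d := fun i => ∫ x, dS i.ζ x * S2 x)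
    (c := fun i => (∫ x, i.AH x * (T x * S2 x)) - ∫ x, dS i.ζ x * (3/2 * (T x * (S2 x * S2 x)))) hγ (fun i => norm_lam γ i.τ) u_eq
    ((hζ.mono (by omega)).add (hζ'.mono (by omega)).tS) lp int_TS2_cube ?_ ?_ ?_
  · exact (Bc.of_BN (AH_B (s+1)).toBN (L2_T L2_S2)).sub (Bc.of_BN hζ'.toBN lp)
  · exact Bc.of_BN hζ'.toBN L2_S2
  · intro i
    have h := i.v_functional
    have e : ∀ {q : ℝ → ℂ}, L2 q → ∫ x, i.u x * q x = (∫ x, dS i.y x * q x) + ∫ x, dS i.ζ x * q x := by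
      intro q hq
      rw [← integral_add (int_dS_S _ hq) (int_dS_S _ hq)]
      congr 1; funext x; simp only [u, add_apply]; ring
    rw [e L2_S2, e lp]
    linear_combination h

theorem u_B (hγ : 0 < γ) {s : ℕ} (hs : 1 ≤ s) : B (R s) s (fun i : Sol0 γ => i.u) := by
  obtain ⟨m, rfl⟩ : ∃ m, s = m + 1 := ⟨s - 1, by omega⟩
  have hζ := ζ_B hγ (m+1)
  exact A_regularity (u_B0 hγ hs) ((hζ.mono (Nat.le_succ m)).add hζ.dS.tS) u_eq

theorem v_B (hγ : 0 < γ) (m : ℕ) : B (R (m+1)) m (fun i : Sol0 γ => dS i.y) := by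
  have := ((u_B hγ (s := m+1) (by omega)).mono (Nat.le_succ m)).sub (ζ_B hγ (m+1)).dS
  simpa only [u, add_sub_cancel_right] using this

theorem y_B0 (hγ : 0 < γ) (m : ℕ) : B (R (m+1)) 0 (fun i : Sol0 γ => i.y) := by
  have hv := (v_B hγ m).mono (Nat.zero_le m)
  have h := ((AH_B (γ := γ) (m+1)).mono (Nat.zero_le _)).sub ((hv.sub (hv.tS.tS.smul 3)).smul (1/2))
  obtain ⟨C, hC, h⟩ := h
  refine ⟨C / γ^2, by positivity, fun i => ?_⟩
  have h1 : γ ^ 2 * N i.y ≤ N (i.AH - (1/2 : ℂ) • (dS i.y - (3 : ℂ) • tS (tS (dS i.y))) : 𝓢(ℝ, ℂ)) := by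
    apply energy_conclude hγ
    have e : i.AH - (1/2 : ℂ) • (dS i.y - (3 : ℂ) • tS (tS (dS i.y))) =
        ((γ : ℂ) + i.τ * Complex.I) • i.y + dS (dS (dS i.y)) := by
      rw [← i.y_eq]; abel
    rw [e, IP_add, IP_smul, IP_self, IP_dS i.y, Complex.add_re, lam_re, Complex.neg_re, IP_dS_re]
    ring
  have h2 := h i
  rw [HsSq_zero] at h2 ⊢
  rw [div_mul_eq_mul_div, le_div_iff₀ (by positivity)]
  linarith

theorem y_B (hγ : 0 < γ) (m : ℕ) : B (R (m+1)) (m+1) (fun i : Sol0 γ => i.y) :=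
  (y_B0 hγ m).succ (v_B hγ m)

theorem W_eq (i : Sol0 γ) : dS i.W = i.y - tS i.W := by simp [y]

theorem W_eq2 (i : Sol0 γ) : ((γ : ℂ) + i.τ * Complex.I) • i.W = i.H - dS (dS i.y) + tS (dS i.y) - (i.y - tS (tS i.y)) := by
  simp only [← i.eq, y, dS_add, dS_sub, dS_smul, dS_tS]
  ext x
  simp only [add_apply, sub_apply, smul_apply, smul_eq_mul, tS_apply]
  ring

theorem W_B0 (hγ : 0 < γ) (m : ℕ) : B (R (m+1)) 0 (fun i : Sol0 γ => i.W) := by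
  have hv := (v_B hγ m).mono (Nat.zero_le m)
  have hy := y_B0 hγ m
  have hH := (H_B (γ := γ) (m+1)).mono (Nat.zero_le _)
  have lTS : L2 (fun x => - T x * S2 x) := by convert L2_neg (L2_T L2_S2) using 2; ring
  refine A_bound (lam := lam) (p := fun _ => 0) (r := y) (d := fun _ => 0)
    (c := fun i => (∫ x, (i.H + tS (dS i.y) - (i.y - tS (tS i.y))) x * S2 x) + ∫ x, dS i.y x * (- T x * S2 x))
    hγ (fun i => norm_lam γ i.τ) W_eq hy L2_zero (by simp) ?_ ?_ ?_
  · exact (Bc.of_BN ((hH.add hv.tS).sub (hy.sub hy.tS.tS)).toBN L2_S2).add (Bc.of_BN hv.toBN lTS)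
  · exact ⟨0, le_rfl, fun i => by simp⟩
  · intro i
    have h1 := int_dS_mul (dS i.y) S2_hasDerivAt L2_S2 lTS
    have e : ∫ x, dS i.y x * (- T x * S2 x) = - ∫ x, dS (dS i.y) x * S2 x := by rw [h1, neg_neg]
    rw [e, ← sub_eq_add_neg, ← integral_const_mul, ← integral_sub (int_dS_S _ L2_S2) (int_dS_S _ L2_S2)]
    simp only [mul_zero, integral_zero, zero_add]
    congr 1; funext x
    have h2 := DFunLike.congr_fun i.W_eq2 x
    simp only [add_apply, sub_apply, smul_apply, smul_eq_mul, tS_apply] at h2 ⊢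
    unfold lam
    linear_combination (S2 x) * h2

theorem w_B (hγ : 0 < γ) {s : ℕ} (hs : 1 ≤ s) : B (R s) s (fun i : Sol0 γ => dS i.W) := by
  obtain ⟨m, rfl⟩ : ∃ m, s = m + 1 := ⟨s - 1, by omega⟩
  exact (A_regularity (W_B0 hγ m) (y_B hγ m) W_eq).dS

end Sol0

/-! ## Module 5: kernel functions for the nonzero modes -/

theorem exists_cS (μ : ℂ) : ∃ c S : ℝ → ℂ, (∀ x, HasDerivAt c (μ * S x) x) ∧ (∀ x, HasDerivAt S (c x) x) ∧
    c 0 = 1 ∧ S 0 = 0 ∧ ∀ x, c x ^ 2 - μ * S x ^ 2 = 1 := by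
  obtain ⟨ν, hν⟩ := IsAlgClosed.exists_pow_nat_eq μ (n := 2) (by norm_num)
  by_cases h0 : ν = 0
  · subst h0
    have hμ : μ = 0 := by rw [← hν]; simp
    refine ⟨fun _ => 1, fun x => x, fun x => ?_, fun x => ?_, rfl, by simp, fun x => by simp [hμ]⟩
    · simpa [hμ] using hasDerivAt_const x (1 : ℂ)
    · exact (hasDerivAt_id x).ofReal_comp
  · have hl : ∀ x : ℝ, HasDerivAt (fun x : ℝ => ν * (x : ℂ)) ν x := fun x => by
      have := ((hasDerivAt_id x).ofReal_comp).const_mul ν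
      simpa using this
    refine ⟨fun x => Complex.cosh (ν * x), fun x => Complex.sinh (ν * x) / ν, fun x => ?_, fun x => ?_,
      by simp, by simp, fun x => ?_⟩
    · have := (Complex.hasDerivAt_cosh (ν * x)).comp x (hl x)
      refine this.congr_deriv ?_
      rw [← hν]; field_simp
    · have := ((Complex.hasDerivAt_sinh (ν * x)).comp x (hl x)).div_const ν
      refine this.congr_deriv ?_
      field_simp
    · have := Complex.cosh_sq (ν * x)
      rw [← hν, this]; field_simp; ring

noncomputable def sech (x : ℝ) : ℂ := ((1 / Real.cosh (x / 2) : ℝ) : ℂ)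

theorem sech_sq (x : ℝ) : sech x ^ 2 = S2 x := by
  have h := Q_eq x
  unfold Q at h
  unfold sech S2
  rw [T_eq]
  norm_cast
  linarith

theorem sech_hasDerivAt (x : ℝ) : HasDerivAt sech (- (T x / 2) * sech x) x := by
  have hc : Real.cosh (x / 2) ≠ 0 := (Real.cosh_pos _).ne'
  have h1 : HasDerivAt (fun x : ℝ => Real.cosh (x / 2)) (Real.sinh (x / 2) * (1 / 2)) x :=
    ((hasDerivAt_id x).div_const 2).cosh
  have h2 := ((h1.inv hc).ofReal_comp)
  have e : sech = fun y : ℝ => (((fun x : ℝ => Real.cosh (x / 2))⁻¹ y : ℝ) : ℂ) := by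
    funext y; simp [sech]
  rw [e]
  refine h2.congr_deriv ?_
  rw [T_eq]
  unfold th
  rw [Real.tanh_eq_sinh_div_cosh]
  simp only [Pi.inv_apply]
  norm_cast
  field_simp

theorem exists_kernel (b : ℝ) : ∃ kc ks : ℝ → ℂ,
    (∀ x, HasDerivAt kc ((1/4 - b) * ks x - T x / 2 * kc x) x) ∧
    (∀ x, HasDerivAt ks (1 * kc x - T x / 2 * ks x) x) ∧
    kc 0 = 1 ∧ ks 0 = 0 ∧ ∀ x, kc x ^ 2 - (1/4 - b) * ks x ^ 2 = S2 x := by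
  obtain ⟨c, S, hc, hS, c0, S0, hp⟩ := exists_cS (1/4 - b)
  refine ⟨fun x => sech x * c x, fun x => sech x * S x, fun x => ?_, fun x => ?_, ?_, ?_, fun x => ?_⟩
  · refine ((sech_hasDerivAt x).mul (hc x)).congr_deriv ?_; ring
  · refine ((sech_hasDerivAt x).mul (hS x)).congr_deriv ?_; ring
  · simp [sech, c0]
  · simp [S0]
  · rw [← sech_sq]
    linear_combination sech x ^ 2 * hp x

/-- a pair of kernel functions -/
structure KP (b : ℝ) (α β : ℂ) (k m : ℝ → ℂ) : Prop where
  hk : ∀ x, HasDerivAt k (α * m x - T x / 2 * k x) x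
  hm : ∀ x, HasDerivAt m (β * k x - T x / 2 * m x) x
  hab : α * β = 1/4 - b

theorem KP.symm {b : ℝ} {α β : ℂ} {k m : ℝ → ℂ} (h : KP b α β k m) : KP b β α m k :=
  ⟨h.hm, h.hk, by rw [mul_comm]; exact h.hab⟩

/-- first and second derivative of the kernel function -/
noncomputable def k1 (α : ℂ) (k m : ℝ → ℂ) (x : ℝ) : ℂ := α * m x - T x / 2 * k x
noncomputable def k2 (b : ℝ) (α : ℂ) (k m : ℝ → ℂ) (x : ℝ) : ℂ := (T x ^ 2 / 2 - b) * k x - α * (T x * m x)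

theorem KP.d1 {b : ℝ} {α β : ℂ} {k m : ℝ → ℂ} (h : KP b α β k m) (x : ℝ) :
    HasDerivAt (k1 α k m) (k2 b α k m x) x := by
  refine (((h.hm x).const_mul α).sub (((T_hasDerivAt x).div_const 2).mul (h.hk x))).congr_deriv ?_
  unfold k2
  linear_combination (k x) * h.hab

theorem KP.L2 {b : ℝ} (hb : 0 < b) {α β : ℂ} {k m : ℝ → ℂ} (h : KP b α β k m) :
    L2 k ∧ L2 (k1 α k m) := by
  obtain ⟨C, -, hC⟩ := lyapD hb
  have := hC (W := k1 α k m) (X := fun x => - b * k x) (f := fun _ => 0) ?_ ?_ L2_zero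
  · refine ⟨?_, this.1⟩
    have h1 := L2_const_mul (-(b:ℂ)⁻¹) this.2.1
    convert h1 using 2 with x
    have : (b : ℂ) ≠ 0 := by exact_mod_cast hb.ne'
    field_simp
  · intro x
    refine (h.d1 x).congr_deriv ?_
    unfold k1 k2; ring
  · intro x
    refine ((h.hk x).const_mul (-(b : ℂ))).congr_deriv ?_
    unfold k1; ring


/-- polynomials in `T` of degree at most four -/
noncomputable def pc (a0 a1 a2 a3 a4 : ℂ) (x : ℝ) : ℂ :=
  a0 + a1 * T x + a2 * T x ^ 2 + a3 * T x ^ 3 + a4 * T x ^ 4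

theorem pc_hasDerivAt (a0 a1 a2 a3 a4 : ℂ) (x : ℝ) : HasDerivAt (pc a0 a1 a2 a3 a4)
    ((a1 + 2 * a2 * T x + 3 * a3 * T x ^ 2 + 4 * a4 * T x ^ 3) * ((1 - T x ^ 2) / 2)) x := by
  have h := T_hasDerivAt x
  have := ((((h.const_mul a1).const_add a0).add ((h.pow 2).const_mul a2)).add
    ((h.pow 3).const_mul a3)).add ((h.pow 4).const_mul a4)
  refine HasDerivAt.congr_deriv (f := pc a0 a1 a2 a3 a4) this ?_
  push_cast; ring

theorem pc_L2 (a0 a1 a2 a3 a4 : ℂ) {g : ℝ → ℂ} (hg : L2 g) : L2 (fun x => pc a0 a1 a2 a3 a4 x * g x) := by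
  have := L2_add (L2_add (L2_add (L2_add (L2_const_mul a0 hg) (L2_const_mul a1 (L2_Tpow 1 hg)))
    (L2_const_mul a2 (L2_Tpow 2 hg))) (L2_const_mul a3 (L2_Tpow 3 hg))) (L2_const_mul a4 (L2_Tpow 4 hg))
  convert this using 2 with x
  unfold pc; ring

theorem pk_hasDerivAt {b : ℝ} {p k P R : ℝ → ℂ} {P1 R1 : ℂ} {x : ℝ} (hp : HasDerivAt p (- T x * p x - b * k x) x)
    (hk : HasDerivAt k (p x) x) (hP : HasDerivAt P P1 x) (hR : HasDerivAt R R1 x) :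
    HasDerivAt (fun x => P x * p x + R x * k x) ((P1 - T x * P x + R x) * p x + (R1 - b * P x) * k x) x := by
  refine ((hP.mul hp).add (hR.mul hk)).congr_deriv ?_
  ring

structure SolB (γ b : ℝ) : Type where
  τ : ℝ
  V : 𝓢(ℝ, ℂ)
  H : 𝓢(ℝ, ℂ)
  eq : dS (dS (dS (dS V))) - dS (dS V) + (3 : ℂ) • (dS (dS V) - tS (tS (dS (dS V)))) +
    ((γ : ℂ) + τ * Complex.I) • dS V + (3 * (b : ℂ) ^ 2) • V = H

namespace SolB
variable {γ b : ℝ}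
noncomputable def W (i : SolB γ b) : 𝓢(ℝ, ℂ) := dS i.V
noncomputable def lam (i : SolB γ b) : ℂ := (γ : ℂ) + i.τ * Complex.I

theorem functional (hb : 0 < b) {α β : ℂ} {k m : ℝ → ℂ} (h : KP b α β k m) (i : SolB γ b) :
    i.lam * (∫ x, i.W x * k2 b α k m x) + 4 * b * α * (∫ x, i.W x * k2 b β m k x) =
      ∫ x, i.H x * k2 b α k m x := by
  obtain ⟨lk, lp⟩ := h.L2 hb
  obtain ⟨lm, lp'⟩ := h.symm.L2 hb
  set p := k1 α k m with hp
  have dp : ∀ x, HasDerivAt p (- T x * p x - b * k x) x := fun x => by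
    refine (h.d1 x).congr_deriv ?_
    rw [hp]; unfold k1 k2; ring
  have dk : ∀ x, HasDerivAt k (p x) x := h.hk
  -- the test function and its derivatives
  set χ : ℝ → ℂ := fun x => pc 0 (-1) 0 0 0 x * p x + pc (-b) 0 0 0 0 x * k x with hχ
  set χ1 : ℝ → ℂ := fun x => pc (-1/2 - b) 0 (3/2) 0 0 x * p x + pc 0 b 0 0 0 x * k x with hχ1
  set χ2 : ℝ → ℂ := fun x => pc 0 (2 + 2 * b) 0 (-3) 0 x * p x + pc (b + b^2) 0 (-2 * b) 0 0 x * k x with hχ2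
  set χ3 : ℝ → ℂ := fun x => pc ((1 + b)^2) 0 (-(15/2 + 5 * b)) 0 (15/2) x * p x +
    pc 0 (-4 * b - 2 * b^2) 0 (5 * b) 0 x * k x with hχ3
  set g : ℝ → ℂ := fun x => pc 0 (-2) 0 3 0 x * p x + pc (-2 * b) 0 (3 * b) 0 0 x * k x with hg
  set g1 : ℝ → ℂ := fun x => pc (-1 - 2 * b) 0 (15/2 + 3 * b) 0 (-15/2) x * p x +
    pc 0 (5 * b) 0 (-6 * b) 0 x * k x with hg1
  have d0 : ∀ x, HasDerivAt χ (χ1 x) x := fun x => by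
    refine (pk_hasDerivAt (dp x) (dk x) (pc_hasDerivAt ..) (pc_hasDerivAt ..)).congr_deriv ?_
    simp only [hχ1, pc]; ring
  have d1 : ∀ x, HasDerivAt χ1 (χ2 x) x := fun x => by
    refine (pk_hasDerivAt (dp x) (dk x) (pc_hasDerivAt ..) (pc_hasDerivAt ..)).congr_deriv ?_
    simp only [hχ2, pc]; ring
  have d2 : ∀ x, HasDerivAt χ2 (χ3 x) x := fun x => by
    refine (pk_hasDerivAt (dp x) (dk x) (pc_hasDerivAt ..) (pc_hasDerivAt ..)).congr_deriv ?_
    simp only [hχ3, pc]; ring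
  have dg : ∀ x, HasDerivAt g (g1 x) x := fun x => by
    refine (pk_hasDerivAt (dp x) (dk x) (pc_hasDerivAt ..) (pc_hasDerivAt ..)).congr_deriv ?_
    simp only [hg1, pc]; ring
  have l0 : _root_.L2 χ := L2_add (pc_L2 _ _ _ _ _ lp) (pc_L2 _ _ _ _ _ lk)
  have l1 : _root_.L2 χ1 := L2_add (pc_L2 _ _ _ _ _ lp) (pc_L2 _ _ _ _ _ lk)
  have l2 : _root_.L2 χ2 := L2_add (pc_L2 _ _ _ _ _ lp) (pc_L2 _ _ _ _ _ lk)
  have l3 : _root_.L2 χ3 := L2_add (pc_L2 _ _ _ _ _ lp) (pc_L2 _ _ _ _ _ lk)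
  have lg : _root_.L2 g := L2_add (pc_L2 _ _ _ _ _ lp) (pc_L2 _ _ _ _ _ lk)
  have lg1 : _root_.L2 g1 := L2_add (pc_L2 _ _ _ _ _ lp) (pc_L2 _ _ _ _ _ lk)
  have hχk : ∀ x, k2 b α k m x = χ x := fun x => by
    simp only [hχ, hp, pc, k1, k2]; ring
  have lM : _root_.L2 (fun x => k2 b β m k x) := by
    have := L2_add (L2_const_mul (-(b:ℂ)) lm) (L2_neg (L2_T lp'))
    convert this using 2 with x
    simp only [k1, k2]; ring
  simp only [hχk]
  have e1 : ∫ x, dS (dS (dS i.W)) x * χ x = - ∫ x, i.W x * χ3 x := by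
    rw [int_dS_mul _ d0 l0 l1, int_dS_mul _ d1 l1 l2, int_dS_mul _ d2 l2 l3, neg_neg]
  have e2 : ∫ x, dS i.W x * g x = - ∫ x, i.W x * g1 x := int_dS_mul _ dg lg lg1
  have e3 : ∫ x, i.W x * p x = - ∫ x, i.V x * χ x := by
    refine int_dS_mul i.V (fun x => ?_) lp l0
    rw [← hχk]; exact h.d1 x
  have key : ∀ x, i.H x * χ x = dS (dS (dS i.W)) x * χ x - dS i.W x * g x * (-1) + i.lam * (i.W x * χ x)
      + 3 * b^2 * (i.V x * χ x) := by
    intro x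
    rw [← i.eq]
    simp only [add_apply, sub_apply, smul_apply, smul_eq_mul, tS_apply, W, lam, hg, hχ, pc]
    ring
  have keyM : ∀ x, 4 * b * α * (i.W x * k2 b β m k x) =
      -(i.W x * χ3 x) - i.W x * g1 x - 3 * b^2 * (i.W x * p x) := by
    intro x
    have e : 4 * b * α * k2 b β m k x = - χ3 x - g1 x - 3 * b^2 * p x := by
      have ha := h.hab
      simp only [k2, hχ3, hg1, hp, k1, pc]
      linear_combination (-4 * b * T x * k x) * ha
    linear_combination (i.W x) * e
  have i1 := int_dS_S (dS (dS (dS i.W))) l0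
  have i2 := int_dS_S (dS i.W) lg
  have i3 := int_dS_S i.W l0
  have i4 := int_dS_S i.V l0
  have i5 := int_dS_S i.W l3
  have i6 := int_dS_S i.W lg1
  have i7 := int_dS_S i.W lp
  have f1 : ∫ x, i.H x * χ x = (∫ x, dS (dS (dS i.W)) x * χ x) - (∫ x, dS i.W x * g x) * (-1)
      + i.lam * (∫ x, i.W x * χ x) + 3 * b^2 * (∫ x, i.V x * χ x) := by
    simp only [key]
    have j1 : Integrable (fun x => dS (dS (dS i.W)) x * χ x - dS i.W x * g x * (-1)) := i1.sub (i2.mul_const (-1))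
    have j2 : Integrable (fun x => dS (dS (dS i.W)) x * χ x - dS i.W x * g x * (-1) + i.lam * (i.W x * χ x)) :=
      j1.add (i3.const_mul _)
    rw [integral_add j2 (i4.const_mul _), integral_add j1 (i3.const_mul _), integral_sub i1 (i2.mul_const (-1)),
      integral_const_mul, integral_const_mul, integral_mul_const]
  have f2 : 4 * b * α * (∫ x, i.W x * k2 b β m k x) = -(∫ x, i.W x * χ3 x) - (∫ x, i.W x * g1 x)
      - 3 * b^2 * (∫ x, i.W x * p x) := by
    rw [← integral_const_mul]
    simp only [keyM]
    have j0 : Integrable (fun x => -(i.W x * χ3 x)) := i5.neg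
    have j1 : Integrable (fun x => -(i.W x * χ3 x) - i.W x * g1 x) := j0.sub i6
    rw [integral_sub j1 (i7.const_mul _), integral_sub j0 i6, integral_neg, integral_const_mul]
  rw [f1, f2, e1, e2, e3]
  ring

end SolB

/-! ## Module 6: the nonzero modes, first half -/

namespace SolB
variable {γ b : ℝ}

noncomputable def z (i : SolB γ b) : 𝓢(ℝ, ℂ) :=
  dS (dS (dS (dS i.V))) + (2 : ℂ) • tS (dS (dS (dS i.V))) + dS (dS i.V) - ((b : ℂ)^2) • i.V

theorem z_eq (i : SolB γ b) : dS (dS (dS (dS i.z))) - dS (dS i.z) + ((γ : ℂ) + i.τ * Complex.I) • dS i.z +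
    (3 * (b : ℂ)^2) • i.z = dS (dS (dS (dS i.H))) + (2 : ℂ) • tS (dS (dS (dS i.H))) +
      ((2 : ℂ) • dS (dS i.H) - tS (tS (dS (dS i.H)))) - ((b : ℂ)^2) • i.H := by
  simp only [← i.eq, z, dS_add, dS_sub, dS_smul, dS_tS]
  ext x
  simp only [add_apply, sub_apply, smul_apply, smul_eq_mul, tS_apply]
  ring

noncomputable def ζ₀ (i : SolB γ b) : 𝓢(ℝ, ℂ) := (exists_solve i.z).choose
theorem ζ₀_eq (i : SolB γ b) : i.ζ₀ - dS (dS i.ζ₀) = i.z := (exists_solve i.z).choose_spec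

noncomputable def η (i : SolB γ b) : 𝓢(ℝ, ℂ) := dS (dS (dS (dS i.ζ₀))) - dS (dS i.ζ₀) +
  ((γ : ℂ) + i.τ * Complex.I) • dS i.ζ₀ + (3 * (b : ℂ)^2) • i.ζ₀

theorem η_eq (i : SolB γ b) : (i.η + dS (dS i.H)) - dS (dS (i.η + dS (dS i.H))) =
    dS ((2 : ℂ) • tS (dS (dS i.H))) + ((2 : ℂ) • dS (dS i.H) - ((b : ℂ)^2) • i.H) := by
  have h := i.z_eq
  rw [← i.ζ₀_eq] at h
  simp only [η, dS_add, dS_sub, dS_smul, dS_tS] at h ⊢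
  ext x
  have h2 := DFunLike.congr_fun h x
  simp only [add_apply, sub_apply, smul_apply, smul_eq_mul, tS_apply] at h2 ⊢
  linear_combination h2

noncomputable def R (s : ℕ) (i : SolB γ b) : ℝ := HsSq (s+1) i.H

theorem H_B (s : ℕ) : B (R s) (s+1) (fun i : SolB γ b => i.H) := ⟨1, zero_le_one, fun i => by simp [R]⟩

noncomputable def ζ (i : SolB γ b) : 𝓢(ℝ, ℂ) := dS i.ζ₀

theorem ζ_B (hγ : 0 < γ) (m : ℕ) : B (R (m+1)) m (fun i : SolB γ b => i.ζ) := by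
  have hH := H_B (γ := γ) (b := b) (m+1)
  have hH2 := hH.dS.dS
  have h1 : B (R (m+1)) m (fun i : SolB γ b => i.η + dS (dS i.H)) := by
    obtain ⟨C, hC, h⟩ := hH2.tS.smul 2
    obtain ⟨D, hD, h'⟩ := (hH2.smul 2).sub ((hH.mono (by omega : m ≤ m+1+1)).smul ((b:ℂ)^2))
    refine ⟨C + D, by positivity, fun i => ?_⟩
    have := energy_res_Hs m i.η_eq
    linarith [h i, h' i]
  have h2 : B (R (m+1)) m (fun i : SolB γ b => i.η) := by
    have := h1.sub hH2
    simpa only [add_sub_cancel_right] using this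
  obtain ⟨C, hC, h⟩ := h2
  refine ⟨C / γ^2, by positivity, fun i => ?_⟩
  have := energy_F0_Hs (3 * b^2) m hγ (z := i.ζ₀) (G := i.η) (τ := i.τ) (by push_cast; rfl)
  rw [div_mul_eq_mul_div, le_div_iff₀ (by positivity)]
  unfold ζ
  linarith [h i]

noncomputable def X (i : SolB γ b) : 𝓢(ℝ, ℂ) := dS i.W + tS i.W
noncomputable def Y1 (i : SolB γ b) : 𝓢(ℝ, ℂ) := dS i.X + (b : ℂ) • i.W
noncomputable def Y2 (i : SolB γ b) : 𝓢(ℝ, ℂ) := i.Y1 + i.ζ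
noncomputable def X2 (i : SolB γ b) : 𝓢(ℝ, ℂ) := dS i.Y2 + tS i.Y2 - tS i.ζ

theorem Y2_eq (i : SolB γ b) : dS i.Y2 = i.X2 - tS i.Y2 + tS i.ζ := by
  simp only [X2]; abel

theorem X2_eq (i : SolB γ b) : dS i.X2 = (b : ℂ) • i.Y2 + (1 - b : ℂ) • i.ζ := by
  have h := congrArg dS i.ζ₀_eq
  simp only [z, X2, Y2, Y1, X, W, ζ, dS_add, dS_sub, dS_smul, dS_tS, tS_add, tS_sub, tS_smul] at h ⊢
  ext x
  have h2 := DFunLike.congr_fun h x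
  simp only [add_apply, sub_apply, smul_apply, smul_eq_mul, tS_apply] at h2 ⊢
  linear_combination -h2

end SolB

/-- abstract `L²` estimate for the exponentially dichotomous system -/
theorem dichotomy {ι : Type} {R : ι → ℝ} {b : ℝ} (hb : 0 < b) {X2 Y2 ζ : ι → 𝓢(ℝ, ℂ)}
    (hY : ∀ i, dS (Y2 i) = X2 i - tS (Y2 i) + tS (ζ i))
    (hX : ∀ i, dS (X2 i) = (b : ℂ) • (Y2 i) + (1 - b : ℂ) • ζ i) (hζ : B R 0 ζ) :
    B R 0 X2 ∧ B R 0 Y2 := by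
  set κ := Real.sqrt (1 + 4 * b) with hκ
  have hκ2 : κ ^ 2 = 1 + 4 * b := Real.sq_sqrt (by positivity)
  have hκ1 : 1 < κ := by
    have : 0 ≤ κ := Real.sqrt_nonneg _
    nlinarith
  have hpos : ∀ x, 0 < κ - th x := fun x => by linarith [th_lt_one x]
  have hposC : ∀ x, (κ : ℂ) - T x ≠ 0 := fun x => by
    rw [T_eq]; exact_mod_cast (hpos x).ne'
  have hκC : (κ : ℂ) ^ 2 = 1 + 4 * b := by exact_mod_cast hκ2
  have hth := th_continuous
  set a : ℝ → ℝ := fun x => 2 * b / (κ - th x) with ha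
  have hac : Continuous a := by
    rw [ha]
    exact continuous_const.div (continuous_const.sub th_continuous) fun x => (hpos x).ne'
  have haC : ∀ x, ((a x : ℝ) : ℂ) = 2 * b / (κ - T x) := fun x => by
    rw [ha, T_eq]; push_cast; rfl
  set rI : ℝ → ℂ := fun x => ((κ : ℂ) - T x)⁻¹ with hrI
  have hrIc : Continuous rI := (continuous_const.sub T_continuous).inv₀ hposC
  have hrIb : ∀ x, ‖rI x‖ ≤ (κ - 1)⁻¹ := fun x => by
    have : rI x = (((κ - th x)⁻¹ : ℝ) : ℂ) := by rw [hrI]; simp only [T_eq]; push_cast; rfl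
    rw [this, Complex.norm_real, Real.norm_eq_abs, abs_of_pos (inv_pos.2 (hpos x))]
    exact inv_anti₀ (by linarith) (by linarith [th_lt_one x])
  have hab : ∀ x, |a x| ≤ 2 * b / (κ - 1) := fun x => by
    rw [abs_of_pos (div_pos (by positivity) (hpos x))]
    exact div_le_div_of_nonneg_left (by positivity) (by linarith) (by linarith [th_lt_one x])
  have hal : ∀ x, 2 * b / (κ + 1) ≤ a x := fun x =>
    div_le_div_of_nonneg_left (by positivity) (hpos x) (by linarith [neg_one_lt_th x])
  have haCc : Continuous (fun x => ((a x : ℝ) : ℂ)) := by fun_prop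
  have haCb : ∀ x, ‖((a x : ℝ) : ℂ)‖ ≤ 2 * b / (κ - 1) := fun x => by
    rw [Complex.norm_real]; exact hab x
  have hrId : ∀ x, HasDerivAt rI ((1 - T x ^ 2) / 2 * rI x ^ 2) x := fun x => by
    have := ((T_hasDerivAt x).const_sub (κ : ℂ)).inv (hposC x)
    refine HasDerivAt.congr_deriv (f := rI) this ?_
    rw [hrI]; field_simp
  have hae : ∀ x, ((a x : ℝ) : ℂ) = 2 * b * rI x := fun x => by rw [haC, hrI]; ring
  have hrmul : ∀ x, rI x * (κ - T x) = 1 := fun x => inv_mul_cancel₀ (hposC x)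
  clear_value rI a
  set P : ι → ℝ → ℂ := fun i x => X2 i x - (a x : ℝ) * Y2 i x with hP
  have hPd : ∀ i x, HasDerivAt (P i) ((1 - b - (a x : ℝ) * T x) * ζ i x - (a x : ℝ) * P i x) x := fun i x => by
    have h1 := (dS_hasDerivAt (X2 i) x).sub (((hrId x).const_mul (2 * (b:ℂ))).mul (dS_hasDerivAt (Y2 i) x))
    have e : P i = fun x => X2 i x - (2 * b * rI x) * Y2 i x := by
      funext x; simp only [hP, hae]
    rw [e]
    refine HasDerivAt.congr_deriv (f := fun x => X2 i x - (2 * b * rI x) * Y2 i x) h1 ?_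
    rw [hX, hY]
    simp only [hae, add_apply, sub_apply, smul_apply, smul_eq_mul, tS_apply]
    have := hrmul x
    have e2 : (1 - T x ^ 2) * rI x ^ 2 = 1 + 2 * T x * rI x - 4 * b * rI x ^ 2 := by
      have : ((1 - T x ^ 2) - (κ ^2 - T x ^ 2 - 4 * b)) * rI x ^ 2 = 0 := by rw [hκC]; ring
      linear_combination this + (rI x * (κ - T x) + 1 + 2 * T x * rI x) * hrmul x
    linear_combination (- b * Y2 i x) * e2
  have hPL : ∀ i, L2 (P i) := fun i => L2_sub (L2_S _) (L2_mul_bdd haCc haCb (L2_S _))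
  have hζN := hζ.toBN
  have hPB : BN R P := by
    have hr : BN R (fun i x => (1 - b - (a x : ℝ) * T x) * ζ i x) := by
      have := (hζN.const_mul (1 - b)).sub (BN.mul_bdd haCc haCb hζN.T)
      convert this using 3
      ring
    obtain ⟨l, C, hC, h⟩ := hr
    refine ⟨hPL, (1 / (2 * b / (κ + 1))^2) * C, by positivity, fun i => ?_⟩
    have := first_order (σ := 1) hac hab (α₀ := 2 * b / (κ + 1)) (by positivity) (by norm_num)
      (by simpa using hal) (hPL i) (l i) (hPd i)
    rw [mul_assoc]
    exact this.trans (mul_le_mul_of_nonneg_left (h i) (by positivity))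
  set U : ι → ℝ → ℂ := fun i x => rI x * Y2 i x with hU
  have hUd : ∀ i x, HasDerivAt (U i) (rI x * (P i x + T x * ζ i x) - ((-(κ - th x) / 2 : ℝ) : ℂ) * U i x) x :=
    fun i x => by
    have h1 := (hrId x).mul (dS_hasDerivAt (Y2 i) x)
    refine HasDerivAt.congr_deriv (f := U i) h1 ?_
    rw [hY]
    push_cast
    simp only [hU, hP, hae, ← T_eq, Pi.add_apply, Pi.sub_apply, tS_apply]
    have := hrmul x
    have e3 : (1 - T x ^ 2) / 2 * rI x ^ 2 - T x * rI x + 2 * b * rI x ^ 2 = 1 / 2 := by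
      have : (4 * b - (κ ^ 2 - 1)) * rI x ^ 2 = 0 := by rw [hκC]; ring
      linear_combination (1/2) * this + (1/2) * (rI x * (κ - T x) + 1) * hrmul x + T x * rI x * hrmul x
    linear_combination (Y2 i x) * e3 - (1/2) * Y2 i x * hrmul x
  have hUL : ∀ i, L2 (U i) := fun i => L2_mul_bdd hrIc hrIb (L2_S _)
  have hUB : BN R U := by
    have hr : BN R (fun i x => rI x * (P i x + T x * ζ i x)) := BN.mul_bdd hrIc hrIb (hPB.add hζN.T)
    obtain ⟨l, C, hC, h⟩ := hr
    have hk0 : 0 < (κ - 1) / 2 := by linarith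
    refine ⟨hUL, (1 / ((κ - 1) / 2)^2) * C, by positivity, fun i => ?_⟩
    have := first_order (σ := -1) (α := fun x => -(κ - th x) / 2) (M := (κ + 1) / 2) (by fun_prop) (fun x => by
        rw [abs_le]; constructor <;> linarith [neg_one_lt_th x, th_lt_one x]) hk0 (by norm_num)
      (fun x => by linarith [th_lt_one x]) (hUL i) (l i) (hUd i)
    rw [mul_assoc]
    exact this.trans (mul_le_mul_of_nonneg_left (h i) (by positivity))
  have hYB : BN R (fun i => ⇑(Y2 i)) := by
    have := (hUB.const_mul κ).sub hUB.T
    convert this using 3 with i x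
    simp only [hU]
    linear_combination (- Y2 i x) * hrmul x
  have hXB : BN R (fun i => ⇑(X2 i)) := by
    have := hPB.add (BN.mul_bdd haCc haCb hYB)
    convert this using 3 with i x
    simp only [hP]; ring
  exact ⟨hXB.toB, hYB.toB⟩

namespace SolB
variable {γ b : ℝ}

theorem XY2_B (hγ : 0 < γ) (hb : 0 < b) (m : ℕ) :
    B (R (m+1)) m (fun i : SolB γ b => i.X2) ∧ B (R (m+1)) m (fun i : SolB γ b => i.Y2) := by
  have hζ := ζ_B (b := b) hγ m
  have h0 := dichotomy hb Y2_eq X2_eq (hζ.mono (Nat.zero_le m))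
  suffices H : ∀ n ≤ m, B (R (m+1)) n (fun i : SolB γ b => i.X2) ∧ B (R (m+1)) n (fun i : SolB γ b => i.Y2) from
    H m le_rfl
  intro n
  induction n with
  | zero => intro _; exact h0
  | succ n ih =>
    intro hn
    obtain ⟨h1, h2⟩ := ih (by omega)
    have hz := hζ.mono (by omega : n ≤ m)
    refine ⟨h0.1.succ ?_, h0.2.succ ?_⟩
    · simp only [X2_eq]; exact (h2.smul b).add (hz.smul (1 - b))
    · simp only [Y2_eq]; exact (h1.sub h2.tS).add hz.tS

theorem Y1_B (hγ : 0 < γ) (hb : 0 < b) (m : ℕ) : B (R (m+1)) m (fun i : SolB γ b => i.Y1) := by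
  have := (XY2_B hγ hb m).2.sub (ζ_B hγ m)
  simpa only [Y2, add_sub_cancel_right] using this

end SolB

/-! ## Module 7: the nonzero modes, second half -/

theorem int_prod_deriv {f g f1 g1 : ℝ → ℂ} (hf : ∀ x, HasDerivAt f (f1 x) x) (hg : ∀ x, HasDerivAt g (g1 x) x)
    (lf : L2 f) (lg : L2 g) (lf1 : L2 f1) (lg1 : L2 g1) :
    (∫ x, f x * g1 x) = - ∫ x, g x * f1 x := by
  have hd : ∀ x, HasDerivAt (fun x => f x * g x) (g x * f1 x + f x * g1 x) x := fun x =>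
    ((hf x).mul (hg x)).congr_deriv (by ring)
  have := integral_eq_zero_of_hasDerivAt_of_integrable hd
    ((L2_mul_integrable lg lf1).add (L2_mul_integrable lf lg1)) (L2_mul_integrable lf lg)
  rw [integral_add (L2_mul_integrable lg lf1) (L2_mul_integrable lf lg1)] at this
  linear_combination this

theorem int_S2_ne (h : Integrable S2) : (∫ x, S2 x) ≠ 0 := by
  have e : ∀ x, S2 x = ((1 - th x ^ 2 : ℝ) : ℂ) := fun x => by unfold S2; rw [T_eq]; push_cast; ring
  have hi : Integrable (fun x => 1 - th x ^ 2) := by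
    have := h.re
    refine this.congr (Filter.Eventually.of_forall fun x => ?_)
    simp only [e]; exact Complex.ofReal_re _
  simp only [e]
  rw [integral_complex_ofReal]
  have hth := th_continuous
  have := integral_pos_of_integrable_nonneg_nonzero (μ := volume) (f := fun x => 1 - th x ^ 2) (x := 0)
    (by fun_prop) hi (fun x => by have := th_sq_lt x; simp only [Pi.zero_apply]; linarith) (by simp [th_zero])
  exact_mod_cast this.ne'

theorem KP.L2_k2 {b : ℝ} (hb : 0 < b) {α β : ℂ} {k m : ℝ → ℂ} (h : KP b α β k m) : _root_.L2 (k2 b α k m) := by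
  obtain ⟨lk, lp⟩ := h.L2 hb
  have := L2_add (L2_const_mul (-(b:ℂ)) lk) (L2_neg (L2_T lp))
  convert this using 2 with x
  simp only [k1, k2]; ring

theorem resolvent_coeff {γ δ τ : ℝ} {ρ : ℂ} (hδ : 0 < δ) (hρ : |ρ.re| ≤ γ - δ) :
    let l : ℂ := (γ : ℂ) + τ * Complex.I
    l ^ 2 - ρ ^ 2 ≠ 0 ∧ ‖l / (l ^ 2 - ρ ^ 2)‖ ≤ 1 / δ ∧ ‖1 / (l ^ 2 - ρ ^ 2)‖ ≤ 1 / δ * (1 / δ) := by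
  intro l
  obtain ⟨h1, h2⟩ := abs_le.1 hρ
  have a1 : δ ≤ ‖l - ρ‖ := by
    have := Complex.re_le_norm (l - ρ)
    simp [l] at this ⊢
    linarith
  have a2 : δ ≤ ‖l + ρ‖ := by
    have := Complex.re_le_norm (l + ρ)
    simp [l] at this ⊢
    linarith
  have n1 : l - ρ ≠ 0 := norm_pos_iff.1 (hδ.trans_le a1)
  have n2 : l + ρ ≠ 0 := norm_pos_iff.1 (hδ.trans_le a2)
  have b1 : ‖1 / (l - ρ)‖ ≤ 1 / δ := by
    rw [norm_div, norm_one]; exact one_div_le_one_div_of_le hδ a1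
  have b2 : ‖1 / (l + ρ)‖ ≤ 1 / δ := by
    rw [norm_div, norm_one]; exact one_div_le_one_div_of_le hδ a2
  have e : l ^ 2 - ρ ^ 2 = (l - ρ) * (l + ρ) := by ring
  rw [e]
  refine ⟨mul_ne_zero n1 n2, ?_, ?_⟩
  · have : l / ((l - ρ) * (l + ρ)) = (1/2) * (1 / (l - ρ) + 1 / (l + ρ)) := by
      field_simp; ring
    rw [this, norm_mul]
    have h3 := norm_add_le (1 / (l - ρ)) (1 / (l + ρ))
    have h4 : ‖(1/2 : ℂ)‖ = 1/2 := by simp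
    rw [h4]; linarith
  · have : 1 / ((l - ρ) * (l + ρ)) = (1 / (l - ρ)) * (1 / (l + ρ)) := by field_simp
    rw [this, norm_mul]
    gcongr

namespace SolB
variable {γ b : ℝ}

theorem X_eq (i : SolB γ b) : dS i.X = i.Y1 - (b : ℂ) • i.W := by simp [Y1]
theorem W_eq (i : SolB γ b) : dS i.W = i.X - tS i.W := by simp [X]

/-- the two functionals are bounded -/
theorem ell_B (hb : 0 < b) {δ : ℝ} {ρ : ℂ} (hδ : 0 < δ) (hρ : |ρ.re| ≤ γ - δ)
    (hρ2 : ρ ^ 2 = 16 * b ^ 2 * (1/4 - b)) {α β : ℂ} {k m : ℝ → ℂ} (h : KP b α β k m) (s : ℕ) :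
    Bc (R s) (fun i : SolB γ b => ∫ x, i.W x * k2 b α k m x) := by
  have hH := (H_B (γ := γ) (b := b) s).toBN
  have h1 := Bc.of_BN hH (h.L2_k2 hb)
  have h2 := Bc.of_BN hH (h.symm.L2_k2 hb)
  have c1 : Bc (R s) (fun i : SolB γ b => i.lam / (i.lam ^ 2 - ρ ^ 2) * ∫ x, i.H x * k2 b α k m x) :=
    Bc.of_le (1 / δ) h1 fun i => by
      rw [norm_mul]
      gcongr
      exact (resolvent_coeff (τ := i.τ) hδ hρ).2.1
  have c2 : Bc (R s) (fun i : SolB γ b => 1 / (i.lam ^ 2 - ρ ^ 2) * ∫ x, i.H x * k2 b β m k x) :=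
    Bc.of_le (1 / δ * (1 / δ)) h2 fun i => by
      rw [norm_mul]
      gcongr
      exact (resolvent_coeff (τ := i.τ) hδ hρ).2.2
  have := c1.sub (c2.const_mul (4 * b * α))
  convert this using 2 with i
  have f1 := i.functional hb h
  have f2 := i.functional hb h.symm
  have hD := (resolvent_coeff (τ := i.τ) hδ hρ).1
  change i.lam ^ 2 - ρ ^ 2 ≠ 0 at hD
  rw [← f1, ← f2]
  field_simp
  have hab := h.hab
  rw [hρ2]
  linear_combination (16 * b^2 * ∫ x, i.W x * k2 b α k m x) * hab

theorem W_B0 (hγ : 0 < γ) (hb : 0 < b) {δ : ℝ} {ρ : ℂ} (hδ : 0 < δ) (hρ : |ρ.re| ≤ γ - δ)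
    (hρ2 : ρ ^ 2 = 16 * b ^ 2 * (1/4 - b)) (m : ℕ) :
    B (R (m+1)) 0 (fun i : SolB γ b => i.W) ∧ B (R (m+1)) 0 (fun i : SolB γ b => i.X) := by
  obtain ⟨kc, ks, hc, hs, c0, s0, hW⟩ := exists_kernel b
  have hkp : KP b (1/4 - b) 1 kc ks := ⟨hc, hs, by ring⟩
  have hbC : (b : ℂ) ≠ 0 := by exact_mod_cast hb.ne'
  obtain ⟨lc, lc1⟩ := hkp.L2 hb
  obtain ⟨ls, ls1⟩ := hkp.symm.L2 hb
  have lc2 := hkp.L2_k2 hb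
  have ls2 := hkp.symm.L2_k2 hb
  have dc1 := hkp.d1
  have ds1 := hkp.symm.d1
  have ellc := ell_B (γ := γ) hb hδ hρ hρ2 hkp (m+1)
  have ells := ell_B (γ := γ) hb hδ hρ hρ2 hkp.symm (m+1)
  have dc : ∀ x, HasDerivAt kc (k1 (1/4 - b) kc ks x) x := hc
  have ds : ∀ x, HasDerivAt ks (k1 1 ks kc x) x := hs
  have ec2 : ∀ x, k2 b (1/4 - b) kc ks x = - b * kc x - T x * k1 (1/4 - b) kc ks x := fun x => by
    unfold k1 k2; ring
  have es2 : ∀ x, k2 b 1 ks kc x = - b * ks x - T x * k1 1 ks kc x := fun x => by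
    unfold k1 k2; ring
  have c10 : k1 (1/4 - b) kc ks 0 = 0 := by simp [k1, s0, T_eq, th_zero]
  have s10 : k1 1 ks kc 0 = 1 := by simp [k1, c0, T_eq, th_zero]
  have wr : ∀ x, kc x * k1 1 ks kc x - ks x * k1 (1/4 - b) kc ks x = S2 x := fun x => by
    rw [← hW]; unfold k1; ring
  have icc : ∫ x, k1 (1/4 - b) kc ks x * k2 b (1/4 - b) kc ks x = 0 := by
    have := int_prod_deriv dc1 dc1 lc1 lc1 lc2 lc2
    linear_combination (1/2) * this
  have iss : ∫ x, k1 1 ks kc x * k2 b 1 ks kc x = 0 := by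
    have := int_prod_deriv ds1 ds1 ls1 ls1 ls2 ls2
    linear_combination (1/2) * this
  have isc := int_prod_deriv ds1 dc1 ls1 lc1 ls2 lc2
  set q := ∫ x, k1 1 ks kc x * k2 b (1/4 - b) kc ks x with hq
  have hq0 : q ≠ 0 := by
    have hS : Integrable S2 := by
      have := (L2_mul_integrable lc ls1).sub (L2_mul_integrable ls lc1)
      refine this.congr (Filter.Eventually.of_forall fun x => ?_)
      simpa using wr x
    have h2q : 2 * q = - b * ∫ x, S2 x := by
      have e : (∫ x, k1 1 ks kc x * k2 b (1/4 - b) kc ks x) - (∫ x, k1 (1/4 - b) kc ks x * k2 b 1 ks kc x) =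
          - b * ∫ x, S2 x := by
        rw [← integral_sub (L2_mul_integrable ls1 lc2) (L2_mul_integrable lc1 ls2), ← integral_const_mul]
        congr 1; funext x
        rw [ec2, es2, ← wr]; ring
      linear_combination e + isc
    intro h0
    rw [h0, mul_zero] at h2q
    exact mul_ne_zero (neg_ne_zero.2 hbC) (int_S2_ne hS) h2q.symm
  clear_value q
  have isc' : ∫ x, k1 (1/4 - b) kc ks x * k2 b 1 ks kc x = - q := by linear_combination isc
  have hY : BN (R (m+1)) (fun i : SolB γ b => ⇑i.Y1) := (Y1_B hγ hb m).toBN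
  set p1 := k1 1 ks kc with hp1
  set p2 := k1 (1/4 - b : ℂ) kc ks with hp2
  clear_value p1 p2
  set Wt : SolB γ b → ℝ → ℂ := fun i x => i.W x - i.W 0 * p1 x + i.X 0 / b * p2 x with hWt
  set Xt : SolB γ b → ℝ → ℂ := fun i x => i.X x + i.W 0 * (b * ks x) - i.X 0 * kc x with hXt
  have hWd : ∀ i x, HasDerivAt (Wt i) (Xt i x - T x * Wt i x) x := fun i x => by
    have := ((dS_hasDerivAt i.W x).sub ((ds1 x).const_mul (i.W 0))).add ((dc1 x).const_mul (i.X 0 / b))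
    refine HasDerivAt.congr_deriv (f := Wt i) this ?_
    rw [i.W_eq, ec2, es2]
    simp only [hWt, hXt, sub_apply, tS_apply]
    field_simp; ring
  have hXd : ∀ i x, HasDerivAt (Xt i) (i.Y1 x - b * Wt i x) x := fun i x => by
    have := ((dS_hasDerivAt i.X x).add (((ds x).const_mul (b:ℂ)).const_mul (i.W 0))).sub ((dc x).const_mul (i.X 0))
    refine HasDerivAt.congr_deriv (f := Xt i) this ?_
    rw [i.X_eq]
    simp only [hWt, sub_apply, smul_apply, smul_eq_mul]
    field_simp; ring
  have hW0 : ∀ i, Wt i 0 = 0 := fun i => by simp [hWt, c10, s10]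
  have hX0 : ∀ i, Xt i 0 = 0 := fun i => by simp [hXt, c0, s0]
  obtain ⟨C, hC, hl⟩ := lyapD hb
  have BW : BN (R (m+1)) Wt := by
    obtain ⟨l, D, hD, hY⟩ := hY
    refine ⟨fun i => (hl (hWd i) (hXd i) (l i)).1, C * D, by positivity, fun i => ?_⟩
    have := (hl (hWd i) (hXd i) (l i)).2.2.1
    rw [hW0, hX0] at this
    have h3 := mul_le_mul_of_nonneg_left (hY i) hC
    simp at this
    linarith
  have BX : BN (R (m+1)) Xt := by
    obtain ⟨l, D, hD, hY⟩ := hY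
    refine ⟨fun i => (hl (hWd i) (hXd i) (l i)).2.1, C * D, by positivity, fun i => ?_⟩
    have := (hl (hWd i) (hXd i) (l i)).2.2.2
    rw [hW0, hX0] at this
    have h3 := mul_le_mul_of_nonneg_left (hY i) hC
    simp at this
    linarith
  have split : ∀ (i : SolB γ b) {g : ℝ → ℂ}, L2 g → ∫ x, i.W x * g x = (∫ x, Wt i x * g x) +
      i.W 0 * (∫ x, p1 x * g x) - i.X 0 / b * ∫ x, p2 x * g x := fun i g hg => by
    have e : ∀ x, i.W x * g x = Wt i x * g x + i.W 0 * (p1 x * g x) - i.X 0 / b * (p2 x * g x) := fun x => by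
      simp only [hWt]; ring
    simp only [e]
    have j1 := L2_mul_integrable (BW.1 i) hg
    have j2 := (L2_mul_integrable ls1 hg).const_mul (i.W 0)
    have j3 := (L2_mul_integrable lc1 hg).const_mul (i.X 0 / b)
    have j4 : Integrable (fun x => Wt i x * g x + i.W 0 * (p1 x * g x)) := j1.add j2
    rw [integral_sub j4 j3, integral_add j1 j2, integral_const_mul, integral_const_mul]
  have BW0 : Bc (R (m+1)) (fun i : SolB γ b => i.W 0) := by
    have := (ellc.sub (Bc.of_BN BW lc2)).const_mul q⁻¹
    convert this using 2 with i
    rw [split i lc2, icc, ← hq]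
    field_simp; ring
  have BX0 : Bc (R (m+1)) (fun i : SolB γ b => i.X 0 / b) := by
    have := (ells.sub (Bc.of_BN BW ls2)).const_mul q⁻¹
    convert this using 2 with i
    rw [split i ls2, iss, isc']
    field_simp; ring
  constructor
  · refine BN.toB ?_
    have := (BW.add (BN.of_Bc BW0 ls1)).sub (BN.of_Bc BX0 lc1)
    convert this using 3 with i x
    simp only [hWt]; ring
  · refine BN.toB ?_
    have := (BX.sub (BN.of_Bc BW0 (L2_const_mul (b:ℂ) ls))).add (BN.of_Bc BX0 (L2_const_mul (b:ℂ) lc))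
    convert this using 3 with i x
    simp only [hXt]
    field_simp; ring

theorem w_B (hγ : 0 < γ) (hb : 0 < b) {δ : ℝ} {ρ : ℂ} (hδ : 0 < δ) (hρ : |ρ.re| ≤ γ - δ)
    (hρ2 : ρ ^ 2 = 16 * b ^ 2 * (1/4 - b)) {s : ℕ} (hs : 1 ≤ s) :
    B (R s) s (fun i : SolB γ b => dS i.W) := by
  obtain ⟨m, rfl⟩ : ∃ m, s = m + 1 := ⟨s - 1, by omega⟩
  have h0 := W_B0 hγ hb hδ hρ hρ2 m
  have hY := Y1_B hγ hb m
  have H : ∀ n ≤ m + 1, B (R (m+1)) n (fun i : SolB γ b => i.W) ∧ B (R (m+1)) n (fun i : SolB γ b => i.X) := by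
    intro n
    induction n with
    | zero => intro _; exact h0
    | succ n ih =>
      intro hn
      obtain ⟨h1, h2⟩ := ih (by omega)
      refine ⟨h0.1.succ ?_, h0.2.succ ?_⟩
      · simp only [W_eq]; exact h2.sub h1.tS
      · simp only [X_eq]; exact (hY.mono (by omega : n ≤ m)).sub (h1.smul b)
  obtain ⟨h1, h2⟩ := H (m+1) le_rfl
  simp only [W_eq]
  exact h2.sub h1.tS

end SolB

/-! ## Module 8: spectral condition and assembly -/

theorem sigma0_bdd (L : ℝ) : BddAbove {x : ℝ | ∃ μ : ℝ, 1 < μ ∧ μ < 2 ∧ x = μ * (μ - 1) * (2 - μ) / 2 ∧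
    ∃ k : ℤ, (k : ℝ) = Real.sqrt 3 * L / 4 * (μ * (2 - μ))} := by
  refine ⟨1, ?_⟩
  rintro x ⟨μ, h1, h2, rfl, -⟩
  have a : (μ - 1) * (2 - μ) ≤ 1 := by nlinarith
  nlinarith

theorem sigma0_nonneg (L : ℝ) : 0 ≤ sigma0 L := by
  refine Real.sSup_nonneg ?_
  rintro x ⟨μ, h1, h2, rfl, -⟩
  have : 0 < (μ - 1) * (2 - μ) := mul_pos (by linarith) (by linarith)
  nlinarith

theorem spectral {L b : ℝ} {k : ℤ} (hb : 0 < b) (hk : ((|k| : ℤ) : ℝ) = Real.sqrt 3 * L * b) :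
    ∃ ρ : ℂ, |ρ.re| ≤ sigma0 L ∧ ρ ^ 2 = 16 * b ^ 2 * (1/4 - b) := by
  rcases lt_or_ge b (1/4) with h | h
  · set r := Real.sqrt (1 - 4 * b) with hr
    have hr2 : r ^ 2 = 1 - 4 * b := Real.sq_sqrt (by linarith)
    have hr0 : 0 < r := Real.sqrt_pos.2 (by linarith)
    have hr1 : r < 1 := by nlinarith
    refine ⟨((2 * b * r : ℝ) : ℂ), ?_, ?_⟩
    · rw [Complex.ofReal_re, abs_of_pos (by positivity)]
      refine le_csSup (sigma0_bdd L) ⟨1 + r, by linarith, by linarith, ?_, |k|, ?_⟩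
      · linear_combination (r/2) * hr2
      · rw [hk]
        linear_combination (Real.sqrt 3 * L / 4) * hr2
    · have : (r : ℂ) ^ 2 = 1 - 4 * b := by exact_mod_cast hr2
      push_cast
      linear_combination (4 * (b:ℂ)^2) * this
  · set r := Real.sqrt (4 * b - 1) with hr
    have hr2 : r ^ 2 = 4 * b - 1 := Real.sq_sqrt (by linarith)
    refine ⟨((2 * b * r : ℝ) : ℂ) * Complex.I, ?_, ?_⟩
    · simpa using sigma0_nonneg L
    · have : (r : ℂ) ^ 2 = 4 * b - 1 := by exact_mod_cast hr2
      push_cast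
      linear_combination (4 * (b:ℂ)^2 * Complex.I ^ 2) * this + (4 * (b:ℂ)^2 * (4 * b - 1)) * Complex.I_sq

/-- the resolvent equation as an identity of Schwartz functions -/
theorem ResolventEq.schwartz {L γ τ : ℝ} {k : ℤ} {w W H : 𝓢(ℝ, ℂ)} (h : ResolventEq L γ τ k w W H) :
    dS W = w ∧ dS (((γ : ℂ) + τ * Complex.I) • W - w + (3 : ℂ) • (w - tS (tS w)) + dS (dS w)) +
      (((k : ℝ) ^ 2 / L ^ 2 : ℝ) : ℂ) • W = dS H := by
  obtain ⟨h1, h2⟩ := h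
  have hw : dS W = w := by ext x; rw [dS_apply, h1]
  refine ⟨hw, ?_⟩
  ext x
  have h3 := h2 x
  have e1 : (fun y : ℝ => (Q y : ℂ) * w y) = ⇑((3 : ℂ) • (w - tS (tS w))) := by
    funext y
    simp only [sub_apply, smul_apply, smul_eq_mul, tS_apply]
    rw [Q_eq, T_eq]; push_cast; ring
  have e2 : iteratedDeriv 3 w x = dS (dS (dS w)) x := by
    rw [iteratedDeriv_succ, iteratedDeriv_succ, iteratedDeriv_one, ← dS_coe, ← dS_coe, ← dS_apply]
  rw [e1, ← dS_apply, ← dS_apply, ← dS_apply, e2] at h3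
  rw [← h3]
  simp only [dS_add, dS_sub, dS_smul, hw]
  simp only [add_apply, sub_apply, smul_apply, smul_eq_mul]

theorem dS_eq_zero {f : 𝓢(ℝ, ℂ)} (h : dS f = 0) : f = 0 := by
  have hd : ∀ x, deriv f x = 0 := fun x => by rw [← dS_apply, h]; rfl
  have hc := is_const_of_deriv_eq_zero f.differentiable hd
  have e : ⇑f = fun _ => f 0 := funext fun x => hc x 0
  have ht : Filter.Tendsto f (Filter.cocompact ℝ) (nhds 0) := ZeroAtInftyContinuousMapClass.zero_at_infty f
  rw [e] at ht
  have h0 : f 0 = 0 := tendsto_nhds_unique tendsto_const_nhds ht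
  ext x
  rw [hc x 0, h0]; rfl

theorem mode_estimate {L γ : ℝ} (hL : 0 < L) (hγ : sigma0 L < γ) {s : ℕ} (hs : 1 ≤ s) (k : ℤ) :
    ∃ C : ℝ, 0 ≤ C ∧ ∀ τ : ℝ, ∀ w W H : 𝓢(ℝ, ℂ), ResolventEq L γ τ k w W H →
      HsSq s w ≤ C * HsSq (s + 1) H := by
  have hγ0 : 0 < γ := (sigma0_nonneg L).trans_lt hγ
  by_cases hk : k = 0
  · subst hk
    obtain ⟨C, hC, h⟩ := Sol0.w_B hγ0 hs
    refine ⟨C, hC, fun τ w W H hr => ?_⟩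
    obtain ⟨hw, he⟩ := hr.schwartz
    have he' : ((γ : ℂ) + τ * Complex.I) • W - w + (3 : ℂ) • (w - tS (tS w)) + dS (dS w) = H := by
      rw [← sub_eq_zero]
      refine dS_eq_zero ?_
      rw [dS_sub, ← he]
      simp
    have := h ⟨τ, W, H, by rw [hw]; exact he'⟩
    simpa only [hw, Sol0.R] using this
  · set b := |(k : ℝ)| / (L * Real.sqrt 3) with hbd
    have h3 : 0 < Real.sqrt 3 := by positivity
    have hk' : (k : ℝ) ≠ 0 := by exact_mod_cast hk
    have hb : 0 < b := by positivity
    have hb2 : 3 * b ^ 2 = (k : ℝ) ^ 2 / L ^ 2 := by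
      rw [hbd, div_pow, sq_abs, mul_pow, Real.sq_sqrt (by norm_num)]; field_simp
    obtain ⟨ρ, hρ, hρ2⟩ := spectral (L := L) (k := k) hb (by
      rw [hbd]; push_cast; field_simp)
    obtain ⟨C, hC, h⟩ := SolB.w_B (γ := γ) hγ0 hb (δ := γ - sigma0 L) (by linarith) (by linarith) hρ2 hs
    refine ⟨C, hC, fun τ w W H hr => ?_⟩
    obtain ⟨hw, he⟩ := hr.schwartz
    rw [← hb2] at he
    have hbC : (3 * (b:ℂ) ^ 2) ≠ 0 := by
      have : (b : ℂ) ≠ 0 := by exact_mod_cast hb.ne'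
      exact mul_ne_zero (by norm_num) (pow_ne_zero 2 this)
    set E := ((γ : ℂ) + τ * Complex.I) • W - w + (3 : ℂ) • (w - tS (tS w)) + dS (dS w) with hE
    have hV : dS ((3 * (b:ℂ) ^ 2)⁻¹ • (H - E)) = W := by
      rw [dS_smul, dS_sub, ← he, add_sub_cancel_left, smul_smul]
      push_cast
      rw [inv_mul_cancel₀ hbC, one_smul]
    have := h ⟨τ, (3 * (b:ℂ) ^ 2)⁻¹ • (H - E), H, by
      rw [hV, hw, smul_smul, mul_inv_cancel₀ hbC, one_smul, hE]
      abel⟩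
    simpa only [SolB.W, hV, hw, SolB.R] using this

/-- Uniform resolvent estimate: for `L > 4/√3`, `γ₀ > σ₀`, all `τ ∈ ℝ` and all
transverse modes `|k/L| ≤ K`, `‖w‖²_{H^s} ≤ C ‖H‖²_{H^{s+1}}`. -/
theorem resolvent_estimate (L : ℝ) (hL : L > 4 / Real.sqrt 3) (s : ℕ) (hs : 1 ≤ s)
    (K γ₀ : ℝ) (hK : 0 < K) (hγ₀ : sigma0 L < γ₀) :
    ∃ C : ℝ, 0 < C ∧
      ∀ τ : ℝ, ∀ k : ℤ, |(k : ℝ) / L| ≤ K →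
        ∀ w W H : SchwartzMap ℝ ℂ, ResolventEq L γ₀ τ k (⇑w) (⇑W) (⇑H) →
          HsSq s (⇑w) ≤ C * HsSq (s + 1) (⇑H) := by
  have h3 : 0 < Real.sqrt 3 := by positivity
  have hL0 : 0 < L := lt_trans (by positivity) hL
  choose c hc h using fun k : ℤ => mode_estimate hL0 hγ₀ hs k
  set n := ⌈K * L⌉ with hn
  refine ⟨1 + ∑ k ∈ Finset.Icc (-n) n, c k, ?_, fun τ k hk w W H hr => ?_⟩
  · have := Finset.sum_nonneg (s := Finset.Icc (-n) n) fun k _ => hc k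
    linarith
  · have hkn : k ∈ Finset.Icc (-n) n := by
      rw [abs_div, abs_of_pos hL0, div_le_iff₀ hL0] at hk
      have h4 : |(k : ℝ)| ≤ n := hk.trans (Int.le_ceil _)
      rw [Finset.mem_Icc, ← abs_le]
      exact_mod_cast h4
    have h5 := Finset.single_le_sum (fun k _ => hc k) hkn
    have h6 := HsSq_nonneg (s+1) H
    calc HsSq s w ≤ c k * HsSq (s+1) H := h k τ w W H hr
      _ ≤ _ := mul_le_mul_of_nonneg_right (by linarith) h6
end

section
/- Let L > 0, let s ≥ 1 be an integer, K > 0 and γ₀ > 0. Then there exist M > 0 and C > 0 such that for every τ ∈ ℝ with |τ| ≥ M, every k ∈ ℤ with |k/L| ≤ K, and all complex-valued Schwartz functions w, W, H on ℝ with W' = w, satisfying the resolvent equation (γ₀ + iτ) w − w' + (Q w)' + w''' + (k²/L²) W = H', one has ‖w‖_{H^s(ℝ)}² ≤ C ‖H‖_{H^{s+1}(ℝ)}². -/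
open MeasureTheory

namespace KPI

/-- `t(x) = tanh(x/2)`. -/
noncomputable def th (x : ℝ) : ℝ := Real.tanh (x / 2)

lemma th_abs (x : ℝ) : |th x| ≤ 1 := (Real.abs_tanh_lt_one _).le

lemma Q_eq (x : ℝ) : Q x = 3 * (1 - th x ^ 2) := by
  unfold Q th
  rw [Real.tanh_eq_sinh_div_cosh]
  have h := Real.cosh_pos (x / 2)
  have h2 := Real.cosh_sq (x / 2)
  field_simp
  linarith

lemma Q_nonneg (x : ℝ) : 0 ≤ Q x := by unfold Q; positivity

lemma Q_le (x : ℝ) : Q x ≤ 3 := by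
  rw [Q_eq]; nlinarith [sq_nonneg (th x)]

lemma th_hasDerivAt (x : ℝ) : HasDerivAt th (Q x / 6) x := by
  have hx : HasDerivAt (fun y : ℝ => y / 2) (1 / 2) x := (hasDerivAt_id x).div_const 2
  have h := (hx.sinh).div (hx.cosh) (Real.cosh_pos _).ne'
  have e : th = (fun y : ℝ => Real.sinh (y / 2)) / (fun y : ℝ => Real.cosh (y / 2)) := by
    funext y; simp [th, Real.tanh_eq_sinh_div_cosh]
  rw [e]
  refine h.congr_deriv ?_
  have h1 := Real.cosh_pos (x / 2)
  have h2 := Real.cosh_sq (x / 2)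
  unfold Q
  field_simp
  linarith

lemma Q_hasDerivAt (x : ℝ) : HasDerivAt Q (-(th x * Q x)) x := by
  have h := (((th_hasDerivAt x).pow 2).const_sub 1).const_mul 3
  have e : Q = fun y => 3 * (1 - (th ^ 2) y) := by
    funext y; rw [Q_eq]; rfl
  rw [e]
  refine h.congr_deriv ?_
  simp only [Pi.pow_apply]
  have := Q_eq x
  rw [← this]; norm_num; ring

lemma th_cont : Continuous th :=
  continuous_iff_continuousAt.2 fun x => (th_hasDerivAt x).continuousAt

lemma Q_cont : Continuous Q :=
  continuous_iff_continuousAt.2 fun x => (Q_hasDerivAt x).continuousAt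

/-- continuous with quadratic decay -/
def Dc (f : ℝ → ℝ) : Prop := Continuous f ∧ ∃ C, ∀ x, |f x| * (1 + x ^ 2) ≤ C

/-- continuous and bounded -/
def Bd (f : ℝ → ℝ) : Prop := Continuous f ∧ ∃ C, ∀ x, |f x| ≤ C

lemma Dc.bd {f : ℝ → ℝ} (h : Dc f) : Bd f := by
  obtain ⟨hc, C, hC⟩ := h
  refine ⟨hc, C, fun x => le_trans ?_ (hC x)⟩
  nlinarith [abs_nonneg (f x), sq_nonneg x, mul_nonneg (abs_nonneg (f x)) (sq_nonneg x)]

lemma Dc.bmul {f g : ℝ → ℝ} (hf : Bd f) (hg : Dc g) : Dc (fun x => f x * g x) := by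
  obtain ⟨fc, C, hC⟩ := hf
  obtain ⟨gc, D, hD⟩ := hg
  refine ⟨fc.mul gc, C * D, fun x => ?_⟩
  rw [abs_mul, mul_assoc]
  exact mul_le_mul (hC x) (hD x) (by positivity) ((abs_nonneg _).trans (hC x))

lemma Dc.mul {f g : ℝ → ℝ} (hf : Dc f) (hg : Dc g) : Dc (fun x => f x * g x) :=
  Dc.bmul hf.bd hg

lemma Dc.add {f g : ℝ → ℝ} (hf : Dc f) (hg : Dc g) : Dc (fun x => f x + g x) := by
  obtain ⟨fc, C, hC⟩ := hf
  obtain ⟨gc, D, hD⟩ := hg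
  refine ⟨fc.add gc, C + D, fun x => ?_⟩
  have := abs_add_le (f x) (g x)
  nlinarith [hC x, hD x, sq_nonneg x]

lemma Bd.const (c : ℝ) : Bd (fun _ => c) := ⟨continuous_const, |c|, fun _ => le_rfl⟩

lemma Dc.cmul {f : ℝ → ℝ} (c : ℝ) (hf : Dc f) : Dc (fun x => c * f x) :=
  Dc.bmul (Bd.const c) hf

lemma Dc.integrable {f : ℝ → ℝ} (h : Dc f) : Integrable f := by
  obtain ⟨hc, C, hC⟩ := h
  refine (integrable_inv_one_add_sq.const_mul C).mono' hc.aestronglyMeasurable ?_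
  refine Filter.Eventually.of_forall fun x => ?_
  rw [Real.norm_eq_abs, ← div_eq_mul_inv, le_div_iff₀ (by positivity)]
  exact hC x

/-- decaying with decaying derivative -/
structure DD (f f' : ℝ → ℝ) : Prop where
  der : ∀ x, HasDerivAt f (f' x) x
  d0 : Dc f
  d1 : Dc f'

structure BB (f f' : ℝ → ℝ) : Prop where
  der : ∀ x, HasDerivAt f (f' x) x
  b0 : Bd f
  b1 : Bd f'

lemma DD.add {f f' g g' : ℝ → ℝ} (hf : DD f f') (hg : DD g g') :
    DD (fun x => f x + g x) (fun x => f' x + g' x) :=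
  ⟨fun x => (hf.der x).add (hg.der x), hf.d0.add hg.d0, hf.d1.add hg.d1⟩

lemma DD.cmul {f f' : ℝ → ℝ} (c : ℝ) (hf : DD f f') :
    DD (fun x => c * f x) (fun x => c * f' x) :=
  ⟨fun x => (hf.der x).const_mul c, hf.d0.cmul c, hf.d1.cmul c⟩

lemma DD.mul {f f' g g' : ℝ → ℝ} (hf : DD f f') (hg : DD g g') :
    DD (fun x => f x * g x) (fun x => f' x * g x + f x * g' x) :=
  ⟨fun x => (hf.der x).mul (hg.der x), hf.d0.mul hg.d0, (hf.d1.mul hg.d0).add (hf.d0.mul hg.d1)⟩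

lemma DD.bmul {f f' g g' : ℝ → ℝ} (hf : BB f f') (hg : DD g g') :
    DD (fun x => f x * g x) (fun x => f' x * g x + f x * g' x) :=
  ⟨fun x => (hf.der x).mul (hg.der x), Dc.bmul hf.b0 hg.d0,
    (Dc.bmul hf.b1 hg.d0).add (Dc.bmul hf.b0 hg.d1)⟩

lemma Bd_th : Bd th := ⟨th_cont, 1, th_abs⟩
lemma Bd_Q : Bd Q := ⟨Q_cont, 3, fun x => by rw [abs_of_nonneg (Q_nonneg x)]; exact Q_le x⟩

lemma BB_th : BB th (fun x => Q x / 6) := by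
  refine ⟨th_hasDerivAt, Bd_th, Q_cont.div_const 6, 3, fun x => ?_⟩
  rw [abs_of_nonneg (by have := Q_nonneg x; positivity)]
  linarith [Q_nonneg x, Q_le x]

lemma BB_Q : BB Q (fun x => -(th x * Q x)) := by
  refine ⟨Q_hasDerivAt, Bd_Q, (th_cont.mul Q_cont).neg, 3, fun x => ?_⟩
  rw [abs_neg, abs_mul, abs_of_nonneg (Q_nonneg x)]
  nlinarith [Q_nonneg x, Q_le x, th_abs x]

/-- integrate a pointwise inequality modulo a total derivative -/
lemma int_le {F F' P R : ℝ → ℝ} (hF : DD F F') (hP : Integrable P) (hR : Integrable R)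
    (h : ∀ x, P x ≤ R x + F' x) : ∫ x, P x ≤ ∫ x, R x := by
  have h0 : ∫ x, F' x = 0 :=
    integral_eq_zero_of_hasDerivAt_of_integrable hF.der hF.d1.integrable hF.d0.integrable
  calc ∫ x, P x ≤ ∫ x, (R x + F' x) := integral_mono hP (hR.add hF.d1.integrable) h
    _ = ∫ x, R x := by rw [integral_add hR hF.d1.integrable, h0, add_zero]

/-- weighted Young inequality -/
lemma young {c B ε : ℝ} (hc : |c| ≤ B) (hε : 0 < ε) (a₁ a₂ b₁ b₂ : ℝ) :
    c * (a₁ * b₁ + a₂ * b₂) ≤ B * (ε / 2 * (a₁ ^ 2 + a₂ ^ 2) + 1 / (2 * ε) * (b₁ ^ 2 + b₂ ^ 2)) := by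
  have key : ∀ a b : ℝ, |a * b| ≤ ε / 2 * a ^ 2 + 1 / (2 * ε) * b ^ 2 := by
    intro a b
    rw [abs_mul]
    have : ε / 2 * a ^ 2 + 1 / (2 * ε) * b ^ 2 - |a| * |b| = (ε * |a| - |b|) ^ 2 / (2 * ε) := by
      rw [← sq_abs a, ← sq_abs b]
      field_simp
      ring
    have h2 : 0 ≤ (ε * |a| - |b|) ^ 2 / (2 * ε) := by positivity
    linarith
  have hB : 0 ≤ B := (abs_nonneg c).trans hc
  calc c * (a₁ * b₁ + a₂ * b₂) ≤ |c * (a₁ * b₁ + a₂ * b₂)| := le_abs_self _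
    _ = |c| * |a₁ * b₁ + a₂ * b₂| := abs_mul _ _
    _ ≤ B * |a₁ * b₁ + a₂ * b₂| := by gcongr
    _ ≤ B * (ε / 2 * (a₁ ^ 2 + a₂ ^ 2) + 1 / (2 * ε) * (b₁ ^ 2 + b₂ ^ 2)) := by
        gcongr
        have := abs_add_le (a₁ * b₁) (a₂ * b₂)
        linarith [key a₁ b₁, key a₂ b₂]

/-- a decaying function with all its derivatives -/
def Sq (u : ℕ → ℝ → ℝ) : Prop := ∀ n, DD (u n) (u (n + 1))

/-- The real form of the resolvent system; `u n + i v n` is the `n`-th derivative of `W`. -/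
structure Sys (γ τ κ : ℝ) (u v a b : ℕ → ℝ → ℝ) : Prop where
  su : Sq u
  sv : Sq v
  sa : Sq a
  sb : Sq b
  eu : ∀ x, γ * u 1 x - τ * v 1 x - u 2 x + (-(th x * Q x) * u 1 x + Q x * u 2 x) + u 4 x
    + κ * u 0 x = a 1 x
  ev : ∀ x, γ * v 1 x + τ * u 1 x - v 2 x + (-(th x * Q x) * v 1 x + Q x * v 2 x) + v 4 x
    + κ * v 0 x = b 1 x

/-- squared L² norm of the pair -/
noncomputable def J (u v : ℕ → ℝ → ℝ) (n : ℕ) : ℝ := ∫ x, (u n x ^ 2 + v n x ^ 2)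

lemma Sq.dc {u : ℕ → ℝ → ℝ} (h : Sq u) (n : ℕ) : Dc (u n) := (h n).d0

lemma sq_dc {u v : ℕ → ℝ → ℝ} (hu : Sq u) (hv : Sq v) (n : ℕ) :
    Dc (fun x => u n x ^ 2 + v n x ^ 2) := by
  have := ((hu.dc n).mul (hu.dc n)).add ((hv.dc n).mul (hv.dc n))
  simpa only [sq] using this

lemma J_nonneg (u v : ℕ → ℝ → ℝ) (n : ℕ) : 0 ≤ J u v n :=
  integral_nonneg fun x => by positivity

/-! ### Leibniz expansion -/

open Polynomial in
noncomputable def dpol (p : ℝ[X]) : ℝ[X] := -X * p + derivative p * (C (1 / 2) * (1 - X ^ 2))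

open Polynomial in
noncomputable def pol : ℕ → ℕ → ℝ[X]
  | 0, 0 => 1
  | 0, _ + 1 => 0
  | n + 1, 0 => dpol (pol n 0)
  | n + 1, m + 1 => dpol (pol n (m + 1)) + pol n m

lemma dpol_zero : dpol 0 = 0 := by simp [dpol]
lemma dpol_one : dpol 1 = -Polynomial.X := by simp [dpol]

lemma pol_gt (n : ℕ) : ∀ m, n < m → pol n m = 0 := by
  induction n with
  | zero => intro m hm; obtain ⟨m, rfl⟩ := Nat.exists_eq_succ_of_ne_zero hm.ne'; rfl
  | succ n ih =>
    intro m hm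
    obtain ⟨m, rfl⟩ := Nat.exists_eq_succ_of_ne_zero (by omega : m ≠ 0)
    simp only [pol]
    rw [ih m (by omega), ih (m + 1) (by omega), dpol_zero, add_zero]

lemma pol_self (n : ℕ) : pol n n = 1 := by
  induction n with
  | zero => rfl
  | succ n ih => simp only [pol]; rw [pol_gt n (n + 1) (by omega), ih, dpol_zero, zero_add]

lemma pol_hasDerivAt (p : Polynomial ℝ) (x : ℝ) :
    HasDerivAt (fun y => Q y * p.eval (th y)) (Q x * (dpol p).eval (th x)) x := by
  have h := (Q_hasDerivAt x).mul ((p.hasDerivAt (th x)).comp x (th_hasDerivAt x))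
  refine h.congr_deriv ?_
  simp only [dpol, Polynomial.eval_add, Polynomial.eval_mul, Polynomial.eval_neg, Polynomial.eval_X,
    Polynomial.eval_C, Polynomial.eval_sub, Polynomial.eval_one, Polynomial.eval_pow,
    Function.comp]
  have := Q_eq x
  rw [show Q x / 6 = 1 / 2 * (1 - th x ^ 2) by rw [this]; ring]
  ring

lemma leibniz {u G : ℕ → ℝ → ℝ} (hu : ∀ n x, HasDerivAt (u n) (u (n + 1) x) x)
    (hG : ∀ n x, HasDerivAt (G n) (G (n + 1) x) x) (h0 : ∀ x, G 0 x = Q x * u 0 x) (n : ℕ) :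
    ∀ x, G n x = ∑ m ∈ Finset.range (n + 1), Q x * (pol n m).eval (th x) * u m x := by
  induction n with
  | zero => intro x; simp [pol, h0]
  | succ n ih =>
    intro x
    have e : G n = fun x => ∑ m ∈ Finset.range (n + 1), Q x * (pol n m).eval (th x) * u m x :=
      funext ih
    have h1 := hG n x
    rw [e] at h1
    have h2 : HasDerivAt (fun x => ∑ m ∈ Finset.range (n + 1), Q x * (pol n m).eval (th x) * u m x)
        (∑ m ∈ Finset.range (n + 1), (Q x * (dpol (pol n m)).eval (th x) * u m x
          + Q x * (pol n m).eval (th x) * u (m + 1) x)) x :=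
      HasDerivAt.fun_sum fun m _ => (pol_hasDerivAt (pol n m) x).mul (hu m x)
    rw [h1.unique h2, Finset.sum_add_distrib, Finset.sum_range_succ' _ (n + 1)]
    simp only [pol, Polynomial.eval_add, mul_add, add_mul, Finset.sum_add_distrib]
    have h3 : ∑ m ∈ Finset.range (n + 1 + 1), Q x * (dpol (pol n m)).eval (th x) * u m x
        = ∑ m ∈ Finset.range (n + 1), Q x * (dpol (pol n m)).eval (th x) * u m x := by
      rw [Finset.sum_range_succ, pol_gt n (n + 1) (by omega), dpol_zero]; simp
    rw [← h3, Finset.sum_range_succ' _ (n + 1)]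
    ring

lemma pol_bound (p : Polynomial ℝ) : ∃ C, ∀ x, (p.eval (th x)) ^ 2 ≤ C := by
  obtain ⟨C, hC⟩ := (isCompact_Icc (a := (-1 : ℝ)) (b := 1)).exists_bound_of_continuousOn
    (f := fun y => (p.eval y) ^ 2) (by fun_prop)
  refine ⟨C, fun x => (le_abs_self _).trans (hC (th x) (abs_le.1 (th_abs x)))⟩

lemma leib_bound (n : ℕ) : ∃ C, 0 ≤ C ∧ ∀ (u : ℕ → ℝ → ℝ) (x : ℝ),
    (∑ m ∈ Finset.range (n + 1), (pol (n + 1) m).eval (th x) * u (m + 1) x) ^ 2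
      ≤ C * ∑ m ∈ Finset.range (n + 1), u (m + 1) x ^ 2 := by
  choose c hc using fun m => pol_bound (pol (n + 1) m)
  refine ⟨∑ m ∈ Finset.range (n + 1), c m, Finset.sum_nonneg fun m _ =>
    (sq_nonneg _).trans (hc m 0), fun u x => ?_⟩
  refine (Finset.sum_mul_sq_le_sq_mul_sq _ _ _).trans ?_
  refine mul_le_mul_of_nonneg_right (Finset.sum_le_sum fun m _ => hc m x)
    (Finset.sum_nonneg fun m _ => sq_nonneg _)

/-- differentiated system -/
lemma level (n : ℕ) : ∃ C, 0 ≤ C ∧ ∀ {γ τ κ : ℝ} {u v a b : ℕ → ℝ → ℝ}, Sys γ τ κ u v a b →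
    ∃ y z : ℝ → ℝ, (∀ x, γ * u (n + 1) x - τ * v (n + 1) x - u (n + 2) x + Q x * u (n + 2) x
        + Q x * y x + u (n + 4) x + κ * u n x = a (n + 1) x) ∧
      (∀ x, γ * v (n + 1) x + τ * u (n + 1) x - v (n + 2) x + Q x * v (n + 2) x
        + Q x * z x + v (n + 4) x + κ * v n x = b (n + 1) x) ∧
      ∀ x, y x ^ 2 + z x ^ 2 ≤
        C * ∑ m ∈ Finset.range (n + 1), (u (m + 1) x ^ 2 + v (m + 1) x ^ 2) := by
  obtain ⟨C, hC0, hC⟩ := leib_bound n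
  have aux : ∀ {γ τ κ : ℝ} {u v a : ℕ → ℝ → ℝ}, Sq u → Sq v → Sq a →
      (∀ x, γ * u 1 x - τ * v 1 x - u 2 x + (-(th x * Q x) * u 1 x + Q x * u 2 x) + u 4 x
        + κ * u 0 x = a 1 x) → ∀ x, γ * u (n + 1) x - τ * v (n + 1) x - u (n + 2) x
        + Q x * u (n + 2) x
        + Q x * (∑ m ∈ Finset.range (n + 1), (pol (n + 1) m).eval (th x) * u (m + 1) x)
        + u (n + 4) x + κ * u n x = a (n + 1) x := by
    intro γ τ κ u v a su sv sa he x
    let G : ℕ → ℝ → ℝ := fun n => match n with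
      | 0 => fun x => Q x * u 1 x
      | n + 1 => fun x => a (n + 1) x - γ * u (n + 1) x + τ * v (n + 1) x + u (n + 2) x
          - u (n + 4) x - κ * u n x
    have hG : ∀ n x, HasDerivAt (G n) (G (n + 1) x) x := by
      intro n x
      cases n with
      | zero =>
        refine ((Q_hasDerivAt x).mul ((su 1).der x)).congr_deriv ?_
        simp only [G]
        linarith [he x]
      | succ n =>
        exact ((((((sa (n + 1)).der x).sub (((su (n + 1)).der x).const_mul γ)).add
          (((sv (n + 1)).der x).const_mul τ)).add ((su (n + 2)).der x)).sub
          ((su (n + 4)).der x)).sub (((su n).der x).const_mul κ)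
    have h := leibniz (u := fun n => u (n + 1)) (fun n x => (su (n + 1)).der x) hG
      (fun x => rfl) (n + 1) x
    rw [Finset.sum_range_succ, pol_self] at h
    simp only [mul_assoc, ← Finset.mul_sum, G] at h
    simp only [Polynomial.eval_one, one_mul] at h
    linarith
  refine ⟨C, hC0, fun {γ τ κ u v a b} h => ⟨_,
    fun x => ∑ m ∈ Finset.range (n + 1), (pol (n + 1) m).eval (th x) * v (m + 1) x,
    aux h.su h.sv h.sa h.eu, ?_, fun x => ?_⟩⟩
  · have := aux (γ := γ) (τ := -τ) (κ := κ) h.sv h.su h.sb (fun x => by linarith [h.ev x])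
    intro x
    linarith [this x]
  · rw [Finset.sum_add_distrib, mul_add]
    exact add_le_add (hC u x) (hC v x)

lemma DD.congr {f f' g : ℝ → ℝ} (h : DD f f') (e : ∀ x, f' x = g x) : DD f g := by
  have : f' = g := funext e
  rwa [this] at h

lemma int_le4 {F F' p f₁ f₂ f₃ f₄ : ℝ → ℝ} {c c₁ c₂ c₃ c₄ : ℝ} (hF : DD F F') (hp : Dc p)
    (h₁ : Dc f₁) (h₂ : Dc f₂) (h₃ : Dc f₃) (h₄ : Dc f₄)
    (h : ∀ x, c * p x ≤ c₁ * f₁ x + c₂ * f₂ x + c₃ * f₃ x + c₄ * f₄ x + F' x) :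
    c * ∫ x, p x ≤ c₁ * (∫ x, f₁ x) + c₂ * (∫ x, f₂ x) + c₃ * (∫ x, f₃ x) + c₄ * ∫ x, f₄ x := by
  have := int_le hF (hp.cmul c).integrable
    ((((h₁.cmul c₁).add (h₂.cmul c₂)).add (h₃.cmul c₃)).add (h₄.cmul c₄)).integrable h
  rw [integral_add (((h₁.cmul c₁).add (h₂.cmul c₂)).add (h₃.cmul c₃)).integrable
    (h₄.cmul c₄).integrable, integral_add ((h₁.cmul c₁).add (h₂.cmul c₂)).integrable
    (h₃.cmul c₃).integrable, integral_add (h₁.cmul c₁).integrable (h₂.cmul c₂).integrable] at this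
  simpa only [integral_const_mul] using this

lemma Dc.sum {f : ℕ → ℝ → ℝ} (h : ∀ n, Dc (f n)) (n : ℕ) :
    Dc (fun x => ∑ m ∈ Finset.range n, f m x) := by
  induction n with
  | zero => simpa using (Dc.cmul 0 (h 0))
  | succ n ih =>
    simp only [Finset.sum_range_succ]
    exact ih.add (h n)

lemma step_alg {γ A B c₁ c₂ c₃ : ℝ} (hγ : 0 < γ) (hA : 0 < A) (hB : 0 ≤ B) (h₁ : 0 < c₁)
    (h₂ : 0 ≤ c₂) (h₃ : 0 ≤ c₃) :
    ∃ C ε, 0 < C ∧ 0 < ε ∧ ∀ X q q' S h : ℝ, 0 ≤ X → 0 ≤ S → 0 ≤ h →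
      γ / 2 * X ≤ c₁ * q + c₂ * S + c₃ * h → 1 / 8 * q' ≤ A * X + B * S + 1 / 2 * h →
      1 / 2 * q ≤ (3 / 2 + 3 / (2 * ε)) * S + ε / 2 * q' → X ≤ C * (S + h) := by
  have hε : 0 < γ / (32 * A * c₁) := by positivity
  obtain ⟨ε, hεd⟩ : ∃ ε, ε = γ / (32 * A * c₁) := ⟨_, rfl⟩
  rw [← hεd] at hε
  have key : c₁ * ε * (8 * A) = γ / 4 := by rw [hεd]; field_simp; norm_num
  obtain ⟨D, hD⟩ : ∃ D, D = c₁ * (3 + 3 / ε + ε * (8 * B) + 4 * ε) + c₂ + c₃ := ⟨_, rfl⟩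
  have hDp : 0 < D := by rw [hD]; positivity
  refine ⟨4 / γ * D, ε, by positivity, hε, fun X q q' S h hX hS hh e1 e2 e3 => ?_⟩
  have e2' : ε * q' ≤ ε * (8 * A * X + 8 * B * S + 4 * h) :=
    mul_le_mul_of_nonneg_left (by linarith) hε.le
  have e4 : q ≤ (3 + 3 / ε) * S + ε * (8 * A * X + 8 * B * S + 4 * h) := by
    have : 3 / (2 * ε) = (3 / ε) / 2 := by field_simp
    rw [this] at e3
    nlinarith
  have e5 := mul_le_mul_of_nonneg_left e4 h₁.le
  have e6 : γ / 4 * X ≤ D * (S + h) := by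
    have hx : c₁ * (ε * (8 * A * X)) = γ / 4 * X := by rw [← key]; ring
    have p1 : 0 ≤ c₁ * (3 + 3 / ε + ε * (8 * B)) * h := by positivity
    have p2 : 0 ≤ c₁ * (4 * ε) * S := by positivity
    have p3 : 0 ≤ c₂ * h := by positivity
    have p4 : 0 ≤ c₃ * S := by positivity
    rw [hD]
    nlinarith
  have : X = 4 / γ * (γ / 4 * X) := by field_simp
  rw [this, mul_assoc]
  exact mul_le_mul_of_nonneg_left e6 (by positivity)

lemma step (γ K2 : ℝ) (hγ : 0 < γ) (hK : 0 ≤ K2) (n : ℕ) (hn : 1 ≤ n) :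
    ∃ C, 0 < C ∧ ∀ {τ κ : ℝ} {u v a b : ℕ → ℝ → ℝ}, Sys γ τ κ u v a b → 0 ≤ κ → κ ≤ K2 →
      J u v (n + 1) ≤ C * (∑ m ∈ Finset.range n, J u v (m + 1) + J a b (n + 1)) := by
  obtain ⟨c0, hc0, hlev⟩ := level n
  obtain ⟨C, ε, hC, hε, halg⟩ := step_alg (γ := γ) (A := γ + 8 + 3 / 2 * c0 + K2 / 2)
    (B := 3 / 2 * c0 + K2 / 2) (c₁ := 1 + c0 / 2) (c₂ := 3 / 2 * c0) (c₃ := 1 / (2 * γ)) hγ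
    (by positivity) (by positivity) (by positivity) (by positivity) (by positivity)
  refine ⟨C, hC, fun {τ κ u v a b} h hκ hκK => ?_⟩
  obtain ⟨y, z, ey, ez, hyz⟩ := hlev h
  have D := fun i j => ((h.su i).mul (h.su j)).add ((h.sv i).mul (h.sv j))
  have zD := fun i => sq_dc h.su h.sv i
  have hσD : Dc (fun x => ∑ m ∈ Finset.range n, (u (m + 1) x ^ 2 + v (m + 1) x ^ 2)) :=
    Dc.sum (fun m => zD (m + 1)) n
  have hσ : ∀ x, u n x ^ 2 + v n x ^ 2 ≤
      ∑ m ∈ Finset.range n, (u (m + 1) x ^ 2 + v (m + 1) x ^ 2) := by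
    intro x
    have := Finset.single_le_sum (f := fun m => u (m + 1) x ^ 2 + v (m + 1) x ^ 2)
      (s := Finset.range n) (fun m _ => by positivity) (Finset.mem_range.2 (by omega : n - 1 < n))
    simpa only [Nat.sub_add_cancel hn] using this
  have hS : ∫ x, ∑ m ∈ Finset.range n, (u (m + 1) x ^ 2 + v (m + 1) x ^ 2)
      = ∑ m ∈ Finset.range n, J u v (m + 1) :=
    integral_finsetSum _ fun m _ => (zD (m + 1)).integrable
  have hy : ∀ x, y x ^ 2 + z x ^ 2 ≤ c0 * (∑ m ∈ Finset.range n, (u (m + 1) x ^ 2 + v (m + 1) x ^ 2)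
      + (u (n + 1) x ^ 2 + v (n + 1) x ^ 2)) := by
    intro x
    have := hyz x
    rwa [Finset.sum_range_succ] at this
  have hQabs : ∀ x, |Q x| ≤ Q x := fun x => (abs_of_nonneg (Q_nonneg x)).le
  have htQ : ∀ x, |th x * Q x| ≤ Q x := by
    intro x
    rw [abs_mul, abs_of_nonneg (Q_nonneg x)]
    nlinarith [Q_nonneg x, th_abs x]
  refine halg (J u v (n + 1)) (∫ x, Q x * (u (n + 1) x ^ 2 + v (n + 1) x ^ 2))
    (∫ x, Q x * (u (n + 2) x ^ 2 + v (n + 2) x ^ 2)) _ (J a b (n + 1)) (J_nonneg _ _ _)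
    (Finset.sum_nonneg fun m _ => J_nonneg _ _ _) (J_nonneg _ _ _) ?_ ?_ ?_
  · -- energy estimate
    rw [← hS]
    have hF := ((((D (n + 1) (n + 1)).cmul (1 / 2)).add
      ((DD.bmul BB_Q (D (n + 1) (n + 1))).cmul (-1 / 2))).add ((D (n + 3) (n + 1)).cmul (-1))).add
      (((D (n + 2) (n + 2)).cmul (1 / 2)).add ((D n n).cmul (-κ / 2)))
    have := int_le4 (c := γ / 2) (c₁ := 1 + c0 / 2) (c₂ := 3 / 2 * c0) (c₃ := 1 / (2 * γ)) (c₄ := 0)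
      hF (zD (n + 1)) (Dc.bmul Bd_Q (zD (n + 1))) hσD (sq_dc h.sa h.sb (n + 1)) (zD 0) ?_
    · simpa [J] using this
    intro x
    have hq := Q_nonneg x
    have hq3 := Q_le x
    have y1 := young (c := Q x) (B := Q x) (hQabs x) one_pos (-y x) (-z x) (u (n + 1) x) (v (n + 1) x)
    have y2 := young (c := 1) (B := 1) (by simp) (one_div_pos.2 hγ) (a (n + 1) x) (b (n + 1) x)
      (u (n + 1) x) (v (n + 1) x)
    have y3 : -(th x * Q x) * (u (n + 1) x ^ 2 + v (n + 1) x ^ 2)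
        ≤ Q x * (u (n + 1) x ^ 2 + v (n + 1) x ^ 2) :=
      mul_le_mul_of_nonneg_right (by have := abs_le.1 (htQ x); linarith) (by positivity)
    have y4 := mul_le_mul_of_nonneg_left (hy x) hq
    obtain ⟨σ, hσe⟩ : ∃ σ, σ = ∑ m ∈ Finset.range n, (u (m + 1) x ^ 2 + v (m + 1) x ^ 2) := ⟨_, rfl⟩
    simp only [← hσe] at y4 ⊢
    have hσ0 : 0 ≤ σ := by rw [hσe]; positivity
    have y5 : Q x * (c0 * σ) ≤ 3 * (c0 * σ) := mul_le_mul_of_nonneg_right hq3 (by positivity)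
    have e1 := ey x
    have e2 := ez x
    have g1 : 1 / γ / 2 = 1 / (2 * γ) := by field_simp
    have g2 : 1 / (2 * (1 / γ)) = γ / 2 := by field_simp
    rw [g1, g2] at y2
    have m1 : u (n + 1) x * (γ * u (n + 1) x - τ * v (n + 1) x - u (n + 2) x + Q x * u (n + 2) x
        + Q x * y x + u (n + 4) x + κ * u n x) = u (n + 1) x * a (n + 1) x := by rw [e1]
    have m2 : v (n + 1) x * (γ * v (n + 1) x + τ * u (n + 1) x - v (n + 2) x + Q x * v (n + 2) x
        + Q x * z x + v (n + 4) x + κ * v n x) = v (n + 1) x * b (n + 1) x := by rw [e2]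
    simp only [show n + 3 + 1 = n + 4 from rfl, show n + 2 + 1 = n + 3 from rfl,
      show n + 1 + 1 = n + 2 from rfl]
    linarith
  · -- virial estimate
    rw [← hS]
    have hF := ((((DD.bmul BB_th (D (n + 3) (n + 1))).cmul (-1)).add
      ((DD.bmul BB_th (D (n + 2) (n + 2))).cmul (1 / 2))).add
      ((DD.bmul BB_Q (D (n + 2) (n + 1))).cmul (1 / 6))).add
      ((DD.bmul BB_th (D (n + 1) (n + 1))).cmul (1 / 2))
    have := int_le4 (c := 1 / 8) (c₁ := γ + 8 + 3 / 2 * c0 + K2 / 2) (c₂ := 3 / 2 * c0 + K2 / 2)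
      (c₃ := 1 / 2) (c₄ := 0)
      hF (Dc.bmul Bd_Q (zD (n + 2))) (zD (n + 1)) hσD (sq_dc h.sa h.sb (n + 1)) (zD 0) ?_
    · simpa [J] using this
    intro x
    have hq := Q_nonneg x
    have hq3 := Q_le x
    have y0 := hσ x
    have y1 := young (c := th x * Q x) (B := Q x) (htQ x) one_pos (-y x) (-z x)
      (u (n + 1) x) (v (n + 1) x)
    have y2 := young (c := th x) (B := 1) (th_abs x) one_pos (a (n + 1) x) (b (n + 1) x)
      (u (n + 1) x) (v (n + 1) x)
    have y3 : -th x * (γ * (u (n + 1) x ^ 2 + v (n + 1) x ^ 2))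
        ≤ 1 * (γ * (u (n + 1) x ^ 2 + v (n + 1) x ^ 2)) :=
      mul_le_mul_of_nonneg_right (by have := abs_le.1 (th_abs x); linarith) (by positivity)
    have y4 := mul_le_mul_of_nonneg_left (hy x) hq
    have y6 := young (c := -(5 / 6) * (th x * Q x)) (B := Q x) (by
      rw [abs_mul, abs_neg, abs_of_nonneg (by norm_num : (0:ℝ) ≤ 5 / 6)]; linarith [htQ x])
      (by norm_num : (0:ℝ) < 1 / 4) (u (n + 2) x) (v (n + 2) x) (u (n + 1) x) (v (n + 1) x)
    have y7 := young (c := -(κ * th x)) (B := K2) (by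
      rw [abs_neg, abs_mul, abs_of_nonneg hκ]
      nlinarith [th_abs x, abs_nonneg (th x)]) one_pos
      (u n x) (v n x) (u (n + 1) x) (v (n + 1) x)
    obtain ⟨σ, hσe⟩ : ∃ σ, σ = ∑ m ∈ Finset.range n, (u (m + 1) x ^ 2 + v (m + 1) x ^ 2) := ⟨_, rfl⟩
    simp only [← hσe] at y4 y0 ⊢
    have hσ0 : 0 ≤ σ := by rw [hσe]; positivity
    have y5 : Q x * (c0 * (σ + (u (n + 1) x ^ 2 + v (n + 1) x ^ 2)))
        ≤ 3 * (c0 * (σ + (u (n + 1) x ^ 2 + v (n + 1) x ^ 2))) :=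
      mul_le_mul_of_nonneg_right hq3 (by positivity)
    have y8 : Q x * (u (n + 1) x ^ 2 + v (n + 1) x ^ 2) ≤ 3 * (u (n + 1) x ^ 2 + v (n + 1) x ^ 2) :=
      mul_le_mul_of_nonneg_right hq3 (by positivity)
    have y8' : 0 ≤ Q x * (u (n + 1) x ^ 2 + v (n + 1) x ^ 2) := by positivity
    have y9 := mul_le_mul_of_nonneg_left y0 hK
    have e1 := ey x
    have e2 := ez x
    have m1 : th x * u (n + 1) x * (γ * u (n + 1) x - τ * v (n + 1) x - u (n + 2) x
        + Q x * u (n + 2) x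
        + Q x * y x + u (n + 4) x + κ * u n x) = th x * u (n + 1) x * a (n + 1) x := by rw [e1]
    have m2 : th x * v (n + 1) x * (γ * v (n + 1) x + τ * u (n + 1) x - v (n + 2) x
        + Q x * v (n + 2) x
        + Q x * z x + v (n + 4) x + κ * v n x) = th x * v (n + 1) x * b (n + 1) x := by rw [e2]
    simp only [show n + 3 + 1 = n + 4 from rfl, show n + 2 + 1 = n + 3 from rfl,
      show n + 1 + 1 = n + 2 from rfl]
    linarith
  · -- interpolation
    rw [← hS]
    have hF := DD.bmul BB_Q (D n (n + 1))
    have := int_le4 (c := 1 / 2) (c₁ := 3 / 2 + 3 / (2 * ε)) (c₂ := ε / 2) (c₃ := 0) (c₄ := 0)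
      hF (Dc.bmul Bd_Q (zD (n + 1))) hσD (Dc.bmul Bd_Q (zD (n + 2))) (zD 0) (zD 0) ?_
    · simpa using this
    intro x
    have hq := Q_nonneg x
    have hq3 := Q_le x
    have y0 := hσ x
    have y1 := young (c := th x * Q x) (B := Q x) (htQ x) one_pos (u n x) (v n x)
      (u (n + 1) x) (v (n + 1) x)
    have y2 := young (c := Q x) (B := Q x) (hQabs x) hε (u (n + 2) x) (v (n + 2) x) (-u n x) (-v n x)
    have y3 : Q x * ((1 / 2 + 1 / (2 * ε)) * (u n x ^ 2 + v n x ^ 2)) ≤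
        3 * ((1 / 2 + 1 / (2 * ε)) * (u n x ^ 2 + v n x ^ 2)) :=
      mul_le_mul_of_nonneg_right hq3 (by positivity)
    have y4 := mul_le_mul_of_nonneg_left y0 (by positivity : 0 ≤ 3 * (1 / 2 + 1 / (2 * ε)))
    have g : 3 / (2 * ε) = 3 * (1 / (2 * ε)) := by ring
    rw [g]
    obtain ⟨σ, hσe⟩ : ∃ σ, σ = ∑ m ∈ Finset.range n, (u (m + 1) x ^ 2 + v (m + 1) x ^ 2) := ⟨_, rfl⟩
    simp only [← hσe] at y0 y4 ⊢
    simp only [show n + 1 + 1 = n + 2 from rfl]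
    generalize 1 / (2 * ε) = r at *
    linarith

lemma base_alg {γ d c C T E I0 I2 h : ℝ} (hγ : 0 < γ) (hd : 0 < d) (hc : 0 < c) (hC : 0 < C)
    (hT1 : 1 ≤ T) (hT : 8 * d * (6 + c) / γ ≤ T) (hE : 0 ≤ E) (hh : 0 ≤ h)
    (b1 : γ / 2 * E ≤ d * I0 + C * h)
    (b2 : T ^ 3 * I0 ≤ 1 / (2 * T) * I2 + (T / 2 + 2 + c / 2) * E + 1 / 2 * h)
    (b3 : I2 ≤ T ^ 4 / 2 * I0 + (T ^ 2 / 2 + 5) * E + 1 / 2 * h) :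
    E ≤ (1 + 4 * C / γ) * h := by
  have hT0 : 0 < T := by linarith
  have b3' := mul_le_mul_of_nonneg_left b3 (by positivity : 0 ≤ 1 / (2 * T))
  have e1 : 1 / (2 * T) * (T ^ 4 / 2 * I0 + (T ^ 2 / 2 + 5) * E + 1 / 2 * h)
      = T ^ 3 / 4 * I0 + T / 4 * E + (1 / T) * (5 / 2 * E + h / 4) := by
    field_simp; ring
  have hTi : 1 / T ≤ 1 := by rw [div_le_one hT0]; exact hT1
  have e2 : (1 / T) * (5 / 2 * E + h / 4) ≤ 1 * (5 / 2 * E + h / 4) :=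
    mul_le_mul_of_nonneg_right hTi (by positivity)
  have e3 : 3 / 4 * (T ^ 3 * I0) ≤ (3 / 4 * T + 9 / 2 + c / 2) * E + 3 / 4 * h := by linarith
  have e4 : (3 / 4 * T + 9 / 2 + c / 2) * E + 3 / 4 * h ≤ 3 / 4 * (T * (2 * (6 + c) * (E + h))) := by
    have p1 : 0 ≤ (T - 1) * E := mul_nonneg (by linarith) hE
    have p2 : 0 ≤ (T - 1) * h := mul_nonneg (by linarith) hh
    have p3 : 0 ≤ c * ((T - 1) * E) := by positivity
    have p4 : 0 ≤ c * ((T - 1) * h) := by positivity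
    have p5 : 0 ≤ c * E := by positivity
    have p6 : 0 ≤ c * h := by positivity
    linarith
  have e5 : T * (T ^ 2 * I0) ≤ T * (2 * (6 + c) * (E + h)) := by
    have : T * (T ^ 2 * I0) = T ^ 3 * I0 := by ring
    linarith
  have e6 : T ^ 2 * I0 ≤ 2 * (6 + c) * (E + h) := le_of_mul_le_mul_left e5 hT0
  have e7 : 8 * d * (6 + c) ≤ γ * T ^ 2 := by
    rw [div_le_iff₀ hγ] at hT
    have h0 : 0 ≤ γ * (T * (T - 1)) := mul_nonneg hγ.le (mul_nonneg (by linarith) (by linarith))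
    linarith [show γ * (T * (T - 1)) = γ * T ^ 2 - T * γ by ring]
  have e8 := mul_le_mul_of_nonneg_left b1 (by positivity : 0 ≤ T ^ 2)
  have e9 := mul_le_mul_of_nonneg_left e6 hd.le
  have e10 := mul_le_mul_of_nonneg_right e7 (by positivity : 0 ≤ E + h)
  have e11 : T ^ 2 * (γ / 4 * E) ≤ T ^ 2 * (γ / 4 * h + C * h) := by linarith
  have e12 : γ / 4 * E ≤ γ / 4 * h + C * h := le_of_mul_le_mul_left e11 (by positivity)
  have e13 : (1 + 4 * C / γ) * h = 4 / γ * (γ / 4 * h + C * h) := by field_simp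
  rw [e13]
  calc E = 4 / γ * (γ / 4 * E) := by field_simp
    _ ≤ _ := mul_le_mul_of_nonneg_left e12 (by positivity)

lemma base (γ K2 : ℝ) (hγ : 0 < γ) (hK : 0 < K2) :
    ∃ M C, 0 < M ∧ 0 < C ∧ ∀ {τ κ : ℝ} {u v a b : ℕ → ℝ → ℝ}, Sys γ τ κ u v a b → 0 ≤ κ → κ ≤ K2 →
      M ≤ |τ| → J u v 1 + J u v 2 ≤ C * (J a b 0 + J a b 1 + J a b 2) := by
  obtain ⟨d, hd⟩ : ∃ d, d = 5 * γ / 2 + 1 := ⟨_, rfl⟩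
  obtain ⟨C, hC⟩ : ∃ C, C = 1 / (2 * γ) + 1 + K2 / (2 * γ) := ⟨_, rfl⟩
  obtain ⟨T0, hT0⟩ : ∃ T0, T0 = max 1 (8 * d * (6 + K2) / γ) := ⟨_, rfl⟩
  have hdp : 0 < d := by rw [hd]; positivity
  have hCp : 0 < C := by rw [hC]; positivity
  have hT01 : 1 ≤ T0 := by rw [hT0]; exact le_max_left _ _
  have hT02 : 8 * d * (6 + K2) / γ ≤ T0 := by rw [hT0]; exact le_max_right _ _
  refine ⟨T0 ^ 3, 1 + 4 * C / γ, by positivity, by positivity,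
    fun {τ κ u v a b} h hκ hκK hM => ?_⟩
  obtain ⟨T, hTn, hT3⟩ : ∃ T : ℝ, 0 ≤ T ∧ T ^ 3 = |τ| := by
    refine ⟨|τ| ^ ((1 : ℝ) / 3), by positivity, ?_⟩
    rw [← Real.rpow_natCast, ← Real.rpow_mul (abs_nonneg τ)]
    norm_num
  have hTT : T0 ≤ T := by
    rw [← hT3] at hM
    exact le_of_pow_le_pow_left₀ (by norm_num) hTn hM
  have hTpos : 0 < T := by linarith
  have D := fun i j => ((h.su i).mul (h.su j)).add ((h.sv i).mul (h.sv j))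
  have X := fun i j => ((h.sv i).mul (h.su j)).add (((h.su i).mul (h.sv j)).cmul (-1))
  have HD := fun i j => ((h.sa i).mul (h.su j)).add ((h.sb i).mul (h.sv j))
  have zD := fun i => sq_dc h.su h.sv i
  have hhD := ((sq_dc h.sa h.sb 0).add (sq_dc h.sa h.sb 1)).add (sq_dc h.sa h.sb 2)
  have eD := ((zD 1).add (zD 2)).add ((zD 0).cmul κ)
  have hE : ∫ x, (u 1 x ^ 2 + v 1 x ^ 2 + (u 2 x ^ 2 + v 2 x ^ 2) + κ * (u 0 x ^ 2 + v 0 x ^ 2))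
      = J u v 1 + J u v 2 + κ * J u v 0 := by
    rw [integral_add ((zD 1).add (zD 2)).integrable ((zD 0).cmul κ).integrable,
      integral_add (zD 1).integrable (zD 2).integrable, integral_const_mul]
    rfl
  have hH : ∫ x, (a 0 x ^ 2 + b 0 x ^ 2 + (a 1 x ^ 2 + b 1 x ^ 2) + (a 2 x ^ 2 + b 2 x ^ 2))
      = J a b 0 + J a b 1 + J a b 2 := by
    rw [integral_add ((sq_dc h.sa h.sb 0).add (sq_dc h.sa h.sb 1)).integrable
      (sq_dc h.sa h.sb 2).integrable,
      integral_add (sq_dc h.sa h.sb 0).integrable (sq_dc h.sa h.sb 1).integrable]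
    rfl
  have htQ : ∀ x, |th x * Q x| ≤ 3 := by
    intro x
    rw [abs_mul, abs_of_nonneg (Q_nonneg x)]
    nlinarith [Q_nonneg x, Q_le x, th_abs x]
  have hQ2 : ∀ x, |1 - Q x| ≤ 2 := fun x =>
    abs_le.2 ⟨by linarith [Q_le x], by linarith [Q_nonneg x]⟩
  have p0 := J_nonneg u v 0
  have p1 := J_nonneg u v 1
  have p2 := J_nonneg u v 2
  have hκJ : 0 ≤ κ * J u v 0 := by positivity
  suffices hmain : J u v 1 + J u v 2 + κ * J u v 0 ≤ (1 + 4 * C / γ) * (J a b 0 + J a b 1 + J a b 2) by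
    linarith
  have q0 := J_nonneg a b 0
  have q1 := J_nonneg a b 1
  have q2 := J_nonneg a b 2
  refine base_alg (T := T) (I0 := J u v 1) (I2 := J u v 3) hγ hdp hK hCp (by linarith) (by linarith)
    (by positivity) (by positivity) ?_ ?_ ?_
  · -- conserved-energy identity
    rw [← hE, ← hH]
    have Lr := (((h.su 0).cmul γ).add ((h.sv 0).cmul (-τ))).add ((h.sa 0).cmul (-1))
    have Li := (((h.sv 0).cmul γ).add ((h.su 0).cmul τ)).add ((h.sb 0).cmul (-1))
    have Zr := (((Lr.cmul (-1)).add (h.su 1)).add ((DD.bmul BB_Q (h.su 1)).cmul (-1))).add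
      ((h.su 3).cmul (-1))
    have Zi := (((Li.cmul (-1)).add (h.sv 1)).add ((DD.bmul BB_Q (h.sv 1)).cmul (-1))).add
      ((h.sv 3).cmul (-1))
    replace Zr := Zr.congr (g := fun x => κ * u 0 x) (fun x => by linarith [h.eu x])
    replace Zi := Zi.congr (g := fun x => κ * v 0 x) (fun x => by linarith [h.ev x])
    have hF := ((((Lr.mul Lr).add (Li.mul Li)).cmul (1 / 2)).add
      (((D 1 2).add (((h.su 0).mul Zr).add ((h.sv 0).mul Zi))).cmul γ)).add
      (((((X 1 2).add (((h.sv 0).mul Zr).add (((h.su 0).mul Zi).cmul (-1)))).cmul (-τ)).add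
      ((HD 1 2).cmul (-1))).add ((((h.sa 0).mul Zr).add ((h.sb 0).mul Zi)).cmul (-1)))
    have := int_le4 (c := γ / 2) (c₁ := d) (c₂ := C) (c₃ := 0) (c₄ := 0)
      hF eD (zD 1) hhD (zD 0) (zD 0) ?_
    · simpa [J] using this
    intro x
    have y1 := young (c := 1) (B := 1) (by simp) (one_div_pos.2 hγ) (a 2 x) (b 2 x) (u 2 x) (v 2 x)
    have y2 := young (c := 1 - Q x) (B := 2) (hQ2 x) one_pos (a 1 x) (b 1 x) (u 1 x) (v 1 x)
    have y3 := young (c := κ) (B := κ) (abs_of_nonneg hκ).le (one_div_pos.2 hγ) (a 0 x) (b 0 x)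
      (u 0 x) (v 0 x)
    have g1 : 1 / γ / 2 = 1 / (2 * γ) := by field_simp
    have g2 : 1 / (2 * (1 / γ)) = γ / 2 := by field_simp
    rw [g1, g2] at y1 y3
    have g3 : K2 / (2 * γ) = K2 * (1 / (2 * γ)) := by ring
    rw [g3] at hC
    have hr : 0 ≤ 1 / (2 * γ) := by positivity
    generalize 1 / (2 * γ) = r at *
    have y4 : κ * (r * (a 0 x ^ 2 + b 0 x ^ 2)) ≤ K2 * (r * (a 0 x ^ 2 + b 0 x ^ 2)) :=
      mul_le_mul_of_nonneg_right hκK (by positivity)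
    have y5 : 0 ≤ γ * ((3 - Q x) * (u 1 x ^ 2 + v 1 x ^ 2)) :=
      mul_nonneg hγ.le (mul_nonneg (by linarith [Q_le x]) (by positivity))
    have n1 : 0 ≤ r * (a 0 x ^ 2 + b 0 x ^ 2) := by positivity
    have n2 : 0 ≤ r * (a 1 x ^ 2 + b 1 x ^ 2) := by positivity
    have n3 : 0 ≤ K2 * (r * (a 1 x ^ 2 + b 1 x ^ 2)) := by positivity
    have n4 : 0 ≤ K2 * (r * (a 2 x ^ 2 + b 2 x ^ 2)) := by positivity
    have n5 : 0 ≤ a 0 x ^ 2 + b 0 x ^ 2 := by positivity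
    have n6 : 0 ≤ a 2 x ^ 2 + b 2 x ^ 2 := by positivity
    rw [hd, hC]
    simp only [Nat.reduceAdd]
    linarith
  · -- imaginary part
    rw [← hE, ← hH, hT3]
    obtain ⟨ς, hς, hςa⟩ : ∃ ς : ℝ, ς * τ = |τ| ∧ |ς| = 1 := by
      rcases le_total 0 τ with h0 | h0
      · exact ⟨1, by rw [abs_of_nonneg h0, one_mul], by simp⟩
      · exact ⟨-1, by rw [abs_of_nonpos h0]; ring, by simp⟩
    have hF := (X 3 1).cmul (-ς)
    have := int_le4 (c := |τ|) (c₁ := 1 / (2 * T)) (c₂ := T / 2 + 2 + K2 / 2) (c₃ := 1 / 2) (c₄ := 0)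
      hF (zD 1) (zD 3) eD hhD (zD 0) ?_
    · simpa [J] using this
    intro x
    have y1 := young (c := ς * (1 - Q x)) (B := 2) (by rw [abs_mul, hςa, one_mul]; exact hQ2 x)
      one_pos (v 2 x) (-u 2 x) (u 1 x) (v 1 x)
    have y2 := young (c := ς) (B := 1) hςa.le (one_div_pos.2 hTpos) (v 3 x) (-u 3 x) (u 2 x) (v 2 x)
    have y3 := young (c := -ς * κ) (B := κ) (by rw [abs_mul, abs_neg, hςa, one_mul, abs_of_nonneg hκ])
      one_pos (v 0 x) (-u 0 x) (u 1 x) (v 1 x)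
    have y4 := young (c := ς) (B := 1) hςa.le one_pos (b 1 x) (-a 1 x) (u 1 x) (v 1 x)
    have g1 : 1 / T / 2 = 1 / (2 * T) := by field_simp
    have g2 : 1 / (2 * (1 / T)) = T / 2 := by field_simp
    rw [g1, g2] at y2
    generalize 1 / (2 * T) = r at *
    have m1 : ς * v 1 x * (γ * u 1 x - τ * v 1 x - u 2 x + (-(th x * Q x) * u 1 x + Q x * u 2 x)
      + u 4 x + κ * u 0 x) = ς * v 1 x * a 1 x := by rw [h.eu x]
    have m2 : ς * u 1 x * (γ * v 1 x + τ * u 1 x - v 2 x + (-(th x * Q x) * v 1 x + Q x * v 2 x)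
      + v 4 x + κ * v 0 x) = ς * u 1 x * b 1 x := by rw [h.ev x]
    have n1 : 0 ≤ T * (u 1 x ^ 2 + v 1 x ^ 2) := by positivity
    have n2 : 0 ≤ T * (κ * (u 0 x ^ 2 + v 0 x ^ 2)) := by positivity
    have n3 : 0 ≤ κ * (u 0 x ^ 2 + v 0 x ^ 2) := by positivity
    have n4 : 0 ≤ K2 * (κ * (u 0 x ^ 2 + v 0 x ^ 2)) := by positivity
    have n5 : 0 ≤ K2 * (u 2 x ^ 2 + v 2 x ^ 2) := by positivity
    have n6 : κ * (u 1 x ^ 2 + v 1 x ^ 2) ≤ K2 * (u 1 x ^ 2 + v 1 x ^ 2) :=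
      mul_le_mul_of_nonneg_right hκK (by positivity)
    have n7 : 0 ≤ u 1 x ^ 2 + v 1 x ^ 2 := by positivity
    have n8 : 0 ≤ u 2 x ^ 2 + v 2 x ^ 2 := by positivity
    have n9 : 0 ≤ a 0 x ^ 2 + b 0 x ^ 2 := by positivity
    have n10 : 0 ≤ a 2 x ^ 2 + b 2 x ^ 2 := by positivity
    rw [← hς]
    simp only [Nat.reduceAdd]
    linarith
  · -- second derivative
    rw [← hE, ← hH]
    have hF := (((D 1 1).cmul (γ / 2)).add (D 3 2)).add ((D 0 1).cmul κ)
    have := int_le4 (c := 1) (c₁ := T ^ 4 / 2) (c₂ := T ^ 2 / 2 + 5) (c₃ := 1 / 2) (c₄ := 0)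
      hF (zD 3) (zD 1) eD hhD (zD 0) ?_
    · simpa [J] using this
    intro x
    have y1 := young (c := -τ) (B := T ^ 3) (by rw [abs_neg, hT3]) hTpos
      (v 1 x) (-u 1 x) (u 2 x) (v 2 x)
    have y2 := young (c := -(th x * Q x)) (B := 3) (by rw [abs_neg]; exact htQ x) one_pos
      (u 1 x) (v 1 x) (u 2 x) (v 2 x)
    have y3 := young (c := -1) (B := 1) (by simp) one_pos (a 1 x) (b 1 x) (u 2 x) (v 2 x)
    have g : T ^ 3 * (T / 2 * (v 1 x ^ 2 + (-u 1 x) ^ 2) + 1 / (2 * T) * (u 2 x ^ 2 + v 2 x ^ 2))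
        = T ^ 4 / 2 * (u 1 x ^ 2 + v 1 x ^ 2) + T ^ 2 / 2 * (u 2 x ^ 2 + v 2 x ^ 2) := by
      field_simp; ring
    rw [g] at y1
    have m1 : u 2 x * (γ * u 1 x - τ * v 1 x - u 2 x + (-(th x * Q x) * u 1 x + Q x * u 2 x)
      + u 4 x + κ * u 0 x) = u 2 x * a 1 x := by rw [h.eu x]
    have m2 : v 2 x * (γ * v 1 x + τ * u 1 x - v 2 x + (-(th x * Q x) * v 1 x + Q x * v 2 x)
      + v 4 x + κ * v 0 x) = v 2 x * b 1 x := by rw [h.ev x]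
    have n1 : 0 ≤ T ^ 2 * (u 1 x ^ 2 + v 1 x ^ 2) := by positivity
    have n2 : 0 ≤ T ^ 2 * (κ * (u 0 x ^ 2 + v 0 x ^ 2)) := by positivity
    have n3 : 0 ≤ κ * (u 0 x ^ 2 + v 0 x ^ 2) := by positivity
    have n4 : 0 ≤ κ * (u 1 x ^ 2 + v 1 x ^ 2) := by positivity
    have n5 : Q x * (u 2 x ^ 2 + v 2 x ^ 2) ≤ 3 * (u 2 x ^ 2 + v 2 x ^ 2) :=
      mul_le_mul_of_nonneg_right (Q_le x) (by positivity)
    have n7 : 0 ≤ u 1 x ^ 2 + v 1 x ^ 2 := by positivity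
    have n8 : 0 ≤ u 2 x ^ 2 + v 2 x ^ 2 := by positivity
    have n9 : 0 ≤ a 0 x ^ 2 + b 0 x ^ 2 := by positivity
    have n10 : 0 ≤ a 2 x ^ 2 + b 2 x ^ 2 := by positivity
    simp only [Nat.reduceAdd]
    linarith

lemma all_levels (γ K2 : ℝ) (hγ : 0 < γ) (hK : 0 < K2) : ∃ M, 0 < M ∧ ∀ s : ℕ, 1 ≤ s →
    ∃ C, 0 < C ∧ ∀ {τ κ : ℝ} {u v a b : ℕ → ℝ → ℝ}, Sys γ τ κ u v a b → 0 ≤ κ → κ ≤ K2 →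
      M ≤ |τ| → ∑ m ∈ Finset.range (s + 1), J u v (m + 1) ≤
        C * ∑ m ∈ Finset.range (s + 1 + 1), J a b m := by
  obtain ⟨M, C0, hM, hC0, hb⟩ := base γ K2 hγ hK
  refine ⟨M, hM, fun s hs => ?_⟩
  induction s, hs using Nat.le_induction with
  | base =>
    refine ⟨C0, hC0, fun h h1 h2 h3 => ?_⟩
    have := hb h h1 h2 h3
    simpa [Finset.sum_range_succ] using this
  | succ s hs ih =>
    obtain ⟨C, hC, ih⟩ := ih
    obtain ⟨C', hC', hst⟩ := step γ K2 hγ hK.le (s + 1) (by omega)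
    refine ⟨C + C' * (C + 1), by positivity, fun {τ κ u v a b} h h1 h2 h3 => ?_⟩
    have i1 := ih h h1 h2 h3
    have i2 := hst h h1 h2
    rw [Finset.sum_range_succ, Finset.sum_range_succ _ (s + 1 + 1)]
    have n1 := J_nonneg a b (s + 1 + 1)
    have n2 : 0 ≤ ∑ m ∈ Finset.range (s + 1 + 1), J a b m :=
      Finset.sum_nonneg fun m _ => J_nonneg _ _ _
    generalize ∑ m ∈ Finset.range (s + 1 + 1), J a b m = A at *
    generalize ∑ m ∈ Finset.range (s + 1), J u v (m + 1) = B at *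
    have i3 := mul_le_mul_of_nonneg_left i1 hC'.le
    have n3 : 0 ≤ C' * A := by positivity
    have n4 : 0 ≤ C' * (C * J a b (s + 1 + 1)) := by positivity
    have n5 : 0 ≤ C * J a b (s + 1 + 1) := by positivity
    linarith

/-! ### Passing from Schwartz functions to the real system -/

lemma schwartz_dc (f : SchwartzMap ℝ ℂ) : Dc (fun x => (f x).re) ∧ Dc (fun x => (f x).im) := by
  obtain ⟨C0, _, h0⟩ := f.decay 0 0
  obtain ⟨C2, _, h2⟩ := f.decay 2 0
  have key : ∀ x, ‖f x‖ * (1 + x ^ 2) ≤ C0 + C2 := by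
    intro x
    have a := h0 x
    have b := h2 x
    rw [norm_iteratedFDeriv_zero] at a b
    rw [Real.norm_eq_abs, sq_abs] at b
    simp only [pow_zero, one_mul] at a
    linarith
  have hc := f.continuous
  exact ⟨⟨Complex.continuous_re.comp hc, C0 + C2, fun x =>
      (mul_le_mul_of_nonneg_right (Complex.abs_re_le_norm _) (by positivity)).trans (key x)⟩,
    ⟨Complex.continuous_im.comp hc, C0 + C2, fun x =>
      (mul_le_mul_of_nonneg_right (Complex.abs_im_le_norm _) (by positivity)).trans (key x)⟩⟩

lemma schwartz_iter (f : SchwartzMap ℝ ℂ) (n : ℕ) :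
    ∃ g : SchwartzMap ℝ ℂ, (⇑g) = iteratedDeriv n (⇑f) := by
  induction n with
  | zero => exact ⟨f, by simp⟩
  | succ n ih =>
    obtain ⟨g, hg⟩ := ih
    refine ⟨SchwartzMap.derivCLM ℝ ℂ g, ?_⟩
    funext x
    rw [SchwartzMap.derivCLM_apply, iteratedDeriv_succ, hg]

lemma schwartz_der (f : SchwartzMap ℝ ℂ) (n : ℕ) (x : ℝ) :
    HasDerivAt (iteratedDeriv n (⇑f)) (iteratedDeriv (n + 1) (⇑f) x) x := by
  obtain ⟨g, hg⟩ := schwartz_iter f n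
  rw [iteratedDeriv_succ, ← hg]
  exact g.hasDerivAt x

lemma hasDerivAt_re {f : ℝ → ℂ} {f' : ℂ} {x : ℝ} (h : HasDerivAt f f' x) :
    HasDerivAt (fun y => (f y).re) f'.re x :=
  (Complex.reCLM.hasFDerivAt.comp_hasDerivAt x h)

lemma hasDerivAt_im {f : ℝ → ℂ} {f' : ℂ} {x : ℝ} (h : HasDerivAt f f' x) :
    HasDerivAt (fun y => (f y).im) f'.im x :=
  (Complex.imCLM.hasFDerivAt.comp_hasDerivAt x h)

lemma schwartz_sq (f : SchwartzMap ℝ ℂ) : Sq (fun n x => (iteratedDeriv n (⇑f) x).re) ∧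
    Sq (fun n x => (iteratedDeriv n (⇑f) x).im) := by
  have hd : ∀ n, Dc (fun x => (iteratedDeriv n (⇑f) x).re) ∧
      Dc (fun x => (iteratedDeriv n (⇑f) x).im) := by
    intro n
    obtain ⟨g, hg⟩ := schwartz_iter f n
    rw [← hg]
    exact schwartz_dc g
  exact ⟨fun n => ⟨fun x => hasDerivAt_re (schwartz_der f n x), (hd n).1, (hd (n + 1)).1⟩,
    fun n => ⟨fun x => hasDerivAt_im (schwartz_der f n x), (hd n).2, (hd (n + 1)).2⟩⟩

lemma hs_eq (f : ℝ → ℂ) (n : ℕ) : ∫ x, ‖iteratedDeriv n f x‖ ^ 2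
    = J (fun n x => (iteratedDeriv n f x).re) (fun n x => (iteratedDeriv n f x).im) n := by
  unfold J
  congr 1
  funext x
  rw [← Complex.normSq_eq_norm_sq, Complex.normSq_apply]
  ring

lemma mk_sys {L γ τ : ℝ} {k : ℤ} {w W H : SchwartzMap ℝ ℂ} (h : ResolventEq L γ τ k w W H) :
    (∀ n, iteratedDeriv n (⇑w) = iteratedDeriv (n + 1) (⇑W)) ∧
    Sys γ τ ((k : ℝ) ^ 2 / L ^ 2) (fun n x => (iteratedDeriv n (⇑W) x).re)
      (fun n x => (iteratedDeriv n (⇑W) x).im) (fun n x => (iteratedDeriv n (⇑H) x).re)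
      (fun n x => (iteratedDeriv n (⇑H) x).im) := by
  obtain ⟨hW, hE⟩ := h
  have hw : ∀ n, iteratedDeriv n (⇑w) = iteratedDeriv (n + 1) (⇑W) := by
    intro n
    rw [iteratedDeriv_succ', show deriv (⇑W) = ⇑w from funext hW]
  refine ⟨hw, ?_⟩
  have hc : ∀ x, ((γ : ℂ) + τ * Complex.I) * iteratedDeriv 1 (⇑W) x - iteratedDeriv 2 (⇑W) x
      + (((-(th x * Q x) : ℝ) : ℂ) * iteratedDeriv 1 (⇑W) x + (Q x : ℂ) * iteratedDeriv 2 (⇑W) x)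
      + iteratedDeriv 4 (⇑W) x
      + (((k : ℝ) ^ 2 / L ^ 2 : ℝ) : ℂ) * iteratedDeriv 0 (⇑W) x = iteratedDeriv 1 (⇑H) x := by
    intro x
    have e := hE x
    have d : HasDerivAt (fun y : ℝ => (Q y : ℂ) * w y)
        (((-(th x * Q x) : ℝ) : ℂ) * w x + (Q x : ℂ) * deriv w x) x :=
      ((Q_hasDerivAt x).ofReal_comp).mul (w.hasDerivAt x)
    rw [d.deriv, hw 3] at e
    rw [← hw 1, ← hw 0, iteratedDeriv_one, iteratedDeriv_zero, iteratedDeriv_zero, iteratedDeriv_one]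
    exact e
  refine ⟨(schwartz_sq W).1, (schwartz_sq W).2, (schwartz_sq H).1, (schwartz_sq H).2,
    fun x => ?_, fun x => ?_⟩
  · have e := congrArg Complex.re (hc x)
    simp only [Complex.add_re, Complex.sub_re, Complex.mul_re, Complex.add_im, Complex.mul_im,
      Complex.ofReal_re, Complex.ofReal_im, Complex.I_re, Complex.I_im] at e
    linarith
  · have e := congrArg Complex.im (hc x)
    simp only [Complex.add_re, Complex.sub_im, Complex.mul_re, Complex.add_im, Complex.mul_im,
      Complex.ofReal_re, Complex.ofReal_im, Complex.I_re, Complex.I_im] at e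
    linarith

end KPI

/-- High-frequency resolvent estimate: for `|τ|` large,
`‖w‖²_{H^s} ≤ C ‖H‖²_{H^{s+1}}`, uniformly in `|k/L| ≤ K`. -/
theorem resolvent_estimate_high_frequency (L : ℝ) (hL : 0 < L) (s : ℕ) (hs : 1 ≤ s)
    (K γ₀ : ℝ) (hK : 0 < K) (hγ₀ : 0 < γ₀) :
    ∃ M C : ℝ, 0 < M ∧ 0 < C ∧
      ∀ τ : ℝ, M ≤ |τ| → ∀ k : ℤ, |(k : ℝ) / L| ≤ K →
        ∀ w W H : SchwartzMap ℝ ℂ, ResolventEq L γ₀ τ k (⇑w) (⇑W) (⇑H) →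
          HsSq s (⇑w) ≤ C * HsSq (s + 1) (⇑H) := by
  obtain ⟨M, hM, hall⟩ := KPI.all_levels γ₀ (K ^ 2) hγ₀ (by positivity)
  obtain ⟨C, hC, hmain⟩ := hall s hs
  refine ⟨M, C, hM, hC, fun τ hτ k hk w W H h => ?_⟩
  obtain ⟨hw, hsys⟩ := KPI.mk_sys h
  have hk2 : (k : ℝ) ^ 2 / L ^ 2 ≤ K ^ 2 := by
    rw [← div_pow, ← sq_abs]
    exact pow_le_pow_left₀ (abs_nonneg _) hk 2
  have := hmain hsys (by positivity) hk2 hτ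
  unfold HsSq
  simp only [hw, KPI.hs_eq]
  exact this
end
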